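/- Proposition (distortion of iterates of the first return map). For every f ∈ Bimod there exists a constant D₃ > 0 such that for every n ≥ 1 and every interval J ⊂ Int(𝕀) on which (T⁰)^n is defined and such that for each 0 ≤ k < n the return time N⁰ is finite and constant on (T⁰)^k(J), one has |D(T⁰)^n(x) / D(T⁰)^n(y)| ≤ 1 + D₃ · d((T⁰)^n(x), (T⁰)^n(y)) for all x, y ∈ J. -/

import Mathlib

open MeasureTheory Set Filter

noncomputable section

/-- Iterated fractional parts in the continued fraction algorithm:
`cfFrac ρ 0 = ρ - ⌊ρ⌋` and `cfFrac ρ (k+1) = 1/(cfFrac ρ k) - ⌊1/(cfFrac ρ k)⌋`. -/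
noncomputable def cfFrac (ρ : ℝ) : ℕ → ℝ
  | 0 => Int.fract ρ
  | n + 1 => Int.fract (1 / cfFrac ρ n)

/-- Partial quotients `a_k` of the continued fraction expansion of `ρ`. -/
noncomputable def cfA (ρ : ℝ) : ℕ → ℤ
  | 0 => ⌊ρ⌋
  | n + 1 => ⌊1 / cfFrac ρ n⌋

/-- Denominators `q_k` of the convergents of `ρ`:
`q_0 = 1`, `q_1 = a_1` (since `q_{-1} = 0`), `q_{k+1} = a_{k+1} q_k + q_{k-1}`. -/
noncomputable def cfQ (ρ : ℝ) : ℕ → ℕ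
  | 0 => 1
  | 1 => (cfA ρ 1).toNat
  | n + 2 => (cfA ρ (n + 2)).toNat * cfQ ρ (n + 1) + cfQ ρ n
/-- The class `Bimod` of degree one bimodal circle endomorphisms, given by the
circle map `f : 𝕋¹ → 𝕋¹` together with a lift `F : ℝ → ℝ` (`π ∘ F = f ∘ π`,
`F(x+1) = F(x)+1`), satisfying (A1) (`C²`, bimodal with non-flat critical points
`c̃⁺ < c̃⁻` of orders `ℓ⁺, ℓ⁻`), (A2) (the rotation numbers of the upper and lower
maps `F₊, F₋` are irrational) and (A3) (all periodic orbits are hyperbolic repelling). -/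
structure BimodData where
  /-- the lift -/
  F : ℝ → ℝ
  /-- the circle endomorphism -/
  f : UnitAddCircle → UnitAddCircle
  /-- lift of the critical point `c⁺` -/
  ctp : ℝ
  /-- lift of the critical point `c⁻` -/
  ctm : ℝ
  /-- `d̃⁺`, the second preimage of the critical value of `c⁺` -/
  dtp : ℝ
  /-- `d̃⁻`, the second preimage of the critical value of `c⁻` -/
  dtm : ℝ
  /-- the non-flatness order `ℓ⁺` -/
  lp : ℝ
  /-- the non-flatness order `ℓ⁻` -/
  lm : ℝ
  /-- the upper map `F₊` (a monotone degree one lift) -/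
  Fp : CircleDeg1Lift
  /-- the lower map `F₋` (a monotone degree one lift) -/
  Fm : CircleDeg1Lift
  /-- the diffeomorphism `ψ⁺` -/
  psip : ℝ → ℝ
  /-- the diffeomorphism `ψ⁻` -/
  psim : ℝ → ℝ
  hf : ∀ x : ℝ, f ((x : ℝ) : UnitAddCircle) = ((F x : ℝ) : UnitAddCircle)
  h0 : 0 < ctp
  h1 : ctp < ctm
  h2 : ctm < 1
  hlift : ∀ x, F (x + 1) = F x + 1
  hC2 : ContDiff ℝ 2 F
  hdecr : ∀ x ∈ Set.Ioo ctp ctm, deriv F x < 0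
  hincr : ∀ x ∈ Set.Ioo ctm (ctp + 1), 0 < deriv F x
  hlp : 1 < lp
  hlm : 1 < lm
  hpsipC2 : ContDiff ℝ 2 psip
  hpsipBij : Function.Bijective psip
  hpsipD : ∀ x, deriv psip x ≠ 0
  hpsip0 : psip ctp = 0
  hpsipEq : ∀ᶠ x in nhds ctp, F x = F ctp - |psip x| ^ lp
  hpsimC2 : ContDiff ℝ 2 psim
  hpsimBij : Function.Bijective psim
  hpsimD : ∀ x, deriv psim x ≠ 0
  hpsim0 : psim ctm = 0
  hpsimEq : ∀ᶠ x in nhds ctm, F x = F ctm + |psim x| ^ lm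
  hdtp : dtp ∈ Set.Ioo ctm (ctp + 1)
  hdtpF : F dtp = F ctp
  hFp1 : ∀ x ∈ Set.Icc ctp dtp, Fp x = F ctp
  hFp2 : ∀ x ∈ Set.Icc dtp (ctp + 1), Fp x = F x
  hdtm : dtm ∈ Set.Ioo (ctm - 1) ctp
  hdtmF : F dtm = F ctm
  hFm1 : ∀ x ∈ Set.Icc dtm ctm, Fm x = F ctm
  hFm2 : ∀ x ∈ Set.Icc ctm (dtm + 1), Fm x = F x
  hirrp : Irrational Fp.translationNumber
  hirrm : Irrational Fm.translationNumber
  hA3 : ∀ (x : ℝ) (n : ℕ), 1 ≤ n → (∃ m : ℤ, F^[n] x = x + (m : ℝ)) →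
    1 < |deriv (F^[n]) x|

namespace BimodData

/-- The critical point `c⁺ = π(c̃⁺)`. -/
noncomputable def cp (B : BimodData) : UnitAddCircle := ((B.ctp : ℝ) : UnitAddCircle)

/-- The critical point `c⁻ = π(c̃⁻)`. -/
noncomputable def cm (B : BimodData) : UnitAddCircle := ((B.ctm : ℝ) : UnitAddCircle)

/-- The interval `𝕀 = π([c̃⁺, c̃⁻])` on which `f` is decreasing. -/
def II (B : BimodData) : Set UnitAddCircle :=
  (fun x : ℝ => ((x : ℝ) : UnitAddCircle)) '' Set.Icc B.ctp B.ctm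

/-- The upper rotation number `ρ⁺`. -/
noncomputable def rhop (B : BimodData) : ℝ := B.Fp.translationNumber

/-- The lower rotation number `ρ⁻`. -/
noncomputable def rhom (B : BimodData) : ℝ := B.Fm.translationNumber

/-- Condition (C⁻): `Σ_{k≥0} q⁻_{2k+1} · d(f^{q⁻_{2k}}(c⁻), c⁻) < ∞`. -/
def CondCm (B : BimodData) : Prop :=
  Summable fun k : ℕ =>
    (cfQ B.rhom (2 * k + 1) : ℝ) * dist (B.f^[cfQ B.rhom (2 * k)] B.cm) B.cm

/-- Condition (C⁺): `Σ_{k≥1} q⁺_{2k} · d(f^{q⁺_{2k-1}}(c⁺), c⁺) < ∞`. -/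
def CondCp (B : BimodData) : Prop :=
  Summable fun k : ℕ =>
    (cfQ B.rhop (2 * k + 2) : ℝ) * dist (B.f^[cfQ B.rhop (2 * k + 1)] B.cp) B.cp

end BimodData

/-- The set of times `n ≥ 1` at which the orbit of `x` lies in `𝕀`. -/
def BimodData.returnSet (B : BimodData) (x : UnitAddCircle) : Set ℕ :=
  {n : ℕ | 1 ≤ n ∧ B.f^[n] x ∈ B.II}

/-- The first entry time `N⁰(x)` to `𝕀` (equal to `0` when the orbit of `x`
never enters `𝕀`). -/
noncomputable def BimodData.N0 (B : BimodData) (x : UnitAddCircle) : ℕ :=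
  sInf (B.returnSet x)

/-- The first entry map `T⁰(x) = f^{N⁰(x)}(x)` to `𝕀` (the first return map on `𝕀`). -/
noncomputable def BimodData.T0 (B : BimodData) (x : UnitAddCircle) : UnitAddCircle :=
  B.f^[B.N0 x] x

/-- The derivative of the circle endomorphism `f`, obtained by lifting the
(1-periodic) derivative of the lift `F` to the circle via the fundamental
domain `[0,1)`. -/
noncomputable def BimodData.Df (B : BimodData) : UnitAddCircle → ℝ :=
  AddCircle.liftIco 1 0 (deriv B.F)

/-- The derivative `Df^m(x)` of the `m`-th iterate of `f`, written via the chain rule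
as the product of the derivatives of `f` along the orbit. -/
noncomputable def BimodData.DfIter (B : BimodData) (m : ℕ) (x : UnitAddCircle) : ℝ :=
  ∏ j ∈ Finset.range m, B.Df (B.f^[j] x)

/-- The total number of iterates of `f` performed by `n` iterates of the first return
map `T⁰` starting at `x`, so that `(T⁰)^n(x) = f^{totalTime n x}(x)` and
`D(T⁰)^n(x) = Df^{totalTime n x}(x)`. -/
noncomputable def BimodData.totalTime (B : BimodData) (n : ℕ) (x : UnitAddCircle) : ℕ :=
  ∑ k ∈ Finset.range n, B.N0 (B.T0^[k] x)

/-- Composition `g i₁ ∘ ⋯ ∘ g iₙ` along a word. -/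
def wordMap {ι : Type*} (g : ι → ℝ → ℝ) : List ι → ℝ → ℝ
  | [], y => y
  | i :: w, y => g i (wordMap g w y)

/-- The derivative of `wordMap`, written via the chain rule. -/
def wordDeriv {ι : Type*} (g g' : ι → ℝ → ℝ) : List ι → ℝ → ℝ
  | [], _ => 1
  | i :: w, y => g' i (wordMap g w y) * wordDeriv g g' w y

/-- The sum of the absolute derivatives over all suffixes of a word. -/
def suffixSum {ι : Type*} (g g' : ι → ℝ → ℝ) : List ι → ℝ → ℝ
  | [], _ => 1
  | i :: w, y => |wordDeriv g g' (i :: w) y| + suffixSum g g' w y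

/-- The sum over all suffixes of the distances between the images of two points. -/
def suffixDist {ι : Type*} (g : ι → ℝ → ℝ) : List ι → ℝ → ℝ → ℝ
  | [], x, y => |x - y|
  | i :: w, x, y => |wordMap g (i :: w) x - wordMap g (i :: w) y| + suffixDist g w x y

/-- The inverse branches of a full-branch interval map on `[p, q]` with Lipschitz distortion
and hyperbolic periodic points. -/
structure BranchSystem {ι : Type*} (p q K : ℝ) (g g' : ι → ℝ → ℝ) : Prop where
  lt : p < q
  K_pos : 0 < K
  maps : ∀ i, ∀ y ∈ Icc p q, g i y ∈ Ioo p q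
  hasDeriv : ∀ i, ∀ y ∈ Icc p q, HasDerivAt (g i) (g' i y) y
  ne : ∀ i, ∀ y ∈ Icc p q, g' i y ≠ 0
  lip : ∀ i, ∀ x ∈ Icc p q, ∀ y ∈ Icc p q,
    |Real.log (g' i x) - Real.log (g' i y)| ≤ K * |x - y|
  disj : ∀ i j, ∀ x ∈ Icc p q, ∀ y ∈ Icc p q, g i x = g j y → i = j
  hyp : ∀ w : List ι, w ≠ [] → ∀ y ∈ Icc p q, wordMap g w y = y → |wordDeriv g g' w y| < 1

section words
variable {ι : Type*} {p q K : ℝ} {g g' : ι → ℝ → ℝ}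

lemma wordMap_append (u w : List ι) (y : ℝ) :
    wordMap g (u ++ w) y = wordMap g u (wordMap g w y) := by
  induction u with
  | nil => rfl
  | cons i u ih => simp [wordMap, ih]

lemma wordDeriv_append (u w : List ι) (y : ℝ) :
    wordDeriv g g' (u ++ w) y
      = wordDeriv g g' u (wordMap g w y) * wordDeriv g g' w y := by
  induction u with
  | nil => simp [wordDeriv]
  | cons i u ih => simp [wordDeriv, ih, wordMap_append, mul_assoc]

lemma suffixSum_nonneg (w : List ι) (y : ℝ) : 0 ≤ suffixSum g g' w y := by
  induction w with
  | nil => simp [suffixSum]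
  | cons i w ih => simp only [suffixSum]; positivity

lemma suffixDist_nonneg (w : List ι) (x y : ℝ) : 0 ≤ suffixDist g w x y := by
  induction w with
  | nil => simp [suffixDist]
  | cons i w ih => simp only [suffixDist]; positivity

lemma abs_wordDeriv_le_suffixSum (w : List ι) (y : ℝ) :
    |wordDeriv g g' w y| ≤ suffixSum g g' w y := by
  cases w with
  | nil => simp [suffixSum, wordDeriv]
  | cons i w => simpa [suffixSum] using suffixSum_nonneg w y

lemma suffixSum_append_le (u w : List ι) (y : ℝ) :
    suffixSum g g' (u ++ w) y
      ≤ suffixSum g g' w y + |wordDeriv g g' w y| * suffixSum g g' u (wordMap g w y) := by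
  induction u with
  | nil => simp [suffixSum]
  | cons i u ih =>
    have h := wordDeriv_append (g := g) (g' := g') (i :: u) w y
    simp only [List.cons_append] at h
    simp only [List.cons_append, suffixSum, h, abs_mul]
    linarith

lemma le_suffixSum_append (u w : List ι) (y : ℝ) :
    |wordDeriv g g' w y| * suffixSum g g' u (wordMap g w y) ≤ suffixSum g g' (u ++ w) y := by
  induction u with
  | nil => simpa [suffixSum] using abs_wordDeriv_le_suffixSum w y
  | cons i u ih =>
    have h := wordDeriv_append (g := g) (g' := g') (i :: u) w y
    simp only [List.cons_append] at h
    simp only [List.cons_append, suffixSum, h, abs_mul]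
    linarith

end words

namespace BranchSystem
variable {ι : Type*} {p q K : ℝ} {g g' : ι → ℝ → ℝ}

lemma word_mem (S : BranchSystem p q K g g') (w : List ι) {y : ℝ} (hy : y ∈ Icc p q) :
    wordMap g w y ∈ Icc p q := by
  induction w with
  | nil => exact hy
  | cons i w ih => exact Ioo_subset_Icc_self (S.maps i _ ih)

lemma word_hasDerivAt (S : BranchSystem p q K g g') (w : List ι) {y : ℝ} (hy : y ∈ Icc p q) :
    HasDerivAt (wordMap g w) (wordDeriv g g' w y) y := by
  induction w with
  | nil => exact hasDerivAt_id y
  | cons i w ih => exact (S.hasDeriv i _ (S.word_mem w hy)).comp y ih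

lemma word_continuousOn (S : BranchSystem p q K g g') (w : List ι) :
    ContinuousOn (wordMap g w) (Icc p q) := fun _ hy =>
  (S.word_hasDerivAt w hy).continuousAt.continuousWithinAt

lemma wordDeriv_ne (S : BranchSystem p q K g g') (w : List ι) {y : ℝ} (hy : y ∈ Icc p q) :
    wordDeriv g g' w y ≠ 0 := by
  induction w with
  | nil => simp [wordDeriv]
  | cons i w ih => exact mul_ne_zero (S.ne i _ (S.word_mem w hy)) ih

/-- Mean value theorem for words. -/
lemma word_mvt (S : BranchSystem p q K g g') (w : List ι) {x y : ℝ} (hx : x ∈ Icc p q)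
    (hy : y ∈ Icc p q) :
    ∃ z ∈ uIcc x y, |wordMap g w x - wordMap g w y| = |wordDeriv g g' w z| * |x - y| := by
  wlog h : x < y generalizing x y
  · rcases (not_lt.1 h).eq_or_lt with h | h
    · subst h; exact ⟨y, by simp, by simp⟩
    · obtain ⟨z, hz, e⟩ := this hy hx h
      exact ⟨z, by rwa [uIcc_comm], by rw [abs_sub_comm, e, abs_sub_comm y x]⟩
  have hs : Icc x y ⊆ Icc p q := Icc_subset_Icc hx.1 hy.2
  obtain ⟨z, hz, e⟩ := exists_hasDerivAt_eq_slope (wordMap g w) (wordDeriv g g' w) h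
    ((S.word_continuousOn w).mono hs)
    (fun t ht => S.word_hasDerivAt w (hs (Ioo_subset_Icc_self ht)))
  refine ⟨z, by rw [uIcc_of_le h.le]; exact Ioo_subset_Icc_self hz, ?_⟩
  have : y - x ≠ 0 := (sub_pos.2 h).ne'
  rw [e, abs_sub_comm, abs_sub_comm x y, ← abs_mul]
  congr 1
  field_simp

lemma word_injOn (S : BranchSystem p q K g g') (w : List ι) {x y : ℝ} (hx : x ∈ Icc p q)
    (hy : y ∈ Icc p q) (h : wordMap g w x = wordMap g w y) : x = y := by
  obtain ⟨z, hz, e⟩ := S.word_mvt w hx hy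
  rw [h, sub_self, abs_zero, eq_comm, mul_eq_zero, abs_eq_zero, abs_eq_zero, sub_eq_zero] at e
  exact e.resolve_left (S.wordDeriv_ne w (uIcc_subset_Icc hx hy hz))

lemma log_cons_le (S : BranchSystem p q K g g') (i : ι) (w : List ι) {x y : ℝ}
    (hx : x ∈ Icc p q) (hy : y ∈ Icc p q) :
    |Real.log (wordDeriv g g' (i :: w) x) - Real.log (wordDeriv g g' (i :: w) y)|
      ≤ K * suffixDist g w x y := by
  induction w generalizing i with
  | nil => simpa [wordDeriv, suffixDist, wordMap] using S.lip i x hx y hy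
  | cons j w ih =>
    have h1 := S.lip i _ (S.word_mem (j :: w) hx) _ (S.word_mem (j :: w) hy)
    have h2 := ih j
    rw [show wordDeriv g g' (i :: j :: w) x
        = g' i (wordMap g (j :: w) x) * wordDeriv g g' (j :: w) x from rfl,
      show wordDeriv g g' (i :: j :: w) y
        = g' i (wordMap g (j :: w) y) * wordDeriv g g' (j :: w) y from rfl,
      Real.log_mul (S.ne i _ (S.word_mem _ hx)) (S.wordDeriv_ne _ hx),
      Real.log_mul (S.ne i _ (S.word_mem _ hy)) (S.wordDeriv_ne _ hy)]
    simp only [suffixDist]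
    rw [abs_le] at *
    constructor <;> nlinarith [h1.1, h1.2, h2.1, h2.2]

lemma log_le (S : BranchSystem p q K g g') (w : List ι) {x y : ℝ}
    (hx : x ∈ Icc p q) (hy : y ∈ Icc p q) :
    |Real.log (wordDeriv g g' w x) - Real.log (wordDeriv g g' w y)|
      ≤ K * suffixDist g w x y := by
  cases w with
  | nil => simpa [wordDeriv, suffixDist] using mul_nonneg S.K_pos.le (abs_nonneg (x - y))
  | cons i w =>
    refine (S.log_cons_le i w hx hy).trans ?_
    have := S.K_pos
    simp only [suffixDist]
    gcongr
    simp

/-- Passing from a bound on a difference of logarithms to a bound on the ratio. -/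
lemma abs_le_of_log {a b L : ℝ} (ha : a ≠ 0) (hb : b ≠ 0)
    (h : |Real.log a - Real.log b| ≤ L) : |a| ≤ Real.exp L * |b| := by
  have h1 : Real.log |a| ≤ L + Real.log |b| := by
    rw [Real.log_abs, Real.log_abs]; linarith [(abs_le.1 h).2]
  calc |a| = Real.exp (Real.log |a|) := (Real.exp_log (abs_pos.2 ha)).symm
    _ ≤ Real.exp (L + Real.log |b|) := Real.exp_le_exp.2 h1
    _ = Real.exp L * |b| := by rw [Real.exp_add, Real.exp_log (abs_pos.2 hb)]

/-- Bootstrapped distortion control near a point where the suffix sum is bounded. -/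
lemma near_bound (S : BranchSystem p q K g g') (w : List ι) {c z₀ z : ℝ} (hz₀ : z₀ ∈ Icc p q)
    (hc : suffixSum g g' w z₀ ≤ c) (hz : z ∈ Icc p q)
    (hd : 2 * K * c * |z - z₀| ≤ Real.log 2) :
    |wordDeriv g g' w z| ≤ 2 * |wordDeriv g g' w z₀| ∧
      |wordDeriv g g' w z₀| ≤ 2 * |wordDeriv g g' w z| ∧
      suffixDist g w z z₀ ≤ 2 * suffixSum g g' w z₀ * |z - z₀| ∧
      suffixSum g g' w z ≤ 2 * suffixSum g g' w z₀ := by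
  induction w generalizing z with
  | nil =>
    simp only [wordDeriv, suffixDist, suffixSum]
    norm_num
    linarith [abs_nonneg (z - z₀)]
  | cons i w ih =>
    have hc' : suffixSum g g' w z₀ ≤ c := by
      simp only [suffixSum] at hc; linarith [abs_nonneg (wordDeriv g g' (i :: w) z₀)]
    have key : ∀ t ∈ Icc p q, 2 * K * c * |t - z₀| ≤ Real.log 2 →
        |Real.log (wordDeriv g g' (i :: w) t) - Real.log (wordDeriv g g' (i :: w) z₀)|
          ≤ Real.log 2 := by
      intro t ht htd
      obtain ⟨-, -, h3, -⟩ := ih hc' ht htd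
      refine (S.log_cons_le i w ht hz₀).trans ((mul_le_mul_of_nonneg_left h3 S.K_pos.le).trans ?_)
      refine le_trans ?_ htd
      have := mul_le_mul_of_nonneg_right hc' (abs_nonneg (t - z₀))
      nlinarith [S.K_pos]
    have h2 : ∀ t ∈ Icc p q, 2 * K * c * |t - z₀| ≤ Real.log 2 →
        |wordDeriv g g' (i :: w) t| ≤ 2 * |wordDeriv g g' (i :: w) z₀| := by
      intro t ht htd
      simpa [Real.exp_log] using
        abs_le_of_log (S.wordDeriv_ne _ ht) (S.wordDeriv_ne _ hz₀) (key t ht htd)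
    have h2' : |wordDeriv g g' (i :: w) z₀| ≤ 2 * |wordDeriv g g' (i :: w) z| := by
      have := key z hz hd
      rw [abs_sub_comm] at this
      simpa [Real.exp_log] using
        abs_le_of_log (S.wordDeriv_ne _ hz₀) (S.wordDeriv_ne _ hz) this
    obtain ⟨-, -, h3, h4⟩ := ih hc' hz hd
    refine ⟨h2 z hz hd, h2', ?_, ?_⟩
    · obtain ⟨t, ht, e⟩ := S.word_mvt (i :: w) hz hz₀
      have hcn : 0 ≤ c := (suffixSum_nonneg w z₀).trans hc'
      have htz : |t - z₀| ≤ |z - z₀| := by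
        rw [uIcc_comm] at ht
        exact abs_sub_left_of_mem_uIcc ht
      have := h2 t (uIcc_subset_Icc hz hz₀ ht) (le_trans (by
        have := S.K_pos
        gcongr) hd)
      simp only [suffixDist, suffixSum]
      rw [e]
      nlinarith [abs_nonneg (z - z₀)]
    · simp only [suffixSum]
      linarith [h2 z hz hd]

/-- Images of two words can only meet if one word is a prefix of the other. -/
lemma prefix_of_eq (S : BranchSystem p q K g g') (s t : List ι) {x y : ℝ} (hx : x ∈ Icc p q)
    (hy : y ∈ Icc p q) (hl : s.length ≤ t.length) (h : wordMap g s x = wordMap g t y) :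
    ∃ r, t = s ++ r ∧ x = wordMap g r y := by
  induction s generalizing t with
  | nil => exact ⟨t, rfl, h⟩
  | cons i s ih =>
    cases t with
    | nil => simp at hl
    | cons j t =>
      have hij : i = j := S.disj i j _ (S.word_mem s hx) _ (S.word_mem t hy) h
      subst hij
      have h' : wordMap g s x = wordMap g t y :=
        S.word_injOn [i] (S.word_mem s hx) (S.word_mem t hy) h
      obtain ⟨r, rfl, e⟩ := ih t (by simpa using hl) h'
      exact ⟨r, rfl, e⟩

/-- A uniform bound on the suffix sums gives a Lipschitz bound on the suffix distances. -/
lemma suffixDist_le (S : BranchSystem p q K g g') (w : List ι) {C x y : ℝ}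
    (hC : ∀ z ∈ Icc p q, suffixSum g g' w z ≤ C) (hx : x ∈ Icc p q) (hy : y ∈ Icc p q) :
    suffixDist g w x y ≤ C * |x - y| := by
  have key : ∀ w : List ι, ∃ φ φ' : ℝ → ℝ, (∀ t ∈ Icc p q, HasDerivAt φ (φ' t) t) ∧
      (∀ t, |φ' t| ≤ suffixSum g g' w t) ∧ φ x - φ y = suffixDist g w x y := by
    intro w
    have aux : ∀ a : ℝ, ∃ ε : ℝ, |ε| = 1 ∧ ε * a = |a| := fun a => by
      rcases le_total 0 a with h | h
      · exact ⟨1, by simp, by simp [abs_of_nonneg h]⟩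
      · exact ⟨-1, by simp, by simp [abs_of_nonpos h]⟩
    induction w with
    | nil =>
      obtain ⟨ε, h1, h2⟩ := aux (x - y)
      refine ⟨fun t => ε * t, fun _ => ε, fun t _ => by simpa using (hasDerivAt_id t).const_mul ε,
        fun t => by simp [h1, suffixSum], ?_⟩
      simp only [suffixDist]; rw [← h2]; ring
    | cons i w ih =>
      obtain ⟨φ, φ', d1, d2, d3⟩ := ih
      obtain ⟨ε, h1, h2⟩ := aux (wordMap g (i :: w) x - wordMap g (i :: w) y)
      refine ⟨fun t => ε * wordMap g (i :: w) t + φ t,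
        fun t => ε * wordDeriv g g' (i :: w) t + φ' t,
        fun t ht => ((S.word_hasDerivAt (i :: w) ht).const_mul ε).add (d1 t ht), fun t => ?_, ?_⟩
      · refine (abs_add_le _ _).trans ?_
        rw [abs_mul, h1, one_mul]
        exact add_le_add le_rfl (d2 t)
      · simp only [suffixDist]; rw [← h2, ← d3]; ring
  obtain ⟨φ, φ', d1, d2, d3⟩ := key w
  have := (convex_Icc p q).norm_image_sub_le_of_norm_hasDerivWithin_le
    (fun t ht => (d1 t ht).hasDerivWithinAt) (fun t ht => (d2 t).trans (hC t ht)) hy hx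
  rw [← d3]
  exact (le_abs_self _).trans this

end BranchSystem

/-- The union of the images of a set under all suffixes of a word. -/
def suffixUnion {ι : Type*} (g : ι → ℝ → ℝ) (Z : Set ℝ) : List ι → Set ℝ
  | [] => Z
  | i :: w => wordMap g (i :: w) '' Z ∪ suffixUnion g Z w

/-- No nonempty suffix of the word maps a point of `Z` into `Z`. -/
def NoReturn {ι : Type*} (g : ι → ℝ → ℝ) (Z : Set ℝ) (w : List ι) : Prop :=
  ∀ r, r ≠ [] → r <:+ w → ∀ x ∈ Z, wordMap g r x ∉ Z

section words
variable {ι : Type*} {g : ι → ℝ → ℝ}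

lemma exists_suffix_of_mem_suffixUnion {Z : Set ℝ} {w : List ι} {z : ℝ}
    (h : z ∈ suffixUnion g Z w) : ∃ s, s <:+ w ∧ ∃ x ∈ Z, wordMap g s x = z := by
  induction w with
  | nil => exact ⟨[], List.suffix_rfl, z, h, rfl⟩
  | cons i w ih =>
    rcases h with ⟨x, hx, rfl⟩ | h
    · exact ⟨i :: w, List.suffix_rfl, x, hx, rfl⟩
    · obtain ⟨s, hs, x, hx, e⟩ := ih h
      exact ⟨s, hs.trans (List.suffix_cons i w), x, hx, e⟩

lemma NoReturn.mono {Z Z' : Set ℝ} {w : List ι} (h : NoReturn g Z w) (hZ : Z' ⊆ Z) :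
    NoReturn g Z' w := fun r hr hs x hx hm => h r hr hs x (hZ hx) (hZ hm)

lemma NoReturn.suffix {Z : Set ℝ} {w v : List ι} (h : NoReturn g Z w) (hv : v <:+ w) :
    NoReturn g Z v := fun r hr hs => h r hr (hs.trans hv)

/-- Every word either never returns to `Z` or ends with a first return word. -/
lemma noReturn_or_exists (g : ι → ℝ → ℝ) (Z : Set ℝ) (w : List ι) :
    NoReturn g Z w ∨ ∃ w' i v, w = w' ++ (i :: v) ∧ NoReturn g Z v ∧
      ∃ x ∈ Z, wordMap g (i :: v) x ∈ Z := by
  induction w with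
  | nil =>
    left
    intro r hr hs
    exact absurd (List.suffix_nil.1 hs) hr
  | cons i w ih =>
    rcases ih with h | ⟨w', j, v, rfl, h1, h2⟩
    · by_cases hx : ∃ x ∈ Z, wordMap g (i :: w) x ∈ Z
      · exact Or.inr ⟨[], i, w, rfl, h, hx⟩
      · left
        push Not at hx
        intro r hr hs
        rcases List.suffix_cons_iff.1 hs with rfl | hs
        · exact hx
        · exact h r hr hs
    · exact Or.inr ⟨i :: w', j, v, rfl, h1, h2⟩

lemma suffixDist_comm (w : List ι) (x y : ℝ) : suffixDist g w x y = suffixDist g w y x := by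
  induction w with
  | nil => exact abs_sub_comm _ _
  | cons i w ih => simp only [suffixDist]; rw [ih, abs_sub_comm]

end words

namespace BranchSystem
variable {ι : Type*} {p q K : ℝ} {g g' : ι → ℝ → ℝ}

lemma measurableSet_image_Ico (S : BranchSystem p q K g g') (w : List ι) {a b : ℝ} (ha : p ≤ a)
    (hb : b ≤ q) : MeasurableSet (wordMap g w '' Ico a b) := by
  refine OrdConnected.measurableSet ?_
  exact (isPreconnected_Ico.image _ ((S.word_continuousOn w).mono
    (Ico_subset_Icc_self.trans (Icc_subset_Icc ha hb)))).ordConnected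

lemma le_volume_image_Ico (S : BranchSystem p q K g g') (w : List ι) {a b : ℝ} (ha : p ≤ a)
    (hab : a ≤ b) (hb : b ≤ q) :
    ENNReal.ofReal |wordMap g w a - wordMap g w b| ≤ volume (wordMap g w '' Ico a b) := by
  have hc := (S.word_continuousOn w).mono (Icc_subset_Icc ha hb)
  rcases le_total (wordMap g w a) (wordMap g w b) with h | h
  · rw [abs_sub_comm, abs_of_nonneg (sub_nonneg.2 h), ← Real.volume_Ioo]
    exact measure_mono ((intermediate_value_Ioo hab hc).trans (image_mono Ioo_subset_Ico_self))
  · rw [abs_of_nonneg (sub_nonneg.2 h), ← Real.volume_Ioo]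
    exact measure_mono ((intermediate_value_Ioo' hab hc).trans (image_mono Ioo_subset_Ico_self))

lemma suffixDist_le_volume (S : BranchSystem p q K g g') (w : List ι) {a b : ℝ} (ha : p ≤ a)
    (hab : a ≤ b) (hb : b ≤ q) (h : NoReturn g (Ico a b) w) :
    ENNReal.ofReal (suffixDist g w a b) ≤ volume (suffixUnion g (Ico a b) w) := by
  have hZ : Ico a b ⊆ Icc p q := Ico_subset_Icc_self.trans (Icc_subset_Icc ha hb)
  induction w with
  | nil =>
    simp only [suffixDist, suffixUnion]
    simpa [wordMap] using S.le_volume_image_Ico [] ha hab hb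
  | cons i w ih =>
    simp only [suffixDist, suffixUnion]
    rw [measure_union' _ (S.measurableSet_image_Ico _ ha hb),
      ENNReal.ofReal_add (abs_nonneg _) (suffixDist_nonneg _ _ _)]
    · exact add_le_add (S.le_volume_image_Ico _ ha hab hb)
        (ih (h.suffix (List.suffix_cons i w)))
    · rw [Set.disjoint_left]
      rintro _ ⟨y, hy, rfl⟩ hz
      obtain ⟨s, hs, x, hx, e⟩ := exists_suffix_of_mem_suffixUnion hz
      have hl := hs.length_le
      obtain ⟨r, hr, hxr⟩ := S.prefix_of_eq s (i :: w) (hZ hx) (hZ hy)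
        (by simp only [List.length_cons]; omega) e
      refine h r ?_ ⟨s, hr.symm⟩ y hy (hxr ▸ hx)
      rintro rfl
      simp only [List.append_nil] at hr
      rw [← hr] at hl
      simp at hl

lemma suffixDist_le_of_noReturn (S : BranchSystem p q K g g') (w : List ι) {a b x y : ℝ}
    (ha : p ≤ a) (hb : b ≤ q) (h : NoReturn g (Ico a b) w)
    (hx : x ∈ Icc a b) (hy : y ∈ Icc a b) : suffixDist g w x y ≤ q - p := by
  wlog hxy : x ≤ y generalizing x y
  · rw [suffixDist_comm]
    exact this hy hx (le_of_not_ge hxy)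
  have h1 := S.suffixDist_le_volume w (ha.trans hx.1) hxy (hy.2.trans hb)
    (h.mono (Ico_subset_Ico hx.1 hy.2))
  have h2 : suffixUnion g (Ico x y) w ⊆ Icc p q := by
    intro z hz
    obtain ⟨s, -, t, ht, rfl⟩ := exists_suffix_of_mem_suffixUnion hz
    exact S.word_mem s ⟨ha.trans (hx.1.trans ht.1), ht.2.le.trans (hy.2.trans hb)⟩
  have h3 := h1.trans (measure_mono h2)
  rw [Real.volume_Icc] at h3
  exact (ENNReal.ofReal_le_ofReal_iff (by linarith [S.lt])).1 h3

/-- Distortion of first return words. -/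
lemma cons_le_of_noReturn (S : BranchSystem p q K g g') (i : ι) (w : List ι) {a b x y : ℝ}
    (ha : p ≤ a) (hb : b ≤ q) (h : NoReturn g (Ico a b) w)
    (hx : x ∈ Icc a b) (hy : y ∈ Icc a b) :
    |wordDeriv g g' (i :: w) x| ≤ Real.exp (K * (q - p)) * |wordDeriv g g' (i :: w) y| := by
  have hI : Icc a b ⊆ Icc p q := Icc_subset_Icc ha hb
  refine abs_le_of_log (S.wordDeriv_ne _ (hI hx)) (S.wordDeriv_ne _ (hI hy))
    ((S.log_cons_le i w (hI hx) (hI hy)).trans ?_)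
  exact mul_le_mul_of_nonneg_left (S.suffixDist_le_of_noReturn w ha hb h hx hy) S.K_pos.le

lemma le_of_noReturn (S : BranchSystem p q K g g') (w : List ι) {a b x y : ℝ}
    (ha : p ≤ a) (hb : b ≤ q) (h : NoReturn g (Ico a b) w)
    (hx : x ∈ Icc a b) (hy : y ∈ Icc a b) :
    |wordDeriv g g' w x| ≤ Real.exp (K * (q - p)) * |wordDeriv g g' w y| := by
  have hI : Icc a b ⊆ Icc p q := Icc_subset_Icc ha hb
  refine abs_le_of_log (S.wordDeriv_ne _ (hI hx)) (S.wordDeriv_ne _ (hI hy))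
    ((S.log_le w (hI hx) (hI hy)).trans ?_)
  exact mul_le_mul_of_nonneg_left (S.suffixDist_le_of_noReturn w ha hb h hx hy) S.K_pos.le

lemma mul_le_of_bound (S : BranchSystem p q K g g') (u : List ι) {a b z M : ℝ}
    (ha : p ≤ a) (hab : a ≤ b) (hb : b ≤ q)
    (h : ∀ y ∈ Icc a b, |wordDeriv g g' u z| ≤ M * |wordDeriv g g' u y|) :
    |wordDeriv g g' u z| * (b - a) ≤ M * |wordMap g u a - wordMap g u b| := by
  obtain ⟨t, ht, e⟩ := S.word_mvt u (x := a) (y := b) ⟨ha, hab.trans hb⟩ ⟨ha.trans hab, hb⟩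
  rw [uIcc_of_le hab] at ht
  rw [e, abs_sub_comm, abs_of_nonneg (sub_nonneg.2 hab), ← mul_assoc]
  exact mul_le_mul_of_nonneg_right (h t ht) (sub_nonneg.2 hab)

lemma suffixSum_mul_le (S : BranchSystem p q K g g') (w : List ι) {a b z : ℝ}
    (ha : p ≤ a) (hb : b ≤ q) (h : NoReturn g (Ico a b) w) (hz : z ∈ Icc a b) :
    suffixSum g g' w z * (b - a) ≤ Real.exp (K * (q - p)) * (q - p) := by
  have hab := hz.1.trans hz.2
  have key : suffixSum g g' w z * (b - a) ≤ Real.exp (K * (q - p)) * suffixDist g w a b := by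
    induction w with
    | nil =>
      have := S.mul_le_of_bound [] (z := z) ha hab hb
          (fun y hy => S.le_of_noReturn [] ha hb h hz hy)
      simpa [suffixSum, suffixDist, wordDeriv, wordMap] using this
    | cons i w ih =>
      have := S.mul_le_of_bound (i :: w) (z := z) ha hab hb
        (fun y hy => S.le_of_noReturn _ ha hb h hz hy)
      have := ih (h.suffix (List.suffix_cons i w))
      simp only [suffixSum, suffixDist]
      linarith
  refine key.trans (mul_le_mul_of_nonneg_left ?_ (Real.exp_pos _).le)
  exact S.suffixDist_le_of_noReturn w ha hb h ⟨le_rfl, hab⟩ ⟨hab, le_rfl⟩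

lemma suffixSum_le_of_noReturn (S : BranchSystem p q K g g') (w : List ι) {a b z : ℝ}
    (ha : p ≤ a) (hab : a < b) (hb : b ≤ q) (h : NoReturn g (Ico a b) w) (hz : z ∈ Icc a b) :
    suffixSum g g' w z ≤ Real.exp (K * (q - p)) * (q - p) / (b - a) := by
  rw [le_div_iff₀ (by linarith)]
  exact S.suffixSum_mul_le w ha hb h hz

/-- Points at which the suffix sums are bounded. -/
def Bdd (_ : BranchSystem p q K g g') (z : ℝ) : Prop := ∃ c, ∀ w, suffixSum g g' w z ≤ c

lemma Bdd.word {S : BranchSystem p q K g g'} {z : ℝ} (h : S.Bdd z) (hz : z ∈ Icc p q)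
    (u : List ι) : S.Bdd (wordMap g u z) := by
  obtain ⟨c, hc⟩ := h
  refine ⟨c / |wordDeriv g g' u z|, fun w => ?_⟩
  rw [le_div_iff₀' (abs_pos.2 (S.wordDeriv_ne u hz))]
  exact (le_suffixSum_append w u z).trans (hc _)

lemma Bdd.nhds {S : BranchSystem p q K g g'} {z : ℝ} (h : S.Bdd z) (hz : z ∈ Icc p q) :
    ∃ c, ∃ δ > 0, ∀ x ∈ Icc p q, |x - z| < δ → ∀ w, suffixSum g g' w x ≤ c := by
  obtain ⟨c, hc⟩ := h
  have hK := S.K_pos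
  have hc0 : 0 < c := by
    have := hc []
    simp only [suffixSum] at this
    linarith
  refine ⟨2 * c, Real.log 2 / (2 * K * c), by have := Real.log_pos one_lt_two; positivity,
    fun x hx hd w => ?_⟩
  have := (S.near_bound w hz (hc w) hx (by
    rw [lt_div_iff₀' (by positivity)] at hd
    exact hd.le)).2.2.2
  linarith [hc w]

lemma exists_bound_of_isCompact (S : BranchSystem p q K g g') {s : Set ℝ} (hs : IsCompact s)
    (hsub : s ⊆ Icc p q) (hB : ∀ z ∈ s, S.Bdd z) :
    ∃ c, ∀ z ∈ s, ∀ w, suffixSum g g' w z ≤ c := by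
  refine hs.induction_on (p := fun t => ∃ c, ∀ z ∈ t, ∀ w, suffixSum g g' w z ≤ c)
    ⟨0, by simp⟩ ?_ ?_ ?_
  · rintro s t hst ⟨c, hc⟩
    exact ⟨c, fun z hz => hc z (hst hz)⟩
  · rintro s t ⟨c, hc⟩ ⟨d, hd⟩
    refine ⟨max c d, ?_⟩
    rintro z (hz | hz) w
    · exact (hc z hz w).trans (le_max_left _ _)
    · exact (hd z hz w).trans (le_max_right _ _)
  · intro z hz
    obtain ⟨c, δ, hδ, h⟩ := (hB z hz).nhds (hsub hz)
    refine ⟨s ∩ Metric.ball z δ, ?_, c, fun x hx => h x (hsub hx.1) hx.2⟩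
    exact inter_mem_nhdsWithin _ (Metric.ball_mem_nhds z hδ)

lemma abs_cons_le_of_noReturn (S : BranchSystem p q K g g') (i : ι) (v : List ι) {a b z : ℝ}
    (ha : p ≤ a) (hab : a < b) (hb : b ≤ q) (h : NoReturn g (Ico a b) v) (hz : z ∈ Icc a b) :
    |wordDeriv g g' (i :: v) z| ≤ Real.exp (K * (q - p)) * (q - p) / (b - a) := by
  rw [le_div_iff₀ (by linarith)]
  refine (S.mul_le_of_bound (i :: v) ha hab.le hb
    (fun y hy => S.cons_le_of_noReturn i v ha hb h hz hy)).trans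
    (mul_le_mul_of_nonneg_left ?_ (Real.exp_pos _).le)
  have m1 := S.word_mem (i :: v) (y := a) ⟨ha, hab.le.trans hb⟩
  have m2 := S.word_mem (i :: v) (y := b) ⟨ha.trans hab.le, hb⟩
  rw [abs_le]
  constructor <;> linarith [m1.1, m1.2, m2.1, m2.2]

/-- The estimate obtained by splitting off a first return word. -/
lemma suffixSum_append_cons_le (S : BranchSystem p q K g g') (w' v : List ι) (i : ι) {a b z : ℝ}
    (ha : p ≤ a) (hab : a < b) (hb : b ≤ q) (h : NoReturn g (Ico a b) v) (hz : z ∈ Icc a b) :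
    suffixSum g g' (w' ++ i :: v) z ≤ 2 * (Real.exp (K * (q - p)) * (q - p) / (b - a))
      + |wordDeriv g g' (i :: v) z| * suffixSum g g' w' (wordMap g (i :: v) z) := by
  have h1 := suffixSum_append_le (g := g) (g' := g') w' (i :: v) z
  have h2 := S.suffixSum_le_of_noReturn v ha hab hb h hz
  have h3 := S.abs_cons_le_of_noReturn i v ha hab hb h hz
  simp only [suffixSum] at h1
  linarith

end BranchSystem

/-- The prefix of length `n` of an infinite word. -/
def initWord {ι : Type*} (a : ℕ → ι) (n : ℕ) : List ι := (List.range n).map a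

section
variable {ι : Type*}

lemma initWord_length (a : ℕ → ι) (n : ℕ) : (initWord a n).length = n := by simp [initWord]

lemma initWord_succ (a : ℕ → ι) (n : ℕ) : initWord a (n + 1) = initWord a n ++ [a n] := by
  simp [initWord, List.range_succ]

lemma initWord_add (a : ℕ → ι) (k n : ℕ) :
    initWord a (k + n) = initWord a k ++ initWord (fun j => a (k + j)) n := by
  induction n with
  | zero => simp [initWord]
  | succ n ih => rw [← add_assoc, initWord_succ, ih, initWord_succ, List.append_assoc]

end

/-- A function vanishing at `x` with negative derivative is positive just before `x`. -/
lemma exists_pos_left_of_hasDerivAt_neg {φ : ℝ → ℝ} {x d a : ℝ} (h : HasDerivAt φ d x) (hd : d < 0)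
    (h0 : φ x = 0) (ha : a < x) : ∃ y ∈ Ioo a x, 0 < φ y := by
  have h1 := (hasDerivAt_iff_tendsto_slope.1 h).eventually (gt_mem_nhds hd)
  have h2 : ∀ᶠ y in nhdsWithin x (Iio x), slope φ x y < 0 :=
    h1.filter_mono (nhdsWithin_mono _ fun y hy => ne_of_lt hy)
  obtain ⟨y, hy, hyI⟩ := (h2.and (Ioo_mem_nhdsLT ha)).exists
  refine ⟨y, hyI, ?_⟩
  rw [slope_def_field, h0, sub_zero] at hy
  by_contra hn
  exact absurd (div_nonneg_of_nonpos (not_lt.1 hn) (by linarith [hyI.2])) (not_le.2 hy)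

/-- A function vanishing at `x` with negative derivative is negative just after `x`. -/
lemma exists_neg_right_of_hasDerivAt_neg {φ : ℝ → ℝ} {x d b : ℝ} (h : HasDerivAt φ d x) (hd : d < 0)
    (h0 : φ x = 0) (hb : x < b) : ∃ y ∈ Ioo x b, φ y < 0 := by
  have h1 := (hasDerivAt_iff_tendsto_slope.1 h).eventually (gt_mem_nhds hd)
  have h2 : ∀ᶠ y in nhdsWithin x (Ioi x), slope φ x y < 0 :=
    h1.filter_mono (nhdsWithin_mono _ fun y hy => ne_of_gt hy)
  obtain ⟨y, hy, hyI⟩ := (h2.and (Ioo_mem_nhdsGT hb)).exists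
  refine ⟨y, hyI, ?_⟩
  rw [slope_def_field, h0, sub_zero] at hy
  by_contra hn
  exact absurd (div_nonneg (not_lt.1 hn) (by linarith [hyI.1])) (not_le.2 hy)

namespace BranchSystem
variable {ι : Type*} {p q K : ℝ} {g g' : ι → ℝ → ℝ}

lemma word_mono_or_anti (S : BranchSystem p q K g g') (w : List ι) :
    StrictMonoOn (wordMap g w) (Icc p q) ∨ StrictAntiOn (wordMap g w) (Icc p q) :=
  (S.word_continuousOn w).strictMonoOn_of_injOn_Icc' S.lt.le
    (fun _ hx _ hy h => S.word_injOn w hx hy h)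

lemma word_dist_add (S : BranchSystem p q K g g') (w : List ι) {x y z : ℝ} (hx : p ≤ x)
    (hxy : x ≤ y) (hyz : y ≤ z) (hz : z ≤ q) :
    |wordMap g w x - wordMap g w z|
      = |wordMap g w x - wordMap g w y| + |wordMap g w y - wordMap g w z| := by
  have mx : x ∈ Icc p q := ⟨hx, hxy.trans (hyz.trans hz)⟩
  have my : y ∈ Icc p q := ⟨hx.trans hxy, hyz.trans hz⟩
  have mz : z ∈ Icc p q := ⟨hx.trans (hxy.trans hyz), hz⟩
  rcases S.word_mono_or_anti w with h | h
  · have h1 := h.monotoneOn mx my hxy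
    have h2 := h.monotoneOn my mz hyz
    rw [abs_of_nonpos (by linarith), abs_of_nonpos (by linarith), abs_of_nonpos (by linarith)]
    ring
  · have h1 := h.antitoneOn mx my hxy
    have h2 := h.antitoneOn my mz hyz
    rw [abs_of_nonneg (by linarith), abs_of_nonneg (by linarith), abs_of_nonneg (by linarith)]
    ring

lemma word_dist_mono (S : BranchSystem p q K g g') (w : List ι) {a b x y : ℝ} (ha : p ≤ a)
    (hb : b ≤ q) (hx : x ∈ Icc a b) (hy : y ∈ Icc a b) :
    |wordMap g w x - wordMap g w y| ≤ |wordMap g w a - wordMap g w b| := by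
  wlog hxy : x ≤ y generalizing x y
  · rw [abs_sub_comm]; exact this hy hx (le_of_not_ge hxy)
  rw [S.word_dist_add w ha hx.1 (hxy.trans hy.2) hb,
    S.word_dist_add w (ha.trans hx.1) hxy hy.2 hb]
  linarith [abs_nonneg (wordMap g w a - wordMap g w x),
    abs_nonneg (wordMap g w y - wordMap g w b)]

/-- No nontrivial interval is mapped onto itself by a word fixing its right endpoint and
having a fixed point to the left. -/
lemma eq_of_fixed (S : BranchSystem p q K g g') {u : List ι} (hu : u ≠ []) {α β : ℝ}
    (hα : α ∈ Icc p q) (hβ : β ∈ Icc p q) (fα : wordMap g u α = α) (fβ : wordMap g u β = β) :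
    ¬ α < β := by
  intro hαβ
  set φ : ℝ → ℝ := fun x => wordMap g u x - x with hφ
  have hI : Icc α β ⊆ Icc p q := Icc_subset_Icc hα.1 hβ.2
  have hd : ∀ x ∈ Icc p q, HasDerivAt φ (wordDeriv g g' u x - 1) x := fun x hx =>
    (S.word_hasDerivAt u hx).sub (hasDerivAt_id x)
  have hneg : ∀ x ∈ Icc p q, φ x = 0 → wordDeriv g g' u x - 1 < 0 := fun x hx h0 => by
    linarith [(abs_lt.1 (S.hyp u hu x hx (sub_eq_zero.1 h0))).2]
  have zα : φ α = 0 := sub_eq_zero.2 fα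
  have zβ : φ β = 0 := sub_eq_zero.2 fβ
  obtain ⟨x₁, hx₁, hpos⟩ := exists_pos_left_of_hasDerivAt_neg (hd β hβ) (hneg β hβ zβ) zβ hαβ
  have hcont : ContinuousOn φ (Icc α x₁) := fun x hx =>
    (hd x (hI ⟨hx.1, hx.2.trans hx₁.2.le⟩)).continuousAt.continuousWithinAt
  have hcomp : IsCompact (Icc α x₁ ∩ φ ⁻¹' Iic 0) :=
    isCompact_Icc.of_isClosed_subset (hcont.preimage_isClosed_of_isClosed isClosed_Icc isClosed_Iic)
      inter_subset_left
  obtain ⟨s, ⟨hs1, hs2⟩, hmax⟩ := hcomp.exists_isGreatest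
    ⟨α, ⟨le_rfl, hx₁.1.le⟩, by simp [zα]⟩
  have hs2' : φ s ≤ 0 := hs2
  have hsx : s < x₁ := lt_of_le_of_ne hs1.2 (by rintro rfl; linarith)
  have hgt : ∀ y ∈ Ioc s x₁, 0 < φ y := by
    intro y hy
    by_contra hn
    exact absurd (hmax ⟨⟨hs1.1.trans hy.1.le, hy.2⟩, not_lt.1 hn⟩) (not_le.2 hy.1)
  have hsI : s ∈ Icc p q := hI ⟨hs1.1, hs1.2.trans hx₁.2.le⟩
  have hs0 : φ s = 0 := by
    refine le_antisymm hs2' ?_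
    have ht : Tendsto φ (nhdsWithin s (Ioi s)) (nhds (φ s)) :=
      (hd s hsI).continuousAt.tendsto.mono_left nhdsWithin_le_nhds
    refine ge_of_tendsto ht ?_
    filter_upwards [Ioc_mem_nhdsGT hsx] with y hy using (hgt y hy).le
  obtain ⟨y, hy, hyn⟩ := exists_neg_right_of_hasDerivAt_neg (hd s hsI) (hneg s hsI hs0) hs0 hsx
  linarith [hgt y ⟨hy.1, hy.2.le⟩]

/-- A nonempty word maps no nontrivial interval onto itself. -/
lemma not_image_eq (S : BranchSystem p q K g g') {r : List ι} (hr : r ≠ []) {α β : ℝ}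
    (hα : p ≤ α) (hαβ : α < β) (hβ : β ≤ q) (h : wordMap g r '' Icc α β = Icc α β) : False := by
  have mα : α ∈ Icc α β := ⟨le_rfl, hαβ.le⟩
  have mβ : β ∈ Icc α β := ⟨hαβ.le, le_rfl⟩
  have hI : Icc α β ⊆ Icc p q := Icc_subset_Icc hα hβ
  have e1 : wordMap g r α ∈ Icc α β := h ▸ mem_image_of_mem _ mα
  have e2 : wordMap g r β ∈ Icc α β := h ▸ mem_image_of_mem _ mβ
  obtain ⟨x, hx, ex⟩ : α ∈ wordMap g r '' Icc α β := h.ge mα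
  obtain ⟨y, hy, ey⟩ : β ∈ wordMap g r '' Icc α β := h.ge mβ
  have hrr : r ++ r ≠ [] := by simp [hr]
  refine S.eq_of_fixed hrr (hI mα) (hI mβ) ?_ ?_ hαβ <;> rw [wordMap_append] <;>
  rcases S.word_mono_or_anti r with hm | hm
  · have := le_antisymm ((hm.monotoneOn (hI mα) (hI hx) hx.1).trans_eq ex) e1.1
    rw [this, this]
  · have h1 := le_antisymm e1.2 (ey.symm.trans_le (hm.antitoneOn (hI mα) (hI hy) hy.1))
    have h2 := le_antisymm ((hm.antitoneOn (hI hx) (hI mβ) hx.2).trans_eq ex) e2.1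
    rw [h1, h2]
  · have := le_antisymm e2.2 (ey.symm.trans_le (hm.monotoneOn (hI hy) (hI mβ) hy.2))
    rw [this, this]
  · have h1 := le_antisymm e1.2 (ey.symm.trans_le (hm.antitoneOn (hI mα) (hI hy) hy.1))
    have h2 := le_antisymm ((hm.antitoneOn (hI hx) (hI mβ) hx.2).trans_eq ex) e2.1
    rw [h2, h1]

/-- Points of `[p, q]` whose itinerary is the given infinite word. -/
def fiber (_ : BranchSystem p q K g g') (a : ℕ → ι) : Set ℝ :=
  ⋂ n, wordMap g (initWord a n) '' Icc p q

lemma fiber_subset (S : BranchSystem p q K g g') (a : ℕ → ι) : S.fiber a ⊆ Icc p q := by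
  intro x hx
  obtain ⟨y, hy, rfl⟩ := mem_iInter.1 hx 0
  exact hy

lemma isClosed_image (S : BranchSystem p q K g g') (w : List ι) :
    IsClosed (wordMap g w '' Icc p q) :=
  (isCompact_Icc.image_of_continuousOn (S.word_continuousOn w)).isClosed

lemma fiber_ordConnected (S : BranchSystem p q K g g') (a : ℕ → ι) : (S.fiber a).OrdConnected :=
  ordConnected_iInter fun _ =>
    (isPreconnected_Icc.image _ (S.word_continuousOn _)).ordConnected

lemma fiber_isCompact (S : BranchSystem p q K g g') (a : ℕ → ι) : IsCompact (S.fiber a) :=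
  isCompact_Icc.of_isClosed_subset (isClosed_iInter fun _ => S.isClosed_image _) (S.fiber_subset a)

lemma image_append_subset (S : BranchSystem p q K g g') (u w : List ι) :
    wordMap g (u ++ w) '' Icc p q ⊆ wordMap g u '' Icc p q := by
  rintro _ ⟨y, hy, rfl⟩
  exact ⟨_, S.word_mem w hy, (wordMap_append u w y).symm⟩

lemma image_initWord_anti (S : BranchSystem p q K g g') (a : ℕ → ι) {m n : ℕ} (h : m ≤ n) :
    wordMap g (initWord a n) '' Icc p q ⊆ wordMap g (initWord a m) '' Icc p q := by
  obtain ⟨k, rfl⟩ := Nat.exists_eq_add_of_le h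
  rw [initWord_add]
  exact S.image_append_subset _ _

lemma mem_fiber_iff (S : BranchSystem p q K g g') (a : ℕ → ι) (k : ℕ) {y : ℝ}
    (hy : y ∈ Icc p q) :
    wordMap g (initWord a k) y ∈ S.fiber a ↔ y ∈ S.fiber fun j => a (k + j) := by
  constructor
  · intro h
    refine mem_iInter.2 fun n => ?_
    obtain ⟨z, hz, e⟩ := mem_iInter.1 h (k + n)
    rw [initWord_add, wordMap_append] at e
    exact ⟨z, hz, S.word_injOn _ (S.word_mem _ hz) hy e⟩
  · intro h
    refine mem_iInter.2 fun n => ?_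
    obtain ⟨z, hz, e⟩ := mem_iInter.1 h n
    refine S.image_initWord_anti a (Nat.le_add_left n k) ⟨z, hz, ?_⟩
    rw [initWord_add, wordMap_append, e]

lemma image_fiber (S : BranchSystem p q K g g') (a : ℕ → ι) (k : ℕ) :
    wordMap g (initWord a k) '' (S.fiber fun j => a (k + j)) = S.fiber a := by
  ext x
  constructor
  · rintro ⟨y, hy, rfl⟩
    exact (S.mem_fiber_iff a k (S.fiber_subset _ hy)).2 hy
  · intro hx
    obtain ⟨y, hy, rfl⟩ := mem_iInter.1 hx k
    exact ⟨y, (S.mem_fiber_iff a k hy).1 hx, rfl⟩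

lemma eq_of_mem_fiber (S : BranchSystem p q K g g') {a b : ℕ → ι} {x : ℝ}
    (ha : x ∈ S.fiber a) (hb : x ∈ S.fiber b) : a = b := by
  funext n
  obtain ⟨y, hy, e1⟩ := mem_iInter.1 ha (n + 1)
  obtain ⟨z, hz, e2⟩ := mem_iInter.1 hb (n + 1)
  obtain ⟨r, hr, -⟩ := S.prefix_of_eq _ _ hy hz (by simp [initWord_length]) (e1.trans e2.symm)
  have hl := congrArg List.length hr
  simp only [initWord_length, List.length_append] at hl
  obtain rfl : r = [] := List.length_eq_zero_iff.1 (by omega)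
  rw [List.append_nil, initWord_succ, initWord_succ] at hr
  have := (List.append_inj' hr rfl).2
  simpa using this.symm

/-- A word without return to `[a, b)` expands a definite neighbourhood of `[a, b]` at least
proportionally. -/
lemma le_dist_of_noReturn (S : BranchSystem p q K g g') (w : List ι) {a b z₀ z κ : ℝ}
    (ha : p ≤ a) (hab : a < b) (hb : b ≤ q) (h : NoReturn g (Ico a b) w) (hz₀ : z₀ ∈ Icc a b)
    (hz : z ∈ Icc p q) (hκ : 2 * K * (Real.exp (K * (q - p)) * (q - p)) * κ ≤ Real.log 2)
    (hd : |z₀ - z| = κ * (b - a)) :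
    κ * |wordMap g w a - wordMap g w b|
      ≤ 2 * Real.exp (K * (q - p)) * |wordMap g w z₀ - wordMap g w z| := by
  have hI : Icc a b ⊆ Icc p q := Icc_subset_Icc ha hb
  have hba : 0 < b - a := by linarith
  have hqp : 0 < q - p := by linarith [S.lt]
  have hK := S.K_pos
  obtain ⟨t, ht, et⟩ := S.word_mvt w (hI hz₀) hz
  obtain ⟨s, hs, es⟩ := S.word_mvt w (x := a) (y := b) (hI ⟨le_rfl, hab.le⟩) (hI ⟨hab.le, le_rfl⟩)
  rw [uIcc_of_le hab.le] at hs
  have hts : |t - z₀| ≤ |z₀ - z| := by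
    rw [abs_sub_comm z₀ z]; exact abs_sub_left_of_mem_uIcc ht
  have h1 := (S.near_bound w (hI hz₀) (S.suffixSum_le_of_noReturn w ha hab hb h hz₀)
    (uIcc_subset_Icc (hI hz₀) hz ht) (le_trans (by
      calc 2 * K * (Real.exp (K * (q - p)) * (q - p) / (b - a)) * |t - z₀|
          ≤ 2 * K * (Real.exp (K * (q - p)) * (q - p) / (b - a)) * (κ * (b - a)) := by
            rw [← hd]; gcongr
        _ = 2 * K * (Real.exp (K * (q - p)) * (q - p)) * κ := by field_simp) hκ)).2.1
  have h2 := S.le_of_noReturn w ha hb h hs hz₀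
  rw [abs_sub_comm a b, abs_of_pos hba] at es
  rw [es, et, hd]
  have hκ0 : 0 ≤ κ := by
    by_contra hn
    have := mul_neg_of_neg_of_pos (not_le.1 hn) hba
    linarith [abs_nonneg (z₀ - z)]
  have h3 : |wordDeriv g g' w s| ≤ Real.exp (K * (q - p)) * (2 * |wordDeriv g g' w t|) :=
    h2.trans (mul_le_mul_of_nonneg_left h1 (Real.exp_pos _).le)
  calc κ * (|wordDeriv g g' w s| * (b - a))
      ≤ κ * (Real.exp (K * (q - p)) * (2 * |wordDeriv g g' w t|) * (b - a)) := by gcongr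
    _ = _ := by ring

/-- There are no wandering intervals. -/
lemma fiber_subsingleton (S : BranchSystem p q K g g') (a : ℕ → ι) : (S.fiber a).Subsingleton := by
  by_contra hns
  rw [not_subsingleton_iff] at hns
  have hqp : 0 < q - p := by linarith [S.lt]
  have hK := S.K_pos
  set M := Real.exp (K * (q - p)) with hM
  have hMpos : 0 < M := Real.exp_pos _
  have hIcc : ∀ b : ℕ → ι, (S.fiber b).Nontrivial → ∃ l h, l < h ∧ S.fiber b = Icc l h := by
    intro b hb
    have := eq_Icc_of_connected_compact
      ⟨hb.nonempty, (S.fiber_ordConnected b).isPreconnected⟩ (S.fiber_isCompact b)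
    refine ⟨_, _, ?_, this⟩
    by_contra hn
    rw [this] at hb
    exact not_nontrivial_iff.2 (subsingleton_Icc_of_ge (not_lt.1 hn)) hb
  obtain ⟨α, β, hαβ, hfib⟩ := hIcc a hns
  have hnt : ∀ k, (S.fiber fun j => a (k + j)).Nontrivial := by
    intro k
    by_contra hn
    refine not_subsingleton_iff.2 hns ?_
    rw [← S.image_fiber a k]
    exact (not_nontrivial_iff.1 hn).image _
  choose lo hi hlt hH using fun k => hIcc _ (hnt k)
  have hlo : ∀ n, p ≤ lo n := fun n =>
    (S.fiber_subset _ ((hH n).ge ⟨le_rfl, (hlt n).le⟩)).1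
  have hhi : ∀ n, hi n ≤ q := fun n =>
    (S.fiber_subset _ ((hH n).ge ⟨(hlt n).le, le_rfl⟩)).2
  have hdisj : ∀ k n, k < n → ∀ x ∈ S.fiber (fun j => a (k + j)),
      x ∉ S.fiber fun j => a (n + j) := by
    intro k n hkn x hx hx'
    obtain ⟨d, rfl⟩ := Nat.exists_eq_add_of_lt hkn
    have hper := S.eq_of_mem_fiber hx hx'
    have him := S.image_fiber (fun j => a (k + j)) (d + 1)
    have e : (fun j => (fun j => a (k + j)) (d + 1 + j)) = fun j => a (k + j) := by
      rw [hper]; funext j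
      have := congrFun hper (d + 1 + j)
      simp only at this ⊢
      rw [← this]; congr 1; ring
    rw [e, hH k] at him
    exact S.not_image_eq (by simp [initWord]) (hlo k) (hlt k) (hhi k) him
  have hnr : ∀ n, NoReturn g (Ico (lo n) (hi n)) (initWord a n) := by
    rintro n r hr ⟨s, hs⟩ x hx hxr
    have hl := congrArg List.length hs
    simp only [List.length_append, initWord_length] at hl
    have hrl := List.length_pos_iff.2 hr
    obtain ⟨d, hd⟩ : ∃ d, n = s.length + d := ⟨r.length, hl.symm⟩
    have hr' : r = initWord (fun j => a (s.length + j)) d := by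
      rw [hd, initWord_add] at hs
      exact (List.append_inj hs (by simp [initWord_length])).2
    have hxf : x ∈ S.fiber fun j => a (n + j) := (hH n).ge (Ico_subset_Icc_self hx)
    have h1 : wordMap g r x ∈ S.fiber fun j => a (s.length + j) := by
      rw [hr', S.mem_fiber_iff _ _ (S.fiber_subset _ hxf)]
      convert hxf using 3 with j
      rw [hd, add_assoc]
    exact hdisj s.length n (by omega) _ h1 ((hH n).ge (Ico_subset_Icc_self hxr))
  obtain ⟨κ, hκ0, hκ4, hκ⟩ : ∃ κ : ℝ, 0 < κ ∧ κ ≤ 1 / 4 ∧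
      2 * K * (M * (q - p)) * κ ≤ Real.log 2 := by
    have hl := Real.log_pos one_lt_two
    refine ⟨min (1 / 4) (Real.log 2 / (2 * K * (M * (q - p)))), by positivity,
      min_le_left _ _, ?_⟩
    calc _ ≤ 2 * K * (M * (q - p)) * (Real.log 2 / (2 * K * (M * (q - p)))) := by
          gcongr; exact min_le_right _ _
      _ = _ := by field_simp
  set ρ := κ * (β - α) / (2 * M) with hρ
  have hρ0 : 0 < ρ := by have := sub_pos.2 hαβ; positivity
  obtain ⟨N, hN⟩ : ∃ N, wordMap g (initWord a N) '' Icc p q ⊆ Ioo (α - ρ / 2) (β + ρ / 2) := by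
    by_contra hn
    push Not at hn
    have hne := IsCompact.nonempty_iInter_of_sequence_nonempty_isCompact_isClosed
      (fun n => wordMap g (initWord a n) '' Icc p q ∩ (Ioo (α - ρ / 2) (β + ρ / 2))ᶜ)
      (fun n => inter_subset_inter_left _ (S.image_initWord_anti a n.le_succ))
      (fun n => by
        obtain ⟨x, hx, hx'⟩ := not_subset.1 (hn n)
        exact ⟨x, hx, hx'⟩)
      ((isCompact_Icc.image_of_continuousOn (S.word_continuousOn _)).inter_right
        isOpen_Ioo.isClosed_compl)
      (fun n => (S.isClosed_image _).inter isOpen_Ioo.isClosed_compl)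
    obtain ⟨x, hx⟩ := hne
    rw [mem_iInter] at hx
    have hxf : x ∈ S.fiber a := mem_iInter.2 fun n => (hx n).1
    rw [hfib] at hxf
    exact (hx 0).2 ⟨by linarith [hxf.1], by linarith [hxf.2]⟩
  have hlen : ∀ n, N ≤ n → ∀ x ∈ Icc p q, ∀ y ∈ Icc p q,
      |wordMap g (initWord a n) x - wordMap g (initWord a n) y| < β - α + ρ := by
    intro n hn x hx y hy
    have h1 := hN (S.image_initWord_anti a hn (mem_image_of_mem _ hx))
    have h2 := hN (S.image_initWord_anti a hn (mem_image_of_mem _ hy))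
    rw [abs_lt]
    constructor <;> linarith [h1.1, h1.2, h2.1, h2.2]
  have hfull : ∀ n, β - α ≤
      |wordMap g (initWord a n) (lo n) - wordMap g (initWord a n) (hi n)| := by
    intro n
    have him := S.image_fiber a n
    rw [hH n, hfib] at him
    obtain ⟨x, hx, ex⟩ := him.ge (left_mem_Icc.2 hαβ.le)
    obtain ⟨y, hy, ey⟩ := him.ge (right_mem_Icc.2 hαβ.le)
    have := S.word_dist_mono (initWord a n) (hlo n) (hhi n) hx hy
    rw [ex, ey, abs_sub_comm, abs_of_pos (sub_pos.2 hαβ)] at this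
    exact this
  have hexp : ∀ n, ∀ z₀ ∈ Icc (lo n) (hi n), ∀ z ∈ Icc p q, |z₀ - z| = κ * (hi n - lo n) →
      ρ ≤ |wordMap g (initWord a n) z₀ - wordMap g (initWord a n) z| := by
    intro n z₀ hz₀ z hz hd
    have h1 := S.le_dist_of_noReturn (initWord a n) (hlo n) (hlt n) (hhi n) (hnr n) hz₀ hz hκ hd
    rw [hρ, div_le_iff₀ (by positivity)]
    have h2 := mul_le_mul_of_nonneg_left (hfull n) hκ0.le
    linarith
  have hR : ∀ n, N ≤ n → q < hi n + κ * (hi n - lo n) := by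
    intro n hn
    by_contra hcon
    have hpos : 0 < κ * (hi n - lo n) := mul_pos hκ0 (sub_pos.2 (hlt n))
    have hz : hi n + κ * (hi n - lo n) ∈ Icc p q :=
      ⟨by linarith [hlo n, hlt n], not_lt.1 hcon⟩
    have h1 := hexp n (hi n) ⟨(hlt n).le, le_rfl⟩ _ hz (by
      rw [show hi n - (hi n + κ * (hi n - lo n)) = -(κ * (hi n - lo n)) by ring, abs_neg,
        abs_of_pos hpos])
    have h2 := S.word_dist_add (initWord a n) (hlo n) (hlt n).le
      (by linarith : hi n ≤ hi n + κ * (hi n - lo n)) hz.2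
    linarith [hfull n, hlen n hn _ ⟨hlo n, (hlt n).le.trans (hhi n)⟩ _ hz]
  have hL : ∀ n, N ≤ n → lo n - κ * (hi n - lo n) < p := by
    intro n hn
    by_contra hcon
    have hpos : 0 < κ * (hi n - lo n) := mul_pos hκ0 (sub_pos.2 (hlt n))
    have hz : lo n - κ * (hi n - lo n) ∈ Icc p q :=
      ⟨not_lt.1 hcon, by linarith [hhi n, hlt n]⟩
    have h1 := hexp n (lo n) ⟨le_rfl, (hlt n).le⟩ _ hz (by
      rw [show lo n - (lo n - κ * (hi n - lo n)) = κ * (hi n - lo n) by ring, abs_of_pos hpos])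
    have h2 := S.word_dist_add (initWord a n) hz.1
      (by linarith : lo n - κ * (hi n - lo n) ≤ lo n) (hlt n).le (hhi n)
    rw [abs_sub_comm] at h1
    linarith [hfull n, hlen n hn _ hz _ ⟨(hlo n).trans (hlt n).le, hhi n⟩]
  have hmid : ∀ n, N ≤ n → (p + q) / 2 ∈ S.fiber fun j => a (n + j) := by
    intro n hn
    rw [hH n]
    have h1 := hR n hn
    have h2 := hL n hn
    have h3 := mul_le_mul_of_nonneg_right hκ4 (sub_pos.2 (hlt n)).le
    constructor <;> linarith [hlo n, hhi n]
  exact hdisj N (N + 1) N.lt_succ_self _ (hmid N le_rfl) (hmid (N + 1) N.le_succ)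

/-- The images of long words are uniformly small. -/
lemma exists_length_small (S : BranchSystem p q K g g') {ε : ℝ} (hε : 0 < ε) :
    ∃ n₀ : ℕ, ∀ w : List ι, n₀ ≤ w.length →
      |wordMap g w p - wordMap g w q| < ε := by
  by_contra hcon
  push Not at hcon
  choose w hwl hwε using hcon
  have mp : p ∈ Icc p q := ⟨le_rfl, S.lt.le⟩
  have mq : q ∈ Icc p q := ⟨S.lt.le, le_rfl⟩
  set mid : ℕ → ℝ := fun n => (wordMap g (w n) p + wordMap g (w n) q) / 2 with hmid
  have hmI : ∀ n, mid n ∈ Icc p q := fun n => by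
    have h1 := S.word_mem (w n) mp
    have h2 := S.word_mem (w n) mq
    constructor <;> simp only [hmid] <;> linarith [h1.1, h1.2, h2.1, h2.2]
  obtain ⟨m, -, φ, hφ, hlim⟩ := isCompact_Icc.tendsto_subseq hmI
  have hball : ∀ n, Icc (mid n - ε / 2) (mid n + ε / 2) ⊆ wordMap g (w n) '' Icc p q := by
    intro n x hx
    have hsub := intermediate_value_uIcc (f := wordMap g (w n)) (a := p) (b := q)
      (by rw [uIcc_of_le S.lt.le]; exact S.word_continuousOn _)
    rw [uIcc_of_le S.lt.le] at hsub
    refine hsub ?_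
    rw [mem_uIcc]
    have := hwε n
    simp only [hmid] at hx
    rcases le_abs.1 this with h | h
    · right; constructor <;> linarith [hx.1, hx.2]
    · left; constructor <;> linarith [hx.1, hx.2]
  have hword : ∀ n, ∃ u : List ι, u.length = n ∧
      Icc (m - ε / 4) (m + ε / 4) ⊆ wordMap g u '' Icc p q := by
    intro n
    obtain ⟨k, hk, hkn⟩ := ((hlim.eventually (Metric.ball_mem_nhds m (by linarith : 0 < ε / 4))).and
      (eventually_ge_atTop n)).exists
    refine ⟨(w (φ k)).take n, ?_, ?_⟩
    · rw [List.length_take, min_eq_left]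
      exact hkn.trans ((hφ.id_le k).trans (hwl _))
    · have hd : |mid (φ k) - m| < ε / 4 := hk
      rw [abs_lt] at hd
      refine (Icc_subset_Icc (by linarith) (by linarith)).trans ((hball (φ k)).trans ?_)
      conv_lhs => rw [← List.take_append_drop n (w (φ k))]
      exact S.image_append_subset _ _
  choose u hul hu using hword
  have hmm : m ∈ Icc (m - ε / 4) (m + ε / 4) := ⟨by linarith, by linarith⟩
  have hstep : ∀ n, ∃ i, u (n + 1) = u n ++ [i] := by
    intro n
    obtain ⟨x, hx, ex⟩ := hu n hmm
    obtain ⟨y, hy, ey⟩ := hu (n + 1) hmm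
    obtain ⟨r, hr, -⟩ := S.prefix_of_eq (u n) (u (n + 1)) hx hy (by rw [hul, hul]; omega)
      (ex.trans ey.symm)
    have hl := congrArg List.length hr
    simp only [List.length_append, hul] at hl
    obtain ⟨i, rfl⟩ := List.length_eq_one_iff.1 (by omega : r.length = 1)
    exact ⟨i, hr⟩
  choose a ha using hstep
  have hua : ∀ n, u n = initWord a n := by
    intro n
    induction n with
    | zero => simpa [initWord] using hul 0
    | succ n ih => rw [ha, ih, initWord_succ]
  have hsub : Icc (m - ε / 4) (m + ε / 4) ⊆ S.fiber a := fun x hx =>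
    mem_iInter.2 fun n => hua n ▸ hu n hx
  have := S.fiber_subsingleton a (hsub (left_mem_Icc.2 (by linarith)))
    (hsub (right_mem_Icc.2 (by linarith)))
  linarith

lemma noReturn_nil (Z : Set ℝ) : NoReturn g Z [] := fun _ hr hs =>
  absurd (List.suffix_nil.1 hs) hr

lemma abs_deriv_mul_le (S : BranchSystem p q K g g') (i : ι) {z : ℝ} (hz : z ∈ Icc p q) :
    |g' i z| * (q - p) ≤ Real.exp (K * (q - p)) * |g i p - g i q| := by
  have := S.mul_le_of_bound [i] (z := z) le_rfl S.lt.le le_rfl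
    (fun y hy => S.cons_le_of_noReturn i [] le_rfl le_rfl (noReturn_nil _) hz hy)
  simpa [wordDeriv, wordMap] using this

lemma abs_deriv_le (S : BranchSystem p q K g g') (i : ι) {z : ℝ} (hz : z ∈ Icc p q) :
    |g' i z| ≤ Real.exp (K * (q - p)) := by
  have := S.abs_cons_le_of_noReturn i [] le_rfl S.lt le_rfl (noReturn_nil _) hz
  rw [mul_div_assoc, div_self (by linarith [S.lt]), mul_one] at this
  simpa [wordDeriv, wordMap] using this

lemma abs_wordDeriv_le_pow (S : BranchSystem p q K g g') (w : List ι) {z : ℝ} (hz : z ∈ Icc p q) :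
    |wordDeriv g g' w z| ≤ Real.exp (K * (q - p)) ^ w.length := by
  induction w with
  | nil => simp [wordDeriv]
  | cons i w ih =>
    rw [wordDeriv, abs_mul, List.length_cons, pow_succ']
    exact mul_le_mul (S.abs_deriv_le i (S.word_mem w hz)) ih (abs_nonneg _) (Real.exp_pos _).le

lemma continuousOn_abs_wordDeriv (S : BranchSystem p q K g g') (w : List ι) :
    ContinuousOn (fun z => |wordDeriv g g' w z|) (Icc p q) := by
  induction w with
  | nil => simpa [wordDeriv] using continuousOn_const
  | cons i w ih =>
    have h1 : ContinuousOn (fun z => Real.log (g' i z)) (Icc p q) := by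
      refine (LipschitzOnWith.of_dist_le_mul (K := ⟨K, S.K_pos.le⟩) ?_).continuousOn
      intro x hx y hy
      exact S.lip i x hx y hy
    have h2 : ContinuousOn (fun z => |g' i z|) (Icc p q) := by
      refine h1.rexp.congr fun z hz => ?_
      change |g' i z| = Real.exp (Real.log (g' i z))
      rw [← Real.log_abs, Real.exp_log (abs_pos.2 (S.ne i z hz))]
    simp only [wordDeriv, abs_mul]
    exact (h2.comp (S.word_continuousOn w) fun z hz => S.word_mem w hz).mul ih

/-- A small interval at the left endpoint which is a union of images of branches, up to
disjoint ones. -/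
lemma exists_nice (S : BranchSystem p q K g g') {e₀ : ℝ} (h0 : p < e₀) :
    ∃ e, p < e ∧ e ≤ e₀ ∧ ∀ j, ∀ x ∈ Icc p q, g j x < e → ∀ y ∈ Icc p q, g j y < e := by
  have hivt : ∀ j e, ∀ x ∈ Icc p q, ∀ y ∈ Icc p q, g j x < e → e ≤ g j y →
      ∃ t ∈ Icc p q, g j t = e := by
    intro j e x hx y hy h1 h2
    have hs : uIcc x y ⊆ Icc p q := uIcc_subset_Icc hx hy
    obtain ⟨t, ht, et⟩ := intermediate_value_uIcc (f := g j) (a := x) (b := y)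
      (fun t ht => (S.hasDeriv j t (hs ht)).continuousAt.continuousWithinAt)
      (mem_uIcc.2 (Or.inl ⟨h1.le, h2⟩))
    exact ⟨t, hs ht, et⟩
  by_cases h : ∃ i, ∃ x ∈ Icc p q, g i x = e₀
  · obtain ⟨i, x, hx, ex⟩ := h
    obtain ⟨z, hz, hmin⟩ := isCompact_Icc.exists_isMinOn (nonempty_Icc.2 S.lt.le)
      (S.word_continuousOn [i])
    refine ⟨g i z, (S.maps i z hz).1, (hmin hx).trans_eq ex, fun j a ha hae b hb => ?_⟩
    by_contra hn
    obtain ⟨t, ht, et⟩ := hivt j _ a ha b hb hae (not_lt.1 hn)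
    obtain rfl := S.disj j i t ht z hz et
    exact absurd (hmin ha) (not_le.2 hae)
  · push Not at h
    refine ⟨e₀, h0, le_rfl, fun j a ha hae b hb => ?_⟩
    by_contra hn
    obtain ⟨t, ht, et⟩ := hivt j _ a ha b hb hae (not_lt.1 hn)
    exact h j t ht et

lemma bdd_left (S : BranchSystem p q K g g') : S.Bdd p := by
  have hqp : 0 < q - p := by linarith [S.lt]
  have hK := S.K_pos
  set M := Real.exp (K * (q - p)) with hM
  have hMpos : 0 < M := Real.exp_pos _
  have hM1 : 1 ≤ M := Real.one_le_exp (by positivity)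
  set ε := (q - p) / (2 * M ^ 2) with hε
  have hεpos : 0 < ε := by positivity
  obtain ⟨n₀, hn₀⟩ := S.exists_length_small hεpos
  obtain ⟨e₀, he₀p, he₀⟩ : ∃ e₀, p < e₀ ∧ e₀ ≤ q ∧ (e₀ - p) * M ^ n₀ ≤ ε := by
    refine ⟨p + min (q - p) (ε / M ^ n₀), ?_, ?_, ?_⟩
    · have : 0 < min (q - p) (ε / M ^ n₀) := by positivity
      linarith
    · linarith [min_le_left (q - p) (ε / M ^ n₀)]
    · rw [add_sub_cancel_left, ← le_div_iff₀ (by positivity)]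
      exact min_le_right _ _
  obtain ⟨e, hpe, hee, hnice⟩ := S.exists_nice he₀p
  have heq : e ≤ q := hee.trans he₀.1
  have hI : Icc p e ⊆ Icc p q := Icc_subset_Icc le_rfl heq
  have hsmall : ∀ v : List ι, |wordMap g v p - wordMap g v e| ≤ ε := by
    intro v
    rcases le_total n₀ v.length with h | h
    · exact (S.word_dist_mono v le_rfl le_rfl ⟨le_rfl, S.lt.le⟩ ⟨hpe.le, heq⟩).trans
        (hn₀ v h).le
    · obtain ⟨t, ht, et⟩ := S.word_mvt v (x := p) (y := e) ⟨le_rfl, S.lt.le⟩ ⟨hpe.le, heq⟩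
      rw [uIcc_of_le hpe.le] at ht
      rw [et, abs_sub_comm p e, abs_of_pos (sub_pos.2 hpe)]
      calc _ ≤ M ^ v.length * (e₀ - p) :=
            mul_le_mul (S.abs_wordDeriv_le_pow v (hI ht)) (by linarith) (by linarith)
              (by positivity)
        _ ≤ M ^ n₀ * (e₀ - p) := by
            have : 0 ≤ e₀ - p := by linarith
            gcongr
        _ ≤ ε := by rw [mul_comm]; exact he₀.2
  set B := M * (q - p) / (e - p) with hB
  have hBpos : 0 < B := by have : 0 < e - p := by linarith
                           positivity
  have key : ∀ n, ∀ w : List ι, w.length ≤ n → ∀ z ∈ Ico p e, suffixSum g g' w z ≤ 4 * B := by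
    intro n
    induction n with
    | zero =>
      intro w hw z hz
      obtain rfl := List.length_eq_zero_iff.1 (Nat.le_zero.1 hw)
      have := S.suffixSum_le_of_noReturn [] le_rfl hpe heq (noReturn_nil _) (Ico_subset_Icc_self hz)
      linarith
    | succ n ih =>
      intro w hw z hz
      have hz' := Ico_subset_Icc_self hz
      rcases noReturn_or_exists g (Ico p e) w with h | ⟨w', i, v, rfl, hv, x, hx, hxu⟩
      · have := S.suffixSum_le_of_noReturn w le_rfl hpe heq h hz'
        linarith
      · have hin : ∀ y ∈ Icc p q, g i y ∈ Ico p e := fun y hy =>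
          ⟨(S.maps i y hy).1.le, hnice i _ (S.word_mem v (hI (Ico_subset_Icc_self hx))) hxu.2 y hy⟩
        have hs := S.suffixSum_append_cons_le w' v i le_rfl hpe heq hv hz'
        have hu : wordMap g (i :: v) z ∈ Ico p e := hin _ (S.word_mem v (hI hz'))
        have hw' : w'.length ≤ n := by
          simp only [List.length_append, List.length_cons] at hw; omega
        have h2 := ih w' hw' _ hu
        have hD : |wordDeriv g g' (i :: v) z| ≤ 1 / 2 := by
          have a1 := S.abs_deriv_mul_le i (S.word_mem v (hI hz'))
          have a2 := S.mul_le_of_bound v (z := z) le_rfl hpe.le heq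
            (fun y hy => S.le_of_noReturn v le_rfl heq hv hz' hy)
          have a3 : |g i p - g i q| ≤ e - p := by
            have m1 := hin p ⟨le_rfl, S.lt.le⟩
            have m2 := hin q ⟨S.lt.le, le_rfl⟩
            rw [abs_le]
            constructor <;> linarith [m1.1, m1.2, m2.1, m2.2]
          have a4 : |g' i (wordMap g v z)| * (q - p) ≤ M * (e - p) :=
            a1.trans (mul_le_mul_of_nonneg_left a3 hMpos.le)
          have a5 : |wordDeriv g g' v z| * (e - p) ≤ M * ε :=
            a2.trans (mul_le_mul_of_nonneg_left (hsmall v) hMpos.le)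
          have hep : 0 < e - p := by linarith
          have a6 := mul_le_mul a4 a5 (by positivity) (by positivity)
          rw [wordDeriv, abs_mul]
          have a7 : M * (e - p) * (M * ε) = 1 / 2 * ((q - p) * (e - p)) := by
            rw [hε]; field_simp
          have a8 : 0 < (q - p) * (e - p) := by positivity
          refine le_of_mul_le_mul_right ?_ a8
          linarith
        have h3 := mul_le_mul hD h2 (suffixSum_nonneg _ _) (by norm_num)
        linarith
  exact ⟨4 * B, fun w => key w.length w le_rfl p ⟨le_rfl, hpe⟩⟩

lemma finite_weak (S : BranchSystem p q K g g') {y : ℝ} (hpy : p < y) (hyq : y ≤ q) :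
    {u : List ι | ∃ i v, u = i :: v ∧ NoReturn g (Ico p y) v ∧
      ∃ z ∈ Icc p y, 1 / 2 < |wordDeriv g g' u z|}.Finite := by
  set W := {u : List ι | ∃ i v, u = i :: v ∧ NoReturn g (Ico p y) v ∧
      ∃ z ∈ Icc p y, 1 / 2 < |wordDeriv g g' u z|} with hW
  have hI : Ico p y ⊆ Icc p q := Ico_subset_Icc_self.trans (Icc_subset_Icc le_rfl hyq)
  have hM := Real.exp_pos (K * (q - p))
  have haux : ∀ u ∈ W, ∀ u' ∈ W, u.length ≤ u'.length → ∀ x ∈ Ico p y, ∀ x' ∈ Ico p y,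
      wordMap g u x = wordMap g u' x' → u = u' := by
    rintro u ⟨i, v, rfl, hv, -⟩ u' ⟨i', v', rfl, hv', -⟩ hl x hx x' hx' e
    obtain ⟨r, hr, hxr⟩ := S.prefix_of_eq _ _ (hI hx) (hI hx') hl e
    by_cases hr0 : r = []
    · rw [hr, hr0, List.append_nil]
    · have hr2 := hr
      simp only [List.cons_append, List.cons.injEq] at hr2
      exact absurd (hxr ▸ hx) (hv' r hr0 ⟨v, hr2.2.symm⟩ x' hx')
  have hdisj : Pairwise (Function.onFun Disjoint fun u : W => wordMap g u.1 '' Ico p y) := by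
    rintro ⟨u, hu⟩ ⟨u', hu'⟩ hne
    rw [Function.onFun, Set.disjoint_left]
    rintro _ ⟨x, hx, rfl⟩ ⟨x', hx', e⟩
    apply hne
    rcases le_total u.length u'.length with h | h
    · exact Subtype.ext (haux u hu u' hu' h x hx x' hx' e.symm)
    · exact Subtype.ext (haux u' hu' u hu h x' hx' x hx e).symm
  have hfin := Measure.finite_const_le_meas_of_disjoint_iUnion (volume : Measure ℝ)
    (ε := ENNReal.ofReal ((y - p) / (2 * Real.exp (K * (q - p)))))
    (ENNReal.ofReal_pos.2 (div_pos (by linarith) (by positivity)))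
    (fun u : W => S.measurableSet_image_Ico u.1 le_rfl hyq) hdisj
    (ne_top_of_le_ne_top (b := volume (Icc p q)) (by simp) (measure_mono (iUnion_subset fun u => by
      rintro _ ⟨x, hx, rfl⟩
      exact S.word_mem _ (hI hx))))
  have huniv : {u : W | ENNReal.ofReal ((y - p) / (2 * Real.exp (K * (q - p))))
      ≤ volume (wordMap g u.1 '' Ico p y)} = univ := by
    refine eq_univ_of_forall ?_
    rintro ⟨u, i, v, rfl, hv, z, hz, hzd⟩
    refine le_trans (ENNReal.ofReal_le_ofReal ?_) (S.le_volume_image_Ico _ le_rfl hpy.le hyq)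
    have := S.mul_le_of_bound (i :: v) (z := z) le_rfl hpy.le hyq
      (fun t ht => S.cons_le_of_noReturn i v le_rfl hyq hv hz ht)
    rw [div_le_iff₀ (by positivity)]
    have h2 := mul_lt_mul_of_pos_right hzd (sub_pos.2 hpy)
    linarith
  rw [huniv, finite_univ_iff] at hfin
  exact W.toFinite

/-- All points have bounded suffix sums. -/
lemma bdd_all (S : BranchSystem p q K g g') {z : ℝ} (hz : z ∈ Icc p q) : S.Bdd z := by
  by_contra hnb
  set E := {z | z ∈ Icc p q ∧ ¬ S.Bdd z} with hE
  have hEc : IsClosed E := by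
    rw [← isOpen_compl_iff, Metric.isOpen_iff]
    intro x hx
    by_cases hxI : x ∈ Icc p q
    · have hb : S.Bdd x := by
        by_contra h; exact hx ⟨hxI, h⟩
      obtain ⟨c, δ, hδ, h⟩ := hb.nhds hxI
      exact ⟨δ, hδ, fun t ht htE => htE.2 ⟨c, h t htE.1 ht⟩⟩
    · obtain ⟨δ, hδ, h⟩ := Metric.isOpen_iff.1 (isClosed_Icc (a := p) (b := q)).isOpen_compl x hxI
      exact ⟨δ, hδ, fun t ht htE => h ht htE.1⟩
  obtain ⟨y, hyE, hmin⟩ := (isCompact_Icc.of_isClosed_subset hEc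
    (fun t ht => ht.1)).exists_isLeast ⟨z, hz, hnb⟩
  have hpy : p < y := lt_of_le_of_ne hyE.1.1 (by rintro rfl; exact hyE.2 S.bdd_left)
  have hyq := hyE.1.2
  have hI : Icc p y ⊆ Icc p q := Icc_subset_Icc le_rfl hyq
  have hbdd : ∀ t ∈ Ico p y, S.Bdd t := fun t ht => by
    by_contra h
    exact absurd (hmin ⟨hI (Ico_subset_Icc_self ht), h⟩) (not_le.2 ht.2)
  have hpre : ∀ u, ∀ t ∈ Icc p y, wordMap g u t = y → t = y := by
    intro u t ht e
    by_contra hne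
    exact hyE.2 (e ▸ (hbdd t ⟨ht.1, lt_of_le_of_ne ht.2 hne⟩).word (hI ht) u)
  have hstay : ∀ u, (∃ x ∈ Ico p y, wordMap g u x ∈ Ico p y) → ∀ t ∈ Icc p y,
      wordMap g u t ∈ Icc p y := by
    rintro u ⟨x, hx, hxu⟩ t ht
    refine ⟨(S.word_mem u (hI ht)).1, ?_⟩
    by_contra hn
    have hs : uIcc x t ⊆ Icc p y := uIcc_subset_Icc (Ico_subset_Icc_self hx) ht
    obtain ⟨s, hs1, es⟩ := intermediate_value_uIcc (f := wordMap g u) (a := x) (b := t)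
      ((S.word_continuousOn u).mono (hs.trans hI))
      (mem_uIcc.2 (Or.inl ⟨hxu.2.le, (not_le.1 hn).le⟩))
    have hsy := hpre u s (hs hs1) es
    have : t = y := by
      rw [mem_uIcc] at hs1
      rcases hs1 with h | h
      · exact le_antisymm ht.2 (hsy ▸ h.2)
      · linarith [hx.2, h.2]
    rw [← hsy.trans this.symm, es] at hn
    exact hn le_rfl
  have hweak : ∀ u : List ι, u ≠ [] → (∃ x ∈ Ico p y, wordMap g u x ∈ Ico p y) → ∃ ε > 0,
      ∀ t ∈ Icc p y, wordMap g u t ≤ y - ε ∨ |wordDeriv g g' u t| ≤ 1 - ε := by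
    intro u hu hret
    have hc : ContinuousOn (fun t => max (y - wordMap g u t) (1 - |wordDeriv g g' u t|))
        (Icc p y) :=
      ContinuousOn.sup (continuousOn_const.sub ((S.word_continuousOn u).mono hI))
        (continuousOn_const.sub ((S.continuousOn_abs_wordDeriv u).mono hI))
    obtain ⟨t₀, ht₀, hm⟩ := isCompact_Icc.exists_isMinOn (nonempty_Icc.2 hpy.le) hc
    refine ⟨max (y - wordMap g u t₀) (1 - |wordDeriv g g' u t₀|), ?_, fun t ht => ?_⟩
    · rw [gt_iff_lt, lt_max_iff]
      rcases (hstay u hret t₀ ht₀).2.lt_or_eq with h | h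
      · left; linarith
      · right
        have := hpre u t₀ ht₀ h
        have := S.hyp u hu t₀ (hI ht₀) (h.trans this.symm)
        linarith
    · have h1 : max (y - wordMap g u t₀) (1 - |wordDeriv g g' u t₀|)
          ≤ max (y - wordMap g u t) (1 - |wordDeriv g g' u t|) := hm ht
      rcases le_max_iff.1 h1 with h | h
      · left; linarith
      · right; linarith
  obtain ⟨ε, hε, hε2, hεu⟩ : ∃ ε > 0, ε ≤ 1 / 2 ∧ ∀ i v, NoReturn g (Ico p y) v →
      (∃ x ∈ Ico p y, wordMap g (i :: v) x ∈ Ico p y) → ∀ t ∈ Icc p y,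
      wordMap g (i :: v) t ≤ y - ε ∨ |wordDeriv g g' (i :: v) t| ≤ 1 - ε := by
    have hfin := S.finite_weak hpy hyq
    have : ∃ ε > 0, ε ≤ 1 / 2 ∧ ∀ u ∈ {u : List ι | ∃ i v, u = i :: v ∧ NoReturn g (Ico p y) v ∧
        ∃ z ∈ Icc p y, 1 / 2 < |wordDeriv g g' u z|},
        (∃ x ∈ Ico p y, wordMap g u x ∈ Ico p y) → ∀ t ∈ Icc p y,
        wordMap g u t ≤ y - ε ∨ |wordDeriv g g' u t| ≤ 1 - ε := by
      have hne : ∀ u ∈ {u : List ι | ∃ i v, u = i :: v ∧ NoReturn g (Ico p y) v ∧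
        ∃ z ∈ Icc p y, 1 / 2 < |wordDeriv g g' u z|}, u ≠ [] := by
        rintro u ⟨i, v, rfl, -⟩; simp
      revert hne
      refine Set.Finite.induction_on (motive := fun s _ => (∀ u ∈ s, u ≠ []) →
        ∃ ε > 0, ε ≤ 1 / 2 ∧ ∀ u ∈ s,
        (∃ x ∈ Ico p y, wordMap g u x ∈ Ico p y) → ∀ t ∈ Icc p y,
        wordMap g u t ≤ y - ε ∨ |wordDeriv g g' u t| ≤ 1 - ε) _ hfin ?_ ?_
      · exact fun _ => ⟨1 / 2, by norm_num, le_rfl, by simp⟩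
      · intro u s _ _ ih hne
        obtain ⟨ε, hε, hε2, h⟩ := ih fun u hu => hne u (mem_insert_of_mem _ hu)
        by_cases hret : ∃ x ∈ Ico p y, wordMap g u x ∈ Ico p y
        · obtain ⟨ε', hε', h'⟩ := hweak u (hne u (mem_insert _ _)) hret
          refine ⟨min ε ε', lt_min hε hε', (min_le_left _ _).trans hε2, ?_⟩
          rintro u' (rfl | hu') hret' t ht
          · rcases h' t ht with h | h
            · left; linarith [min_le_right ε ε']
            · right; linarith [min_le_right ε ε']
          · rcases h u' hu' hret' t ht with h | h
            · left; linarith [min_le_left ε ε']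
            · right; linarith [min_le_left ε ε']
        · refine ⟨ε, hε, hε2, ?_⟩
          rintro u' (rfl | hu') hret' t ht
          · exact absurd hret' hret
          · exact h u' hu' hret' t ht
    obtain ⟨ε, hε, hε2, h⟩ := this
    refine ⟨ε, hε, hε2, fun i v hv hret t ht => ?_⟩
    by_cases hd : 1 / 2 < |wordDeriv g g' (i :: v) t|
    · exact h _ ⟨i, v, rfl, hv, t, ht, hd⟩ hret t ht
    · right; linarith [not_lt.1 hd]
  obtain ⟨c₀, hc₀⟩ := S.exists_bound_of_isCompact (s := Icc p (y - ε)) isCompact_Icc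
    ((Icc_subset_Icc le_rfl (by linarith)).trans hI) fun t ht => hbdd t ⟨ht.1, by linarith [ht.2]⟩
  set B := Real.exp (K * (q - p)) * (q - p) / (y - p) with hB
  have hBpos : 0 < B := div_pos (mul_pos (Real.exp_pos _) (by linarith [S.lt])) (by linarith)
  set c := max c₀ 0 with hc
  set C := max (2 * B + B * c) (2 * B / ε) with hC
  have hC1 : 2 * B + B * c ≤ C := le_max_left _ _
  have hC2 : 2 * B ≤ ε * C := by
    rw [← div_le_iff₀' hε]; exact le_max_right _ _
  have hc0 : 0 ≤ c := le_max_right _ _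
  have hBc : 0 ≤ B * c := by positivity
  have key : ∀ n, ∀ w : List ι, w.length ≤ n → ∀ t ∈ Icc p y, suffixSum g g' w t ≤ C := by
    intro n
    induction n with
    | zero =>
      intro w hw t ht
      obtain rfl := List.length_eq_zero_iff.1 (Nat.le_zero.1 hw)
      have := S.suffixSum_le_of_noReturn [] le_rfl hpy hyq (noReturn_nil _) ht
      linarith
    | succ n ih =>
      intro w hw t ht
      rcases noReturn_or_exists g (Ico p y) w with h | ⟨w', i, v, rfl, hv, hret⟩
      · have := S.suffixSum_le_of_noReturn w le_rfl hpy hyq h ht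
        linarith
      · have hs := S.suffixSum_append_cons_le w' v i le_rfl hpy hyq hv ht
        have hut := hstay _ hret t ht
        rcases hεu i v hv hret t ht with h | h
        · have h1 := S.abs_cons_le_of_noReturn i v le_rfl hpy hyq hv ht
          have h2 : suffixSum g g' w' (wordMap g (i :: v) t) ≤ c :=
            (hc₀ _ ⟨hut.1, h⟩ w').trans (le_max_left _ _)
          have h3 := mul_le_mul h1 h2 (suffixSum_nonneg _ _) hBpos.le
          linarith
        · have hw' : w'.length ≤ n := by
            simp only [List.length_append, List.length_cons] at hw; omega
          have h3 := mul_le_mul h (ih w' hw' _ hut) (suffixSum_nonneg _ _) (by linarith)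
          linarith
  exact hyE.2 ⟨C, fun w => key w.length w le_rfl y ⟨hpy.le, le_rfl⟩⟩

/-- Uniform Lipschitz distortion of all words. -/
theorem exists_distortion (S : BranchSystem p q K g g') :
    ∃ C > 0, ∀ w : List ι, ∀ x ∈ Icc p q, ∀ y ∈ Icc p q,
      |Real.log (wordDeriv g g' w x) - Real.log (wordDeriv g g' w y)| ≤ C * |x - y| := by
  obtain ⟨c, hc⟩ := S.exists_bound_of_isCompact isCompact_Icc subset_rfl fun z hz => S.bdd_all hz
  have hK := S.K_pos
  have hc1 : 1 ≤ c := hc p ⟨le_rfl, S.lt.le⟩ []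
  refine ⟨K * c, by positivity, fun w x hx y hy => ?_⟩
  refine (S.log_le w hx hy).trans ?_
  rw [mul_assoc]
  exact mul_le_mul_of_nonneg_left (S.suffixDist_le w (fun z hz => hc z hz w) hx hy) hK.le

end BranchSystem

/-- `φ` is twice differentiable with derivatives `φ₁`, `φ₂`, the second one continuous. -/
structure HasTwoDerivs (φ φ₁ φ₂ : ℝ → ℝ) : Prop where
  fst : ∀ x, HasDerivAt φ (φ₁ x) x
  snd : ∀ x, HasDerivAt φ₁ (φ₂ x) x
  cont : Continuous φ₂

/-- The logarithmic derivative in `v` of `φ'(v) (v - u)² / (φ v - φ u)²`. -/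
def koebe (φ φ₁ φ₂ : ℝ → ℝ) (u v : ℝ) : ℝ :=
  φ₂ v / φ₁ v - 2 * φ₁ v / (φ v - φ u) + 2 / (v - u)

lemma ContDiff.hasTwoDerivs {φ : ℝ → ℝ} (h : ContDiff ℝ 2 φ) :
    HasTwoDerivs φ (deriv φ) (deriv (deriv φ)) := by
  have h1 : ContDiff ℝ 1 (deriv φ) := by
    have : ContDiff ℝ (1 + 1) φ := by simpa [one_add_one_eq_two] using h
    exact (contDiff_succ_iff_deriv.1 this).2.2
  refine ⟨fun x => (h.differentiable (by norm_num) x).hasDerivAt,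
    fun x => (h1.differentiable (by norm_num) x).hasDerivAt, ?_⟩
  exact h1.continuous_deriv le_rfl

namespace HasTwoDerivs
variable {φ φ₁ φ₂ : ℝ → ℝ}

lemma continuous_fst (h : HasTwoDerivs φ φ₁ φ₂) : Continuous φ₁ :=
  continuous_iff_continuousAt.2 fun x => (h.snd x).continuousAt

lemma continuous (h : HasTwoDerivs φ φ₁ φ₂) : Continuous φ :=
  continuous_iff_continuousAt.2 fun x => (h.fst x).continuousAt

lemma neg (h : HasTwoDerivs φ φ₁ φ₂) :
    HasTwoDerivs (fun x => - φ x) (fun x => - φ₁ x) (fun x => - φ₂ x) :=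
  ⟨fun x => (h.fst x).neg, fun x => (h.snd x).neg, h.cont.neg⟩

lemma comp_neg (h : HasTwoDerivs φ φ₁ φ₂) :
    HasTwoDerivs (fun x => φ (-x)) (fun x => - φ₁ (-x)) (fun x => φ₂ (-x)) := by
  refine ⟨fun x => ?_, fun x => ?_, h.cont.comp continuous_neg⟩
  · exact ((h.fst (-x)).comp x (hasDerivAt_neg x)).congr_deriv (by ring)
  · exact ((h.snd (-x)).comp x (hasDerivAt_neg x)).neg.congr_deriv (by ring)

lemma comp_sub_const (h : HasTwoDerivs φ φ₁ φ₂) (a : ℝ) :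
    HasTwoDerivs (fun x => φ (x - a)) (fun x => φ₁ (x - a)) (fun x => φ₂ (x - a)) :=
  ⟨fun x => (h.fst (x - a)).comp_sub_const x a, fun x => (h.snd (x - a)).comp_sub_const x a,
    h.cont.comp (continuous_id.sub continuous_const)⟩

lemma exists_mvt (h : HasTwoDerivs φ φ₁ φ₂) {u v : ℝ} (huv : u < v) :
    ∃ ξ ∈ Ioo u v, φ v - φ u = φ₁ ξ * (v - u) := by
  obtain ⟨ξ, hξ, e⟩ := exists_hasDerivAt_eq_slope φ φ₁ huv h.continuous.continuousOn
    (fun x _ => h.fst x)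
  refine ⟨ξ, hξ, ?_⟩
  rw [e]
  have : v - u ≠ 0 := (sub_pos.2 huv).ne'
  field_simp

/-- The distortion derivative of a map without critical points is bounded on compact sets. -/
lemma exists_koebe_le (h : HasTwoDerivs φ φ₁ φ₂) {a b : ℝ} (hab : a ≤ b)
    (hne : ∀ x ∈ Icc a b, φ₁ x ≠ 0) :
    ∃ C, (∀ v ∈ Icc a b, φ₂ v / φ₁ v ≤ C) ∧
      ∀ u ∈ Icc a b, ∀ v ∈ Icc a b, u < v → koebe φ φ₁ φ₂ u v ≤ C := by
  obtain ⟨x₀, hx₀, hm⟩ := isCompact_Icc.exists_isMinOn (nonempty_Icc.2 hab)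
    h.continuous_fst.abs.continuousOn
  obtain ⟨x₁, hx₁, hA⟩ := isCompact_Icc.exists_isMaxOn (nonempty_Icc.2 hab)
    h.cont.abs.continuousOn
  set m := |φ₁ x₀| with hmdef
  set A := |φ₂ x₁| with hAdef
  have hmpos : 0 < m := abs_pos.2 (hne x₀ hx₀)
  have hm' : ∀ x ∈ Icc a b, m ≤ |φ₁ x| := fun x hx => hm hx
  have hA' : ∀ x ∈ Icc a b, |φ₂ x| ≤ A := fun x hx => hA hx
  have hA0 : 0 ≤ A := abs_nonneg _
  have h1 : ∀ v ∈ Icc a b, φ₂ v / φ₁ v ≤ A / m := fun v hv => by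
    refine (le_abs_self _).trans ?_
    rw [abs_div]
    exact div_le_div₀ hA0 (hA' v hv) hmpos (hm' v hv)
  refine ⟨3 * (A / m), fun v hv => (h1 v hv).trans ?_, fun u hu v hv huv => ?_⟩
  · have : 0 ≤ A / m := by positivity
    linarith
  · obtain ⟨ξ, hξ, e⟩ := h.exists_mvt huv
    have hξI : ξ ∈ Icc a b := ⟨hu.1.trans hξ.1.le, hξ.2.le.trans hv.2⟩
    obtain ⟨ζ, hζ, e'⟩ := exists_hasDerivAt_eq_slope φ₁ φ₂ hξ.2 h.continuous_fst.continuousOn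
      (fun x _ => h.snd x)
    have hζI : ζ ∈ Icc a b := ⟨hξI.1.trans hζ.1.le, hζ.2.le.trans hv.2⟩
    have huv' : 0 < v - u := sub_pos.2 huv
    have hξv : 0 < v - ξ := sub_pos.2 hξ.2
    have e2 : φ₁ v - φ₁ ξ = φ₂ ζ * (v - ξ) := by
      rw [e']; field_simp
    have e3 : - 2 * φ₁ v / (φ v - φ u) + 2 / (v - u)
        = 2 * (-(φ₂ ζ) / φ₁ ξ * ((v - ξ) / (v - u))) := by
      have hn := hne ξ hξI
      rw [e]
      field_simp
      linarith
    have h2 : -(φ₂ ζ) / φ₁ ξ * ((v - ξ) / (v - u)) ≤ A / m := by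
      refine (le_abs_self _).trans ?_
      rw [abs_mul, abs_div, abs_neg, abs_of_pos (div_pos hξv huv')]
      have : (v - ξ) / (v - u) ≤ 1 := by
        rw [div_le_one huv']; linarith [hξ.1]
      calc |φ₂ ζ| / |φ₁ ξ| * ((v - ξ) / (v - u)) ≤ A / m * 1 :=
            mul_le_mul (div_le_div₀ hA0 (hA' ζ hζI) hmpos (hm' ξ hξI)) this
              (div_pos hξv huv').le (by positivity)
        _ = A / m := mul_one _
    have e4 : koebe φ φ₁ φ₂ u v = φ₂ v / φ₁ v + (- 2 * φ₁ v / (φ v - φ u) + 2 / (v - u)) := by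
      rw [koebe]; ring
    rw [e4, e3]
    linarith [h1 v hv]

end HasTwoDerivs

/-- The polynomial-type inequality behind the negative Schwarzian behaviour of power maps. -/
lemma pow_koebe_aux {l : ℝ} (hl : 1 < l) {x : ℝ} (hx : 0 < x) :
    0 ≤ (x - 1) * ((x ^ l - 1) * ((l - 1) * x - (l + 1)) + 2 * l * (x - 1)) := by
  set P : ℝ → ℝ := fun x => (x ^ l - 1) * ((l - 1) * x - (l + 1)) + 2 * l * (x - 1) with hP
  have hd : ∀ t, 0 < t → HasDerivAt P ((l + 1) * ((l - 1) * t ^ l - l * t ^ (l - 1) + 1)) t := by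
    intro t ht
    have h1 := (Real.hasDerivAt_rpow_const (p := l) (Or.inl ht.ne')).sub_const 1
    have h2 := ((hasDerivAt_id t).const_mul (l - 1)).sub_const (l + 1)
    have h3 := ((hasDerivAt_id t).sub_const 1).const_mul (2 * l)
    refine ((h1.mul h2).add h3).congr_deriv ?_
    have : t ^ l = t ^ (l - 1) * t := by
      rw [← Real.rpow_add_one ht.ne']; congr 1; ring
    simp only [id, mul_one]
    rw [this]; ring
  have hn : ∀ t, 0 < t → 0 ≤ (l + 1) * ((l - 1) * t ^ l - l * t ^ (l - 1) + 1) := by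
    intro t ht
    refine mul_nonneg (by linarith) ?_
    have hb := one_add_mul_self_le_rpow_one_add (s := t⁻¹ - 1)
      (by linarith [inv_pos.2 ht]) hl.le
    rw [add_sub_cancel, Real.inv_rpow ht.le] at hb
    have hpos : 0 < t ^ l := Real.rpow_pos_of_pos ht l
    have hmul := mul_le_mul_of_nonneg_left hb hpos.le
    rw [mul_inv_cancel₀ hpos.ne'] at hmul
    have e : t ^ (l - 1) = t ^ l * t⁻¹ := by
      rw [Real.rpow_sub ht, Real.rpow_one]; rfl
    rw [e]
    nlinarith
  have hmono : MonotoneOn P (Ioi 0) := by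
    refine monotoneOn_of_deriv_nonneg (convex_Ioi 0)
      (fun t ht => (hd t ht).continuousAt.continuousWithinAt)
      (fun t ht => (hd t (interior_subset ht)).differentiableAt.differentiableWithinAt)
      (fun t ht => ?_)
    rw [(hd t (interior_subset ht)).deriv]
    exact hn t (interior_subset ht)
  have hP1 : P 1 = 0 := by simp [hP]
  rcases le_total 1 x with h | h
  · have := hmono (mem_Ioi.2 one_pos) (mem_Ioi.2 hx) h
    rw [hP1] at this
    exact mul_nonneg (by linarith) this
  · have := hmono (mem_Ioi.2 hx) (mem_Ioi.2 one_pos) h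
    rw [hP1] at this
    exact mul_nonneg_of_nonpos_of_nonpos (by linarith) this

/-- Power maps decrease the distortion derivative. -/
lemma pow_koebe_nonpos {l : ℝ} (hl : 1 < l) {a b : ℝ} (ha : 0 < a) (hb : 0 < b) (hab : a ≠ b) :
    (b - a) * ((l - 1) / b - 2 * (l * b ^ (l - 1)) / (b ^ l - a ^ l) + 2 / (b - a)) ≤ 0 := by
  set x := b / a with hx
  have hxpos : 0 < x := div_pos hb ha
  have hbx : b = x * a := by rw [hx]; field_simp
  have hx1 : x ≠ 1 := by
    rintro h
    rw [h, one_mul] at hbx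
    exact hab hbx.symm
  have e1 : b ^ l = x ^ l * a ^ l := by rw [hbx, Real.mul_rpow hxpos.le ha.le]
  have e2 : b ^ (l - 1) = x ^ l * a ^ l / (x * a) := by
    rw [Real.rpow_sub hb, Real.rpow_one, e1, ← hbx]
  have hal : 0 < a ^ l := Real.rpow_pos_of_pos ha l
  have hsgn : 0 < (x ^ l - 1) * (x - 1) := by
    rcases lt_or_gt_of_ne hx1 with h | h
    · exact mul_pos_of_neg_of_neg
        (by linarith [Real.rpow_lt_one hxpos.le h (by linarith : 0 < l)]) (by linarith)
    · exact mul_pos (by linarith [Real.one_lt_rpow h (by linarith : 0 < l)]) (by linarith)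
  have hxl : x ^ l - 1 ≠ 0 := fun h => by rw [h, zero_mul] at hsgn; exact lt_irrefl _ hsgn
  have hx1' : x - 1 ≠ 0 := sub_ne_zero.2 hx1
  have haux := pow_koebe_aux hl hxpos
  rw [e1, e2, hbx]
  have e3 : (x * a - a) * ((l - 1) / (x * a)
      - 2 * (l * (x ^ l * a ^ l / (x * a))) / (x ^ l * a ^ l - a ^ l) + 2 / (x * a - a))
      = - ((x - 1) * ((x ^ l - 1) * ((l - 1) * x - (l + 1)) + 2 * l * (x - 1)))
        / (x * ((x ^ l - 1) * (x - 1))) := by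
    have : x ^ l * a ^ l - a ^ l = (x ^ l - 1) * a ^ l := by ring
    rw [this]
    have : x * a - a = (x - 1) * a := by ring
    rw [this]
    field_simp
    ring
  rw [e3]
  exact div_nonpos_of_nonpos_of_nonneg (by linarith) (by positivity)

/-- On `(a, b)` the map `φ` is, up to an affine map, a power of a positive `C²` map without
critical points, whose derivative has the sign of `ε`. -/
def PowerChart (φ : ℝ → ℝ) (a b ε : ℝ) : Prop :=
  ∃ χ χ₁ χ₂ : ℝ → ℝ, HasTwoDerivs χ χ₁ χ₂ ∧ (∀ x, 0 < ε * χ₁ x) ∧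
    ∃ l > (1 : ℝ), ∃ s : ℝ, s ≠ 0 ∧ ∃ c : ℝ, ∀ x ∈ Ioo a b, 0 < χ x ∧ φ x = c + s * χ x ^ l

namespace PowerChart
variable {φ φ₁ φ₂ : ℝ → ℝ} {a b ε : ℝ}

lemma mono (h : PowerChart φ a b ε) {a' b' : ℝ} (ha : a ≤ a') (hb : b' ≤ b) :
    PowerChart φ a' b' ε := by
  obtain ⟨χ, χ₁, χ₂, h1, h2, l, hl, s, hs, c, hc⟩ := h
  exact ⟨χ, χ₁, χ₂, h1, h2, l, hl, s, hs, c, fun x hx => hc x ⟨ha.trans_lt hx.1, hx.2.trans_le hb⟩⟩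

lemma comp_neg (h : PowerChart φ a b ε) : PowerChart (fun x => φ (-x)) (-b) (-a) (-ε) := by
  obtain ⟨χ, χ₁, χ₂, h1, h2, l, hl, s, hs, c, hc⟩ := h
  refine ⟨_, _, _, h1.comp_neg, fun x => ?_, l, hl, s, hs, c, fun x hx => ?_⟩
  · have := h2 (-x); linarith
  · exact hc (-x) ⟨by linarith [hx.2], by linarith [hx.1]⟩

lemma comp_sub_const (h : PowerChart φ a b ε) (t r : ℝ) (hφ : ∀ x, φ x = φ (x - t) + r) :
    PowerChart φ (a + t) (b + t) ε := by
  obtain ⟨χ, χ₁, χ₂, h1, h2, l, hl, s, hs, c, hc⟩ := h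
  refine ⟨_, _, _, h1.comp_sub_const t, fun x => h2 _, l, hl, s, hs, c + r, fun x hx => ?_⟩
  have := hc (x - t) ⟨by linarith [hx.1], by linarith [hx.2]⟩
  exact ⟨this.1, by rw [hφ x, this.2]; ring⟩

/-- Non-flat critical points have power charts on both sides. -/
lemma exists_of_nonflat {ψ : ℝ → ℝ} {c₀ l s : ℝ} (hψ : ContDiff ℝ 2 ψ)
    (hψ' : ∀ x, deriv ψ x ≠ 0) (h0 : ψ c₀ = 0) (hl : 1 < l) (hs : s ≠ 0)
    (he : ∀ᶠ x in nhds c₀, φ x = φ c₀ + s * |ψ x| ^ l) :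
    ∃ δ > 0, PowerChart φ c₀ (c₀ + δ) 1 ∧ PowerChart φ (c₀ - δ) c₀ (-1) := by
  wlog hpos : ∀ x, 0 < deriv ψ x generalizing ψ
  · refine this (ψ := fun x => - ψ x) hψ.neg (fun x => ?_) (by simp [h0]) (by simpa using he) ?_
    · rw [deriv.fun_neg]; exact neg_ne_zero.2 (hψ' x)
    · have hc := hψ.hasTwoDerivs.continuous_fst
      intro x
      rw [deriv.fun_neg]
      push Not at hpos
      obtain ⟨y, hy⟩ := hpos
      by_contra hx
      have hy' : deriv ψ y < 0 := lt_of_le_of_ne hy (hψ' y)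
      have hx' : 0 < deriv ψ x := lt_of_le_of_ne (by linarith) (hψ' x).symm
      obtain ⟨z, hz⟩ := mem_range_of_exists_le_of_exists_ge hc ⟨y, hy'.le⟩ ⟨x, hx'.le⟩
      exact hψ' z hz
  have hmono : StrictMono ψ := strictMono_of_deriv_pos hpos
  obtain ⟨δ, hδ, hball⟩ := Metric.eventually_nhds_iff.1 he
  have h2 := hψ.hasTwoDerivs
  refine ⟨δ, hδ, ⟨ψ, _, _, h2, fun x => by simpa using hpos x, l, hl, s, hs, φ c₀, fun x hx => ?_⟩,
    ⟨_, _, _, h2.neg, fun x => by simpa using hpos x, l, hl, s, hs, φ c₀, fun x hx => ?_⟩⟩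
  · have hp : 0 < ψ x := h0 ▸ hmono hx.1
    refine ⟨hp, ?_⟩
    rw [hball (by rw [Real.dist_eq, abs_lt]; constructor <;> linarith [hx.1, hx.2]), abs_of_pos hp]
  · have hp : ψ x < 0 := h0 ▸ hmono hx.2
    refine ⟨by linarith, ?_⟩
    rw [hball (by rw [Real.dist_eq, abs_lt]; constructor <;> linarith [hx.1, hx.2]), abs_of_neg hp]

/-- Upper bound of the distortion derivative in a power chart. -/
lemma exists_koebe_le (h : PowerChart φ a b ε) (hab : a ≤ b) (hφ : HasTwoDerivs φ φ₁ φ₂) :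
    ∃ C, (ε < 0 → ∀ v ∈ Ioo a b, φ₂ v / φ₁ v ≤ C) ∧
      ∀ u ∈ Ioo a b, ∀ v ∈ Ioo a b, u < v → koebe φ φ₁ φ₂ u v ≤ C := by
  obtain ⟨χ, χ₁, χ₂, h1, h2, l, hl, s, hs, c, hc⟩ := h
  have hne : ∀ x, χ₁ x ≠ 0 :=
      fun x hx => by have := h2 x; rw [hx, mul_zero] at this; exact lt_irrefl _ this
  obtain ⟨C, hC1, hC2⟩ := h1.exists_koebe_le hab (fun x _ => hne x)
  have hl0 : l ≠ 0 := by linarith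
  have d1 : ∀ x ∈ Ioo a b, φ₁ x = s * (l * χ x ^ (l - 1) * χ₁ x) := by
    intro x hx
    have e : φ =ᶠ[nhds x] fun x => c + s * χ x ^ l := by
      filter_upwards [Ioo_mem_nhds hx.1 hx.2] with y hy using (hc y hy).2
    have := (((h1.fst x).rpow_const (p := l) (Or.inl (hc x hx).1.ne')).const_mul s).const_add c
    rw [(hφ.fst x).unique (this.congr_of_eventuallyEq e)]; ring
  have d2 : ∀ x ∈ Ioo a b, φ₂ x = s * (l * ((l - 1) * χ x ^ (l - 1) / χ x * χ₁ x ^ 2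
      + χ x ^ (l - 1) * χ₂ x)) := by
    intro x hx
    have e : φ₁ =ᶠ[nhds x] fun x => s * (l * χ x ^ (l - 1) * χ₁ x) := by
      filter_upwards [Ioo_mem_nhds hx.1 hx.2] with y hy using d1 y hy
    have := ((((h1.fst x).rpow_const (p := l - 1) (Or.inl (hc x hx).1.ne')).const_mul l).mul
      (h1.snd x)).const_mul s
    rw [(hφ.snd x).unique (this.congr_of_eventuallyEq e), Real.rpow_sub_one (hc x hx).1.ne' (l - 1)]
    ring
  have d3 : ∀ v ∈ Ioo a b, φ₂ v / φ₁ v = χ₁ v * ((l - 1) / χ v) + χ₂ v / χ₁ v := by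
    intro v hv
    have hp := (hc v hv).1
    have := (Real.rpow_pos_of_pos hp (l - 1)).ne'
    have := hne v
    rw [d1 v hv, d2 v hv]
    field_simp
  refine ⟨C, fun hε v hv => ?_, fun u hu v hv huv => ?_⟩
  · rw [d3 v hv]
    have hneg : χ₁ v ≤ 0 := by have := h2 v; nlinarith
    have : 0 ≤ (l - 1) / χ v := div_nonneg (by linarith) (hc v hv).1.le
    nlinarith [hC1 v (Ioo_subset_Icc_self hv)]
  · have hup := (hc u hu).1
    have hvp := (hc v hv).1
    have hvu : 0 < v - u := sub_pos.2 huv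
    obtain ⟨ξ, hξ, e⟩ := h1.exists_mvt huv
    have hχne : χ v - χ u ≠ 0 := by rw [e]; exact mul_ne_zero (hne ξ) hvu.ne'
    have hsign : 0 < χ₁ v * (χ v - χ u) := by
      rw [e]
      have := mul_pos (h2 v) (h2 ξ)
      have h3 : 0 < χ₁ v * χ₁ ξ := by
        by_contra hcon
        nlinarith [sq_nonneg ε]
      nlinarith [mul_pos h3 hvu]
    have hpk := pow_koebe_nonpos hl hup hvp (fun h => hχne (by rw [h, sub_self]))
    set W := (l - 1) / χ v - 2 * (l * χ v ^ (l - 1)) / (χ v ^ l - χ u ^ l) + 2 / (χ v - χ u) with hW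
    have hW' : χ₁ v * W ≤ 0 := by
      by_contra hcon
      push Not at hcon
      have : 0 < (χ₁ v * (χ v - χ u)) * (χ₁ v * W) := mul_pos hsign hcon
      nlinarith [sq_nonneg (χ₁ v)]
    have hpne : χ v ^ l - χ u ^ l ≠ 0 := by
      intro h0
      have := (Real.rpow_left_inj hvp.le hup.le hl0).1 (sub_eq_zero.1 h0)
      exact hχne (by rw [this, sub_self])
    have key : koebe φ φ₁ φ₂ u v = koebe χ χ₁ χ₂ u v + χ₁ v * W := by
      have e5 : 2 * φ₁ v / (φ v - φ u) =
          χ₁ v * (2 * (l * χ v ^ (l - 1)) / (χ v ^ l - χ u ^ l)) := by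
        rw [d1 v hv, (hc v hv).2, (hc u hu).2]
        have : c + s * χ v ^ l - (c + s * χ u ^ l) = s * (χ v ^ l - χ u ^ l) := by ring
        rw [this]
        field_simp
      rw [koebe, koebe, d3 v hv, e5, hW]
      ring
    rw [key]
    linarith [hC2 u (Ioo_subset_Icc_self hu) v (Ioo_subset_Icc_self hv) huv]

end PowerChart

/-- Upper bound of the distortion derivative on a lap between two non-flat critical points. -/
lemma HasTwoDerivs.exists_koebe_le_lap {φ φ₁ φ₂ : ℝ → ℝ} {a b δ : ℝ} (hφ : HasTwoDerivs φ φ₁ φ₂)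
    (hab : a < b) (hδ : 0 < δ) (hsgn : ∀ x ∈ Ioo a b, ∀ y ∈ Ioo a b, 0 < φ₁ x * φ₁ y)
    (hL : PowerChart φ a (a + δ) 1) (hR : PowerChart φ (b - δ) b (-1)) :
    ∃ C, ∀ u ∈ Ioo a b, ∀ v ∈ Ioo a b, u < v → koebe φ φ₁ φ₂ u v ≤ C := by
  set η := min (δ / 2) ((b - a) / 4) with hη
  have hη0 : 0 < η := lt_min (by linarith) (by linarith)
  have hη1 : 2 * η ≤ δ := by linarith [min_le_left (δ / 2) ((b - a) / 4)]
  have hη2 : 4 * η ≤ b - a := by linarith [min_le_right (δ / 2) ((b - a) / 4)]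
  obtain ⟨C₁, -, h1⟩ := hL.exists_koebe_le (by linarith) hφ
  obtain ⟨C₂, h2', h2⟩ := hR.exists_koebe_le (by linarith) hφ
  obtain ⟨C₃, h3', h3⟩ := hφ.exists_koebe_le (a := a + η) (b := b - η) (by linarith)
    (fun x hx h => by
      have hm : x ∈ Ioo a b := ⟨by linarith [hx.1], by linarith [hx.2]⟩
      have := hsgn x hm x hm
      rw [h, zero_mul] at this; exact lt_irrefl _ this)
  refine ⟨max (max C₁ C₂) (max C₃ (max C₂ C₃ + 2 / η)), fun u hu v hv huv => ?_⟩
  by_cases hc1 : v < a + δ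
  · exact (h1 u ⟨hu.1, huv.trans hc1⟩ v ⟨hv.1, hc1⟩ huv).trans
      ((le_max_left _ _).trans (le_max_left _ _))
  by_cases hc2 : b - δ < u
  · exact (h2 u ⟨hc2, hu.2⟩ v ⟨hc2.trans huv, hv.2⟩ huv).trans
      ((le_max_right _ _).trans (le_max_left _ _))
  push Not at hc1 hc2
  by_cases hc3 : a + η ≤ u ∧ v ≤ b - η
  · exact (h3 u ⟨hc3.1, by linarith⟩ v ⟨by linarith, hc3.2⟩ huv).trans
      ((le_max_left _ _).trans (le_max_right _ _))
  have hvu : η ≤ v - u := by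
    by_contra hcon
    push Not at hcon
    exact hc3 ⟨by linarith, by linarith⟩
  refine le_trans ?_ ((le_max_right _ _).trans (le_max_right _ _))
  have hq : φ₂ v / φ₁ v ≤ max C₂ C₃ := by
    by_cases hvb : v ≤ b - η
    · exact (h3' v ⟨by linarith, hvb⟩).trans (le_max_right _ _)
    · push Not at hvb
      exact (h2' (by norm_num) v ⟨by linarith, hv.2⟩).trans (le_max_left _ _)
  have hfrac : 0 ≤ 2 * φ₁ v / (φ v - φ u) := by
    obtain ⟨ξ, hξ, e⟩ := hφ.exists_mvt huv
    have hs := hsgn v hv ξ ⟨hu.1.trans hξ.1, hξ.2.trans hv.2⟩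
    have hξ0 : φ₁ ξ ≠ 0 := fun h => by rw [h, mul_zero] at hs; exact lt_irrefl _ hs
    have : 2 * φ₁ v / (φ v - φ u) = 2 * (φ₁ v * φ₁ ξ) / (φ₁ ξ ^ 2 * (v - u)) := by
      have : v - u ≠ 0 := by linarith
      rw [e]; field_simp
    rw [this]
    exact div_nonneg (by linarith) (mul_nonneg (sq_nonneg _) (by linarith))
  have : 2 / (v - u) ≤ 2 / η := div_le_div_of_nonneg_left (by norm_num) hη0 hvu
  rw [koebe]
  linarith

/-- `v` lies between `u` and `v'`, and differs from `u`. -/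
def Between (u v v' : ℝ) : Prop := (u < v ∧ v ≤ v') ∨ (v' ≤ v ∧ v < u)

/-- The logarithm of `φ'(v) (v - u)² / (φ v - φ u)²`. -/
def logKoebe (φ φ₁ : ℝ → ℝ) (u v : ℝ) : ℝ :=
  Real.log (φ₁ v) + 2 * Real.log (v - u) - 2 * Real.log (φ v - φ u)

/-- Moving away from `u`, the Koebe quotient increases at a bounded rate. -/
lemma HasTwoDerivs.exists_logKoebe_le {φ φ₁ φ₂ : ℝ → ℝ} {a b δ : ℝ} (hφ : HasTwoDerivs φ φ₁ φ₂)
    (hab : a < b) (hδ : 0 < δ) (hsgn : ∀ x ∈ Ioo a b, ∀ y ∈ Ioo a b, 0 < φ₁ x * φ₁ y)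
    (hL : PowerChart φ a (a + δ) 1) (hR : PowerChart φ (b - δ) b (-1)) :
    ∃ C ≥ 0, ∀ u ∈ Ioo a b, ∀ v ∈ Ioo a b, ∀ v' ∈ Ioo a b, Between u v v' →
      logKoebe φ φ₁ u v' - logKoebe φ φ₁ u v ≤ C * |v' - v| := by
  obtain ⟨C₁, h1⟩ := hφ.exists_koebe_le_lap hab hδ hsgn hL hR
  obtain ⟨C₂, h2⟩ := hφ.comp_neg.exists_koebe_le_lap (a := -b) (b := -a) (by linarith) hδ
    (fun x hx y hy => by
      have := hsgn (-x) ⟨by linarith [hx.2], by linarith [hx.1]⟩ (-y)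
        ⟨by linarith [hy.2], by linarith [hy.1]⟩
      linarith)
    (by have := hR.comp_neg; rwa [neg_neg, neg_sub, sub_eq_neg_add] at this)
    (by have := hL.comp_neg; rwa [neg_add] at this)
  have hne : ∀ x ∈ Ioo a b, φ₁ x ≠ 0 := fun x hx h => by
    have := hsgn x hx x hx; rw [h, zero_mul] at this; exact lt_irrefl _ this
  have hne' : ∀ u ∈ Ioo a b, ∀ v ∈ Ioo a b, u ≠ v → φ v - φ u ≠ 0 := by
    have : ∀ u ∈ Ioo a b, ∀ v ∈ Ioo a b, u < v → φ v - φ u ≠ 0 := by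
      intro u hu v hv huv
      obtain ⟨ξ, hξ, e⟩ := hφ.exists_mvt huv
      rw [e]
      exact mul_ne_zero (hne ξ ⟨hu.1.trans hξ.1, hξ.2.trans hv.2⟩) (by linarith)
    intro u hu v hv huv
    rcases lt_or_gt_of_ne huv with h | h
    · exact this u hu v hv h
    · have := this v hv u hu h
      intro h0; exact this (by linarith)
  have hd : ∀ u ∈ Ioo a b, ∀ v ∈ Ioo a b, u ≠ v →
      HasDerivAt (logKoebe φ φ₁ u) (koebe φ φ₁ φ₂ u v) v := by
    intro u hu v hv huv
    have a1 := (hφ.snd v).log (hne v hv)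
    have a2 := (((hasDerivAt_id v).sub_const u).log (sub_ne_zero.2 huv.symm)).const_mul 2
    have a3 := (((hφ.fst v).sub_const (φ u)).log (hne' u hu v hv huv)).const_mul 2
    refine ((a1.add a2).sub a3).congr_deriv ?_
    simp only [koebe, id]
    ring
  refine ⟨max 0 (max C₁ C₂), le_max_left _ _, fun u hu v hv v' hv' hbt => ?_⟩
  rcases hbt with ⟨h3, h4⟩ | ⟨h3, h4⟩
  · rcases h4.eq_or_lt with rfl | h4
    · simp
    obtain ⟨ξ, hξ, e⟩ := exists_hasDerivAt_eq_slope (logKoebe φ φ₁ u) (koebe φ φ₁ φ₂ u) h4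
      (fun x hx => (hd u hu x ⟨hv.1.trans_le hx.1, hx.2.trans_lt hv'.2⟩
        (h3.trans_le hx.1).ne).continuousAt.continuousWithinAt)
      (fun x hx => hd u hu x ⟨hv.1.trans hx.1, hx.2.trans hv'.2⟩ (h3.trans hx.1).ne)
    have hb := h1 u hu ξ ⟨hv.1.trans hξ.1, hξ.2.trans hv'.2⟩ (h3.trans hξ.1)
    have hb' : koebe φ φ₁ φ₂ u ξ ≤ max 0 (max C₁ C₂) :=
      hb.trans ((le_max_left _ _).trans (le_max_right _ _))
    rw [e, div_le_iff₀ (by linarith)] at hb'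
    rwa [abs_of_pos (by linarith)]
  · rcases h3.eq_or_lt with rfl | h3
    · simp
    obtain ⟨ξ, hξ, e⟩ := exists_hasDerivAt_eq_slope (logKoebe φ φ₁ u) (koebe φ φ₁ φ₂ u) h3
      (fun x hx => (hd u hu x ⟨hv'.1.trans_le hx.1, hx.2.trans_lt hv.2⟩
        (hx.2.trans_lt h4).ne').continuousAt.continuousWithinAt)
      (fun x hx => hd u hu x ⟨hv'.1.trans hx.1, hx.2.trans hv.2⟩ (hx.2.trans h4).ne')
    have hb := h2 (-u) ⟨by linarith [hu.2], by linarith [hu.1]⟩ (-ξ)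
      ⟨by linarith [hξ.2, hv.2], by linarith [hξ.1, hv'.1]⟩ (by linarith [hξ.2])
    have hneg : koebe (fun x => φ (-x)) (fun x => - φ₁ (-x)) (fun x => φ₂ (-x)) (-u) (-ξ)
        = - koebe φ φ₁ φ₂ u ξ := by
      simp only [koebe, neg_neg]
      have : -ξ - -u = - (ξ - u) := by ring
      rw [this, div_neg, div_neg]
      ring
    rw [hneg] at hb
    have hb' : - koebe φ φ₁ φ₂ u ξ ≤ max 0 (max C₁ C₂) :=
      hb.trans ((le_max_right _ _).trans (le_max_right _ _))
    rw [e, ← neg_div, div_le_iff₀ (by linarith)] at hb'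
    rw [abs_of_neg (by linarith)]
    linarith

/-- The orbit of a plateau never comes back to the plateau if the rotation number is irrational. -/
lemma CircleDeg1Lift.iterate_sub_notMem_plateau (G : CircleDeg1Lift) {a b s : ℝ}
    (hconst : ∀ x ∈ Icc a b, G x = G s) (hirr : Irrational G.translationNumber) {n : ℕ}
    (hn : 1 ≤ n) (k : ℤ) : G^[n] s - k ∉ Icc a b := by
  intro h
  have h1 := hconst _ h
  have h2 : G (G^[n] s) = G s + k := by
    rw [← h1, ← G.map_add_int, sub_add_cancel]
  have h3 : (G ^ n) (G s) = G s + k := by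
    rw [CircleDeg1Lift.coe_pow, ← Function.iterate_succ_apply, Function.iterate_succ_apply', h2]
  have h4 := G.translationNumber_of_map_pow_eq_add_int h3 hn
  rw [h4] at hirr
  refine hirr ⟨(k / n : ℚ), by push_cast; rfl⟩

/-- The same statement for a map that agrees with `G` outside of the plateau. -/
lemma CircleDeg1Lift.iterate_sub_notMem_plateau_of_eq (G : CircleDeg1Lift) {F : ℝ → ℝ} {a b s : ℝ}
    (hF : ∀ (x : ℝ) (k : ℤ), F (x + k) = F x + k) (hconst : ∀ x ∈ Icc a b, G x = G s)
    (heq : ∀ x ∈ Icc b (a + 1), G x = F x) (hs : G s = F s)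
    (hirr : Irrational G.translationNumber) {n : ℕ} (hn : 1 ≤ n) (k : ℤ) :
    F^[n] s - k ∉ Icc a b := by
  have key : ∀ j, F^[j] s = G^[j] s := by
    intro j
    induction j with
    | zero => rfl
    | succ j ih =>
      rw [Function.iterate_succ_apply', Function.iterate_succ_apply', ih]
      rcases Nat.eq_zero_or_pos j with rfl | hj
      · simpa using hs.symm
      · set z := G^[j] s with hz
        have hfl := Int.floor_le (z - a)
        have hfl' := Int.lt_floor_add_one (z - a)
        have hnm := G.iterate_sub_notMem_plateau hconst hirr hj ⌊z - a⌋
        rw [← hz] at hnm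
        have hb : b < z - ⌊z - a⌋ := by
          by_contra hcon
          exact hnm ⟨by linarith, by linarith⟩
        have := heq (z - ⌊z - a⌋) ⟨hb.le, by linarith⟩
        have e : z = (z - ⌊z - a⌋) + (⌊z - a⌋ : ℤ) := by ring
        rw [e, hF, G.map_add_int, this]
  rw [key]
  exact G.iterate_sub_notMem_plateau hconst hirr hn k

/-- A right inverse of a map on an interval is differentiable. -/
lemma HasTwoDerivs.hasDerivAt_rightInverse {φ φ₁ φ₂ : ℝ → ℝ} (h : HasTwoDerivs φ φ₁ φ₂)
    {s t : Set ℝ} {Ψ : ℝ → ℝ} (hs : IsOpen s) (ht : IsOpen t) (hinj : InjOn φ s)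
    (hΨ : ∀ z ∈ t, Ψ z ∈ s ∧ φ (Ψ z) = z) {z : ℝ} (hz : z ∈ t) (hne : φ₁ (Ψ z) ≠ 0) :
    HasDerivAt Ψ (φ₁ (Ψ z))⁻¹ z := by
  have hst : HasStrictDerivAt φ (φ₁ (Ψ z)) (Ψ z) :=
    hasStrictDerivAt_of_hasDerivAt_of_continuousAt (Eventually.of_forall h.fst)
      h.continuous_fst.continuousAt
  have hev : ∀ᶠ x in nhds (Ψ z), Ψ (φ x) = x := by
    have h1 : φ ⁻¹' t ∈ nhds (Ψ z) :=
      h.continuous.continuousAt.preimage_mem_nhds (by rw [(hΨ z hz).2]; exact ht.mem_nhds hz)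
    filter_upwards [h1, hs.mem_nhds (hΨ z hz).1] with x hx hxs
    exact hinj (hΨ _ hx).1 hxs (hΨ _ hx).2
  have := (hst.to_local_left_inverse hne hev).hasDerivAt
  rwa [(hΨ z hz).2] at this

namespace BimodData
variable (B : BimodData)

lemma hasTwoDerivs : HasTwoDerivs B.F (deriv B.F) (deriv (deriv B.F)) := B.hC2.hasTwoDerivs

lemma continuous_F : Continuous B.F := B.hasTwoDerivs.continuous

lemma F_add_int (x : ℝ) (k : ℤ) : B.F (x + k) = B.F x + k := by
  have hn : ∀ (n : ℕ) (x : ℝ), B.F (x + n) = B.F x + n := by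
    intro n
    induction n with
    | zero => simp
    | succ n ih => intro x; push_cast; rw [← add_assoc, B.hlift, ih]; ring
  obtain ⟨n, rfl | rfl⟩ := k.eq_nat_or_neg
  · exact_mod_cast hn n x
  · have := hn n (x + ((-n : ℤ) : ℝ))
    push_cast at this ⊢
    rw [neg_add_cancel_right] at this
    linarith

lemma iterate_add_int (n : ℕ) (x : ℝ) (k : ℤ) : B.F^[n] (x + k) = B.F^[n] x + k := by
  induction n generalizing x with
  | zero => rfl
  | succ n ih => rw [Function.iterate_succ_apply, B.F_add_int, ih, Function.iterate_succ_apply]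

lemma strictMonoOn : StrictMonoOn B.F (Icc B.ctm (B.ctp + 1)) :=
  strictMonoOn_of_deriv_pos (convex_Icc _ _) B.continuous_F.continuousOn
    (by rw [interior_Icc]; exact B.hincr)

lemma strictAntiOn : StrictAntiOn B.F (Icc B.ctp B.ctm) :=
  strictAntiOn_of_deriv_neg (convex_Icc _ _) B.continuous_F.continuousOn
    (by rw [interior_Icc]; exact B.hdecr)

lemma iterate_ctp_notMem {n : ℕ} (hn : 1 ≤ n) (k : ℤ) :
    B.F^[n] B.ctp - k ∉ Icc B.ctp B.dtp := by
  have hp : B.ctp ∈ Icc B.ctp B.dtp := ⟨le_rfl, (B.h1.trans B.hdtp.1).le⟩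
  exact B.Fp.iterate_sub_notMem_plateau_of_eq B.F_add_int
    (fun x hx => (B.hFp1 x hx).trans (B.hFp1 _ hp).symm) B.hFp2 (B.hFp1 _ hp) B.hirrp hn k

lemma iterate_ctm_notMem {n : ℕ} (hn : 1 ≤ n) (k : ℤ) :
    B.F^[n] B.ctm - k ∉ Icc B.dtm B.ctm := by
  have hp : B.ctm ∈ Icc B.dtm B.ctm := ⟨(B.hdtm.2.trans B.h1).le, le_rfl⟩
  exact B.Fm.iterate_sub_notMem_plateau_of_eq B.F_add_int
    (fun x hx => (B.hFm1 x hx).trans (B.hFm1 _ hp).symm) B.hFm2 (B.hFm1 _ hp) B.hirrm hn k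

/-- `[u, v, v']` in one of the two laps. -/
lemma exists_logKoebe_le : ∃ C ≥ 0,
    (∀ u ∈ Ioo B.ctp B.ctm, ∀ v ∈ Ioo B.ctp B.ctm, ∀ v' ∈ Ioo B.ctp B.ctm, Between u v v' →
      logKoebe B.F (deriv B.F) u v' - logKoebe B.F (deriv B.F) u v ≤ C * |v' - v|) ∧
    ∀ u ∈ Ioo B.ctm (B.ctp + 1), ∀ v ∈ Ioo B.ctm (B.ctp + 1), ∀ v' ∈ Ioo B.ctm (B.ctp + 1),
      Between u v v' →
      logKoebe B.F (deriv B.F) u v' - logKoebe B.F (deriv B.F) u v ≤ C * |v' - v| := by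
  obtain ⟨δ₁, hδ₁, hp1, hp2⟩ := PowerChart.exists_of_nonflat (φ := B.F) (s := -1) B.hpsipC2
    B.hpsipD B.hpsip0 B.hlp (by norm_num) (B.hpsipEq.mono fun x hx => by rw [hx]; ring)
  obtain ⟨δ₂, hδ₂, hm1, hm2⟩ := PowerChart.exists_of_nonflat (φ := B.F) (s := 1) B.hpsimC2
    B.hpsimD B.hpsim0 B.hlm (by norm_num) (B.hpsimEq.mono fun x hx => by rw [hx]; ring)
  have hp3 := hp2.comp_sub_const 1 1 (fun x => by rw [← B.hlift, sub_add_cancel])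
  have hδ : 0 < min δ₁ δ₂ := lt_min hδ₁ hδ₂
  have h1 := min_le_left δ₁ δ₂
  have h2 := min_le_right δ₁ δ₂
  obtain ⟨C₁, hC₁, k1⟩ := B.hasTwoDerivs.exists_logKoebe_le B.h1 hδ
    (fun x hx y hy => mul_pos_of_neg_of_neg (B.hdecr x hx) (B.hdecr y hy))
    (hp1.mono le_rfl (by linarith)) (hm2.mono (by linarith) le_rfl)
  obtain ⟨C₂, hC₂, k2⟩ := B.hasTwoDerivs.exists_logKoebe_le
      (by linarith [B.h2, B.h0] : B.ctm < B.ctp + 1) hδ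
    (fun x hx y hy => mul_pos (B.hincr x hx) (B.hincr y hy))
    (hm1.mono le_rfl (by linarith)) (hp3.mono (by linarith) le_rfl)
  refine ⟨max C₁ C₂, hC₁.trans (le_max_left _ _), fun u hu v hv v' hv' hb => ?_,
    fun u hu v hv v' hv' hb => ?_⟩
  · exact (k1 u hu v hv v' hv' hb).trans
      (mul_le_mul_of_nonneg_right (le_max_left _ _) (abs_nonneg _))
  · exact (k2 u hu v hv v' hv' hb).trans
      (mul_le_mul_of_nonneg_right (le_max_right _ _) (abs_nonneg _))

/-- A chain of inverse branches of `F` over `(d̃⁻, d̃⁺)`: the last one takes values in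
`(c̃⁺, c̃⁻)`, the others take values in `(c̃⁻, c̃⁺ + 1)`. -/
structure IsChain (m : ℕ) (H H' : ℕ → ℝ → ℝ) (n : ℕ → ℤ) : Prop where
  pos : 1 ≤ m
  zero : ∀ y, H 0 y = y
  deriv_zero : ∀ y, H' 0 y = 1
  map : ∀ j < m, ∀ y ∈ Ioo B.dtm B.dtp, B.F (H (j + 1) y) = H j y + n j
  mem : ∀ j, j + 1 < m → ∀ y ∈ Ioo B.dtm B.dtp, H (j + 1) y ∈ Ioo B.ctm (B.ctp + 1)
  last : ∀ y ∈ Ioo B.dtm B.dtp, H m y ∈ Ioo B.ctp B.ctm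
  deriv_succ : ∀ j < m, ∀ y ∈ Ioo B.dtm B.dtp, H' (j + 1) y = H' j y / deriv B.F (H (j + 1) y)
  hasDerivAt : ∀ j ≤ m, ∀ y ∈ Ioo B.dtm B.dtp, HasDerivAt (H j) (H' j y) y

variable {B} {m : ℕ} {H H' : ℕ → ℝ → ℝ} {n : ℕ → ℤ}

lemma mem_Ioo_of_mem_Icc {y : ℝ} (hy : y ∈ Icc B.ctp B.ctm) : y ∈ Ioo B.dtm B.dtp :=
  ⟨B.hdtm.2.trans_le hy.1, hy.2.trans_lt B.hdtp.1⟩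

namespace IsChain

lemma mem_or (h : B.IsChain m H H' n) {j : ℕ} (hj : j < m) :
    (∀ y ∈ Ioo B.dtm B.dtp, H (j + 1) y ∈ Ioo B.ctp B.ctm) ∨
      ∀ y ∈ Ioo B.dtm B.dtp, H (j + 1) y ∈ Ioo B.ctm (B.ctp + 1) := by
  rcases (Nat.succ_le_of_lt hj).eq_or_lt with e | hlt
  · left
    have := h.last
    rwa [← e] at this
  · right
    exact h.mem j hlt

lemma deriv_F_ne (h : B.IsChain m H H' n) {j : ℕ} (hj : j < m) {y : ℝ} (hy : y ∈ Ioo B.dtm B.dtp) :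
    deriv B.F (H (j + 1) y) ≠ 0 := by
  rcases h.mem_or hj with h1 | h1
  · exact (B.hdecr _ (h1 y hy)).ne
  · exact (B.hincr _ (h1 y hy)).ne'

lemma deriv_ne (h : B.IsChain m H H' n) {j : ℕ} (hj : j ≤ m) {y : ℝ} (hy : y ∈ Ioo B.dtm B.dtp) :
    H' j y ≠ 0 := by
  induction j with
  | zero => rw [h.deriv_zero]; exact one_ne_zero
  | succ j ih =>
    rw [h.deriv_succ j hj y hy]
    exact div_ne_zero (ih (by lia)) (h.deriv_F_ne hj hy)

lemma iterate_eq (h : B.IsChain m H H' n) (i k : ℕ) (hik : k + i ≤ m) {y : ℝ}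
    (hy : y ∈ Ioo B.dtm B.dtp) : ∃ N : ℤ, B.F^[i] (H (k + i) y) = H k y + N := by
  induction i with
  | zero => exact ⟨0, by simp⟩
  | succ i ih =>
    obtain ⟨N, hN⟩ := ih (by lia)
    refine ⟨N + n (k + i), ?_⟩
    rw [Function.iterate_succ_apply, ← add_assoc, h.map (k + i) (by lia) y hy,
        B.iterate_add_int, hN]
    push_cast; ring

lemma iterate_last (h : B.IsChain m H H' n) {y : ℝ}
    (hy : y ∈ Ioo B.dtm B.dtp) : ∃ N : ℤ, B.F^[m] (H m y) = y + N := by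
  obtain ⟨N, hN⟩ := h.iterate_eq m 0 (by lia) hy
  rw [zero_add, h.zero] at hN
  exact ⟨N, hN⟩

lemma between (h : B.IsChain m H H' n) {j : ℕ} (hj : j ≤ m) {u v v' : ℝ} (hu : u ∈ Ioo B.dtm B.dtp)
    (hv : v ∈ Ioo B.dtm B.dtp) (hv' : v' ∈ Ioo B.dtm B.dtp) (hb : Between u v v') :
    Between (H j u) (H j v) (H j v') := by
  induction j with
  | zero => simpa only [h.zero] using hb
  | succ j ih =>
    have ih := ih (by lia)
    have eu := h.map j hj u hu
    have ev := h.map j hj v hv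
    have ev' := h.map j hj v' hv'
    rcases h.mem_or hj with h1 | h1
    · have s1 := B.strictAntiOn.lt_iff_gt (Ioo_subset_Icc_self (h1 u hu))
          (Ioo_subset_Icc_self (h1 v hv))
      have s2 := B.strictAntiOn.lt_iff_gt (Ioo_subset_Icc_self (h1 v hv))
          (Ioo_subset_Icc_self (h1 u hu))
      have s3 := B.strictAntiOn.le_iff_ge (Ioo_subset_Icc_self (h1 v hv))
          (Ioo_subset_Icc_self (h1 v' hv'))
      have s4 := B.strictAntiOn.le_iff_ge (Ioo_subset_Icc_self (h1 v' hv'))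
          (Ioo_subset_Icc_self (h1 v hv))
      rw [eu, ev] at s1 s2
      rw [ev, ev'] at s3 s4
      rcases ih with ⟨i1, i2⟩ | ⟨i1, i2⟩
      · right; exact ⟨s3.1 (by linarith), s1.1 (by linarith)⟩
      · left; exact ⟨s2.1 (by linarith), s4.1 (by linarith)⟩
    · have s1 := B.strictMonoOn.lt_iff_lt (Ioo_subset_Icc_self (h1 u hu))
          (Ioo_subset_Icc_self (h1 v hv))
      have s2 := B.strictMonoOn.lt_iff_lt (Ioo_subset_Icc_self (h1 v hv))
          (Ioo_subset_Icc_self (h1 u hu))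
      have s3 := B.strictMonoOn.le_iff_le (Ioo_subset_Icc_self (h1 v hv))
          (Ioo_subset_Icc_self (h1 v' hv'))
      have s4 := B.strictMonoOn.le_iff_le (Ioo_subset_Icc_self (h1 v' hv'))
          (Ioo_subset_Icc_self (h1 v hv))
      rw [eu, ev] at s1 s2
      rw [ev, ev'] at s3 s4
      rcases ih with ⟨i1, i2⟩ | ⟨i1, i2⟩
      · left; exact ⟨s1.1 (by linarith), s3.1 (by linarith)⟩
      · right; exact ⟨s4.1 (by linarith), s2.1 (by linarith)⟩

/-- Koebe-type control of the derivative of a chain. -/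
lemma koebe_sum (h : B.IsChain m H H' n) {C : ℝ}
    (hC1 : ∀ u ∈ Ioo B.ctp B.ctm, ∀ v ∈ Ioo B.ctp B.ctm, ∀ v' ∈ Ioo B.ctp B.ctm, Between u v v' →
      logKoebe B.F (deriv B.F) u v' - logKoebe B.F (deriv B.F) u v ≤ C * |v' - v|)
    (hC2 : ∀ u ∈ Ioo B.ctm (B.ctp + 1), ∀ v ∈ Ioo B.ctm (B.ctp + 1),
      ∀ v' ∈ Ioo B.ctm (B.ctp + 1), Between u v v' →
      logKoebe B.F (deriv B.F) u v' - logKoebe B.F (deriv B.F) u v ≤ C * |v' - v|)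
    {j : ℕ} (hj : j ≤ m) {u v v' : ℝ} (hu : u ∈ Ioo B.dtm B.dtp)
    (hv : v ∈ Ioo B.dtm B.dtp) (hv' : v' ∈ Ioo B.dtm B.dtp) (hb : Between u v v') :
    (- Real.log (H' j v') + 2 * Real.log (H j v' - H j u) - 2 * Real.log (v' - u))
      - (- Real.log (H' j v) + 2 * Real.log (H j v - H j u) - 2 * Real.log (v - u))
      ≤ C * ∑ i ∈ Finset.range j, |H (i + 1) v' - H (i + 1) v| := by
  induction j with
  | zero => simp [h.zero, h.deriv_zero]
  | succ j ih =>
    have ih := ih (by lia)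
    rw [Finset.sum_range_succ, mul_add]
    have hbt := h.between hj hu hv hv' hb
    have hk : logKoebe B.F (deriv B.F) (H (j + 1) u) (H (j + 1) v')
        - logKoebe B.F (deriv B.F) (H (j + 1) u) (H (j + 1) v)
        ≤ C * |H (j + 1) v' - H (j + 1) v| := by
      rcases h.mem_or hj with h1 | h1
      · exact hC1 _ (h1 u hu) _ (h1 v hv) _ (h1 v' hv') hbt
      · exact hC2 _ (h1 u hu) _ (h1 v hv) _ (h1 v' hv') hbt
    have e : ∀ w ∈ Ioo B.dtm B.dtp, logKoebe B.F (deriv B.F) (H (j + 1) u) (H (j + 1) w)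
        = (Real.log (H' j w) - Real.log (H' (j + 1) w)) + 2 * Real.log (H (j + 1) w - H (j + 1) u)
          - 2 * Real.log (H j w - H j u) := by
      intro w hw
      rw [logKoebe, h.map j hj w hw, h.map j hj u hu, h.deriv_succ j hj w hw,
        Real.log_div (h.deriv_ne (by lia) hw) (h.deriv_F_ne hj hw), add_sub_add_right_eq_sub]
      ring
    rw [e v' hv', e v hv] at hk
    linarith

/-- The images of `[c̃⁺, c̃⁻]` along a chain are disjoint, so their total length is bounded. -/
lemma sum_abs_sub_le (h : B.IsChain m H H' n) {j : ℕ} (hj : j ≤ m) {y y' : ℝ}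
    (hy : y ∈ Icc B.ctp B.ctm) (hy' : y' ∈ Icc B.ctp B.ctm) :
    ∑ i ∈ Finset.range j, |H (i + 1) y' - H (i + 1) y| ≤ 2 := by
  have hsub : uIcc y y' ⊆ Icc B.ctp B.ctm := uIcc_subset_Icc hy hy'
  have hcont : ∀ i ≤ m, ContinuousOn (H i) (uIcc y y') := fun i hi z hz =>
    (h.hasDerivAt i hi z (mem_Ioo_of_mem_Icc (hsub hz))).continuousAt.continuousWithinAt
  have himg : ∀ i ≤ m, uIcc (H i y) (H i y') ⊆ H i '' uIcc y y' := fun i hi =>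
    intermediate_value_uIcc (hcont i hi)
  have h0 := B.h0
  have h1 := B.h1
  have h2 := B.h2
  have key : ∀ k, k < m → ∑ i ∈ Finset.range k, |H (i + 1) y' - H (i + 1) y| ≤ 1 := by
    intro k hk
    have hdisj : (Finset.range k : Set ℕ).PairwiseDisjoint
        fun i => uIcc (H (i + 1) y) (H (i + 1) y') := by
      have main : ∀ i i', i < i' → i' < k → Disjoint (uIcc (H (i + 1) y) (H (i + 1) y'))
          (uIcc (H (i' + 1) y) (H (i' + 1) y')) := by
        intro i i' hii hi'
        rw [Set.disjoint_left]
        intro z hz hz'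
        obtain ⟨a, ha, ea⟩ := himg (i + 1) (by lia) hz
        obtain ⟨b, hb, eb⟩ := himg (i' + 1) (by lia) hz'
        obtain ⟨t, rfl⟩ : ∃ t, i' = t + 1 + i := ⟨i' - i - 1, by lia⟩
        obtain ⟨N, hN⟩ := h.iterate_eq (i + 1) 0 (by lia) (mem_Ioo_of_mem_Icc (hsub ha))
        obtain ⟨M, hM⟩ := h.iterate_eq (i + 1) (t + 1) (by lia) (mem_Ioo_of_mem_Icc (hsub hb))
        have hmem := h.mem t (by lia) b (mem_Ioo_of_mem_Icc (hsub hb))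
        rw [zero_add, h.zero, ea] at hN
        rw [← add_assoc, eb, hN] at hM
        have ha' := hsub ha
        have hr : ((N - M : ℤ) : ℝ) = H (t + 1) b - a := by push_cast; linarith
        have hlt1 : ((N - M : ℤ) : ℝ) < 1 := by rw [hr]; linarith [hmem.2, ha'.1]
        have hlt0 : (0 : ℝ) < ((N - M : ℤ) : ℝ) := by rw [hr]; linarith [hmem.1, ha'.2]
        have hi1 : N - M < 1 := by exact_mod_cast hlt1
        have hi0 : 0 < N - M := by exact_mod_cast hlt0
        lia
      intro i hi i' hi' hne
      rw [Finset.coe_range, mem_Iio] at hi hi'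
      rcases lt_or_gt_of_ne hne with hlt | hlt
      · exact main i i' hlt hi'
      · exact (main i' i hlt hi).symm
    have hvol := measure_biUnion_finset (μ := volume) hdisj (fun i _ => measurableSet_uIcc)
    have hle : volume (⋃ i ∈ Finset.range k, uIcc (H (i + 1) y) (H (i + 1) y'))
        ≤ ENNReal.ofReal 1 := by
      calc _ ≤ volume (Ioo B.ctm (B.ctp + 1)) := by
            refine measure_mono (iUnion₂_subset fun i hi => ?_)
            intro z hz
            obtain ⟨a, ha, ea⟩ := himg (i + 1) (by have := Finset.mem_range.1 hi; lia) hz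
            rw [← ea]
            exact h.mem i (by have := Finset.mem_range.1 hi; lia) a (mem_Ioo_of_mem_Icc (hsub ha))
        _ = ENNReal.ofReal (B.ctp + 1 - B.ctm) := Real.volume_Ioo
        _ ≤ ENNReal.ofReal 1 := ENNReal.ofReal_le_ofReal (by linarith)
    rw [hvol] at hle
    simp only [Real.volume_interval] at hle
    rw [← ENNReal.ofReal_sum_of_nonneg (fun i _ => abs_nonneg _)] at hle
    exact (ENNReal.ofReal_le_ofReal_iff zero_le_one).1 hle
  rcases hj.eq_or_lt with rfl | hlt
  · obtain ⟨k, rfl⟩ : ∃ k, j = k + 1 := ⟨j - 1, by have := h.pos; lia⟩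
    rw [Finset.sum_range_succ]
    have a1 := h.last y (mem_Ioo_of_mem_Icc hy)
    have a2 := h.last y' (mem_Ioo_of_mem_Icc hy')
    have : |H (k + 1) y' - H (k + 1) y| ≤ 1 := by
      rw [abs_le]; constructor <;> linarith [a1.1, a1.2, a2.1, a2.2]
    linarith [key k (by lia)]
  · linarith [key j hlt]

end IsChain

/-- Chains of inverse branches have uniformly Lipschitz logarithmic derivative. -/
theorem exists_chain_distortion (B : BimodData) : ∃ K > 0, ∀ m H H' n, B.IsChain m H H' n →
    ∀ y ∈ Icc B.ctp B.ctm, ∀ y' ∈ Icc B.ctp B.ctm,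
      |Real.log (H' m y) - Real.log (H' m y')| ≤ K * |y - y'| := by
  obtain ⟨C, hC0, hC1, hC2⟩ := B.exists_logKoebe_le
  set r := min ((B.ctp - B.dtm) / 2) ((B.dtp - B.ctm) / 2) with hr
  have hdm := B.hdtm.2
  have hdp := B.hdtp.1
  have hpq := B.h1
  have hr0 : 0 < r := lt_min (by linarith) (by linarith)
  have hr1 : r < B.ctp - B.dtm := (min_le_left _ _).trans_lt (by linarith)
  have hr2 : r < B.dtp - B.ctm := (min_le_right _ _).trans_lt (by linarith)
  have one : ∀ {m H H' n}, B.IsChain m H H' n → ∀ j ≤ m, ∀ y ∈ Icc B.ctp B.ctm,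
      ∀ y' ∈ Icc B.ctp B.ctm, Real.log (H' j y) - Real.log (H' j y')
        ≤ 2 / r * |y - y'| + C * ∑ i ∈ Finset.range j, |H (i + 1) y' - H (i + 1) y| := by
    intro m H H' n h j hj y hy y' hy'
    obtain ⟨u, hu, hb, hd⟩ : ∃ u ∈ Ioo B.dtm B.dtp, Between u y y' ∧ r ≤ |y - u| := by
      rcases le_total y y' with hyy | hyy
      · refine ⟨B.ctp - r, ⟨by linarith, by linarith⟩, Or.inl ⟨by linarith [hy.1], hyy⟩, ?_⟩
        exact le_trans (by linarith [hy.1]) (le_abs_self _)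
      · refine ⟨B.ctm + r, ⟨by linarith, by linarith⟩, Or.inr ⟨hyy, by linarith [hy.2]⟩, ?_⟩
        exact le_trans (by linarith [hy.2]) (neg_le_abs _)
    have hyU := mem_Ioo_of_mem_Icc hy
    have hyU' := mem_Ioo_of_mem_Icc hy'
    have hk := h.koebe_sum hC1 hC2 hj hu hyU hyU' hb
    have hbt := h.between hj hu hyU hyU' hb
    have mono : ∀ {a b c : ℝ}, Between a b c → Real.log (b - a) ≤ Real.log (c - a) := by
      intro a b c hbc
      rcases hbc with ⟨i1, i2⟩ | ⟨i1, i2⟩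
      · exact Real.log_le_log (by linarith) (by linarith)
      · rw [← Real.log_abs (b - a), ← Real.log_abs (c - a), abs_of_neg (by linarith),
          abs_of_neg (by linarith)]
        exact Real.log_le_log (by linarith) (by linarith)
    have m1 := mono hbt
    have m2 : Real.log (y' - u) - Real.log (y - u) ≤ |y - y'| / r := by
      have hyu : 0 < |y - u| := hr0.trans_le hd
      have hyu' : 0 < |y' - u| := by
        rw [abs_pos]
        rcases hb with ⟨i1, i2⟩ | ⟨i1, i2⟩ <;> intro hcon <;> linarith
      rw [← Real.log_abs (y' - u), ← Real.log_abs (y - u), ← Real.log_div hyu'.ne' hyu.ne']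
      refine (Real.log_le_sub_one_of_pos (div_pos hyu' hyu)).trans ?_
      rw [div_sub_one hyu.ne']
      have ht : |y' - u| - |y - u| ≤ |y - y'| := by
        have := abs_sub_abs_le_abs_sub (y' - u) (y - u)
        rwa [sub_sub_sub_cancel_right, abs_sub_comm y' y] at this
      calc (|y' - u| - |y - u|) / |y - u| ≤ |y - y'| / |y - u| :=
            div_le_div_of_nonneg_right ht hyu.le
        _ ≤ |y - y'| / r := div_le_div_of_nonneg_left (abs_nonneg _) hr0 hd
    have e : 2 / r * |y - y'| = 2 * (|y - y'| / r) := by ring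
    rw [e]
    linarith
  set c := 2 / r * (B.ctm - B.ctp) + C * 2 with hc
  have hL : 0 < B.ctm - B.ctp := by linarith
  have hsmall : ∀ y ∈ Icc B.ctp B.ctm, ∀ y' ∈ Icc B.ctp B.ctm, |y - y'| ≤ B.ctm - B.ctp := by
    intro y hy y' hy'
    rw [abs_le]; constructor <;> linarith [hy.1, hy.2, hy'.1, hy'.2]
  set K := 2 / r + C * (2 * (Real.exp c / (B.ctm - B.ctp))) with hK
  have hKpos : 0 < K := by positivity
  have two : ∀ {m H H' n}, B.IsChain m H H' n → ∀ y ∈ Icc B.ctp B.ctm,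
      ∀ y' ∈ Icc B.ctp B.ctm, Real.log (H' m y) - Real.log (H' m y') ≤ K * |y - y'| := by
    intro m H H' n h y hy y' hy'
    have hp : B.ctp ∈ Icc B.ctp B.ctm := left_mem_Icc.2 hpq.le
    have hq : B.ctm ∈ Icc B.ctp B.ctm := right_mem_Icc.2 hpq.le
    have hder : ∀ j ≤ m, ∀ z ∈ Icc B.ctp B.ctm,
        |H' j z| ≤ Real.exp c / (B.ctm - B.ctp) * |H j B.ctm - H j B.ctp| := by
      intro j hj z hz
      obtain ⟨ξ, hξ, e⟩ := exists_hasDerivAt_eq_slope (H j) (H' j) hpq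
        (fun x hx => (h.hasDerivAt j hj x
          (mem_Ioo_of_mem_Icc hx)).continuousAt.continuousWithinAt)
        (fun x hx => h.hasDerivAt j hj x (mem_Ioo_of_mem_Icc (Ioo_subset_Icc_self hx)))
      have hξI := Ioo_subset_Icc_self hξ
      have hlog := one h j hj z hz ξ hξI
      have hle : Real.log (H' j z) - Real.log (H' j ξ) ≤ c := by
        refine hlog.trans ?_
        rw [hc]
        have := hsmall z hz ξ hξI
        have := h.sum_abs_sub_le hj hz hξI
        gcongr
      have hzp : 0 < |H' j z| := abs_pos.2 (h.deriv_ne hj (mem_Ioo_of_mem_Icc hz))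
      have hξp : 0 < |H' j ξ| := abs_pos.2 (h.deriv_ne hj (mem_Ioo_of_mem_Icc hξI))
      rw [← Real.log_abs (H' j z), ← Real.log_abs (H' j ξ), ← Real.log_div hzp.ne' hξp.ne',
        Real.log_le_iff_le_exp (div_pos hzp hξp), div_le_iff₀ hξp, e, abs_div, abs_of_pos hL] at hle
      exact hle.trans_eq (by ring)
    have hdist : ∀ j ≤ m, |H j y' - H j y|
        ≤ Real.exp c / (B.ctm - B.ctp) * |H j B.ctm - H j B.ctp| * |y - y'| := by
      intro j hj
      have := (convex_Icc B.ctp B.ctm).norm_image_sub_le_of_norm_hasDerivWithin_le (f := H j)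
        (f' := H' j) (fun x hx => (h.hasDerivAt j hj x (mem_Ioo_of_mem_Icc hx)).hasDerivWithinAt)
        (fun x hx => by rw [Real.norm_eq_abs]; exact hder j hj x hx) hy hy'
      rwa [Real.norm_eq_abs, Real.norm_eq_abs, abs_sub_comm y' y] at this
    have hsum : ∑ i ∈ Finset.range m, |H (i + 1) y' - H (i + 1) y|
        ≤ Real.exp c / (B.ctm - B.ctp) * 2 * |y - y'| := by
      calc _ ≤ ∑ i ∈ Finset.range m, Real.exp c / (B.ctm - B.ctp)
              * |H (i + 1) B.ctm - H (i + 1) B.ctp| * |y - y'| :=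
            Finset.sum_le_sum fun i hi => hdist (i + 1) (Finset.mem_range.1 hi)
        _ = Real.exp c / (B.ctm - B.ctp)
              * (∑ i ∈ Finset.range m, |H (i + 1) B.ctm - H (i + 1) B.ctp|) * |y - y'| := by
            rw [← Finset.sum_mul, ← Finset.mul_sum]
        _ ≤ _ := by
            have := h.sum_abs_sub_le le_rfl hp hq
            gcongr
    refine (one h m le_rfl y hy y' hy').trans ?_
    rw [hK, add_mul]
    have := mul_le_mul_of_nonneg_left hsum hC0
    linarith
  refine ⟨K, hKpos, fun m H H' n h y hy y' hy' => ?_⟩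
  rw [abs_le]
  have i1 := two h y hy y' hy'
  have i2 := two h y' hy' y hy
  rw [abs_sub_comm] at i2
  constructor <;> linarith

end BimodData

namespace BimodData
variable (B : BimodData)

/-- An increasing inverse branch of an iterate over `(d̃⁻, d̃⁺)` does not meet critical values. -/
lemma add_int_mem_Ioo {h : ℝ → ℝ} {j : ℕ} {n e : ℤ} {X : ℝ}
    (hcont : ContinuousOn h (Ioo B.dtm B.dtp)) (hmono : StrictMonoOn h (Ioo B.dtm B.dtp))
    (hit : ∀ y ∈ Ioo B.dtm B.dtp, ∃ N : ℤ, B.F^[j] (h y) = y + N) (hX : X ∈ Icc B.ctp B.ctm)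
    (hXn : h X + n ∈ Ioo (B.F B.ctm) (B.F B.ctp + e)) {y : ℝ} (hy : y ∈ Ioo B.dtm B.dtp) :
    h y + n ∈ Ioo (B.F B.ctm) (B.F B.ctp + e) := by
  have hXU := mem_Ioo_of_mem_Icc hX
  constructor
  · by_contra hcon
    push Not at hcon
    have hyX : y < X := by
      by_contra hc
      have := hmono.monotoneOn hXU hy (not_lt.1 hc)
      linarith [hXn.1]
    have hsub : Icc y X ⊆ Ioo B.dtm B.dtp := fun z hz =>
      ⟨hy.1.trans_le hz.1, hz.2.trans_lt hXU.2⟩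
    obtain ⟨z, hz, ez⟩ := intermediate_value_Icc hyX.le (hcont.mono hsub)
      (show B.F B.ctm - n ∈ Icc (h y) (h X) from ⟨by linarith, by linarith [hXn.1]⟩)
    obtain ⟨N, hN⟩ := hit z (hsub hz)
    refine B.iterate_ctm_notMem (n := j + 1) (by lia) (N + n) ?_
    have e1 : B.F B.ctm = h z + n := by linarith
    rw [Function.iterate_succ_apply, e1, B.iterate_add_int, hN]
    have e2 : z + N + n - ((N + n : ℤ) : ℝ) = z := by push_cast; ring
    rw [e2]
    exact ⟨(hsub hz).1.le, hz.2.trans hX.2⟩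
  · by_contra hcon
    push Not at hcon
    have hyX : X < y := by
      by_contra hc
      have := hmono.monotoneOn hy hXU (not_lt.1 hc)
      linarith [hXn.2]
    have hsub : Icc X y ⊆ Ioo B.dtm B.dtp := fun z hz =>
      ⟨hXU.1.trans_le hz.1, hz.2.trans_lt hy.2⟩
    obtain ⟨z, hz, ez⟩ := intermediate_value_Icc hyX.le (hcont.mono hsub)
      (show B.F B.ctp + e - n ∈ Icc (h X) (h y) from ⟨by linarith [hXn.2], by linarith⟩)
    obtain ⟨N, hN⟩ := hit z (hsub hz)
    refine B.iterate_ctp_notMem (n := j + 1) (by lia) (N + n - e) ?_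
    have e1 : B.F B.ctp = h z + ((n - e : ℤ) : ℝ) := by push_cast; linarith
    rw [Function.iterate_succ_apply, e1, B.iterate_add_int, hN]
    have e2 : z + N + ((n - e : ℤ) : ℝ) - ((N + n - e : ℤ) : ℝ) = z := by push_cast; ring
    rw [e2]
    exact ⟨hX.1.trans hz.1, (hsub hz).2.le⟩

/-- Every point of `(c̃⁺, c̃⁻)` which returns to `[c̃⁺, c̃⁻]` modulo `1` lies in the image of a
chain of inverse branches. -/
theorem exists_chain {x : ℝ} (hx : x ∈ Ioo B.ctp B.ctm) {m : ℕ} (hm : 1 ≤ m) {k : ℤ}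
    (hk : B.F^[m] x - k ∈ Icc B.ctp B.ctm)
    (hno : ∀ j, 1 ≤ j → j < m → ∀ k : ℤ, B.F^[j] x - k ∉ Icc B.ctp B.ctm) :
    ∃ H H' n, B.IsChain m H H' n ∧ H m (B.F^[m] x - k) = x := by
  have hpq : B.ctm < B.ctp + 1 := by linarith [B.h0, B.h2]
  have hΨ : ∀ z ∈ Ioo (B.F B.ctm) (B.F B.ctp + 1), ∃ w ∈ Ioo B.ctm (B.ctp + 1), B.F w = z := by
    intro z hz
    rw [← B.hlift] at hz
    exact intermediate_value_Ioo hpq.le B.continuous_F.continuousOn hz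
  have hΦ : ∀ z ∈ Ioo (B.F B.ctm) (B.F B.ctp), ∃ w ∈ Ioo B.ctp B.ctm, B.F w = z := fun z hz =>
    intermediate_value_Ioo' B.h1.le B.continuous_F.continuousOn hz
  choose! Ψ hΨ using hΨ
  choose! Φ hΦ using hΦ
  set e : ℕ → ℤ :=
      fun j => if j = 0 then k else if j = m then 0 else ⌊B.F^[m - j] x - B.ctp⌋ with he
  set a : ℕ → ℝ := fun j => B.F^[m - j] x - e j with ha
  set n : ℕ → ℤ := fun j => e j - e (j + 1) with hn
  have ha0 : a 0 = B.F^[m] x - k := by simp [ha, he]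
  have ham : a m = x := by
    have : m ≠ 0 := by lia
    simp [ha, he, this]
  have hamid : ∀ j, j + 1 < m → a (j + 1) ∈ Ioo B.ctm (B.ctp + 1) := by
    intro j hj
    have e1 : e (j + 1) = ⌊B.F^[m - (j + 1)] x - B.ctp⌋ := by
      simp [he, show j + 1 ≠ m by lia]
    have hno' := hno (m - (j + 1)) (by lia) (by lia) ⌊B.F^[m - (j + 1)] x - B.ctp⌋
    have f1 := Int.floor_le (B.F^[m - (j + 1)] x - B.ctp)
    have f2 := Int.lt_floor_add_one (B.F^[m - (j + 1)] x - B.ctp)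
    simp only [ha, e1]
    constructor
    · by_contra hcon
      exact hno' ⟨by linarith, not_lt.1 hcon⟩
    · linarith
  have hstep : ∀ j < m, B.F (a (j + 1)) = a j + n j := by
    intro j hj
    have e1 : a (j + 1) = B.F^[m - (j + 1)] x + ((-e (j + 1) : ℤ) : ℝ) := by
      simp [ha, sub_eq_add_neg]
    rw [e1, B.F_add_int, ← Function.iterate_succ_apply' B.F, show (m - (j + 1)).succ = m - j by lia]
    simp only [ha, hn]
    push_cast; ring
  have haI : a 0 ∈ Icc B.ctp B.ctm := ha0 ▸ hk
  set X := a 0 with hX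
  set H : ℕ → ℝ → ℝ := fun j => Nat.rec (fun y => y)
    (fun j h y => (if j + 1 < m then Ψ else Φ) (h y + n j)) j with hH
  have H0 : ∀ y, H 0 y = y := fun y => rfl
  have HS : ∀ j y, H (j + 1) y = (if j + 1 < m then Ψ else Φ) (H j y + n j) := fun j y => rfl
  clear_value H
  set H' : ℕ → ℝ → ℝ := fun j => Nat.rec (fun _ => 1)
    (fun j h' y => h' y / deriv B.F (H (j + 1) y)) j with hH'
  have H'0 : ∀ y, H' 0 y = 1 := fun y => rfl
  have H'S : ∀ j y, H' (j + 1) y = H' j y / deriv B.F (H (j + 1) y) := fun j y => rfl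
  clear_value H'
  have hsucc : ∀ j < m, (∀ y ∈ Ioo B.dtm B.dtp, HasDerivAt (H j) (H' j y) y) →
      StrictMonoOn (H j) (Ioo B.dtm B.dtp) → H j X = a j →
      (∀ y ∈ Ioo B.dtm B.dtp, ∃ N : ℤ, B.F^[j] (H j y) = y + N) →
      (∀ y ∈ Ioo B.dtm B.dtp, B.F (H (j + 1) y) = H j y + n j) ∧
      (∀ y ∈ Ioo B.dtm B.dtp, HasDerivAt (H (j + 1)) (H' (j + 1) y) y) ∧
      H (j + 1) X = a (j + 1) ∧
      (j + 1 < m → ∀ y ∈ Ioo B.dtm B.dtp, H (j + 1) y ∈ Ioo B.ctm (B.ctp + 1)) ∧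
      (j + 1 = m → ∀ y ∈ Ioo B.dtm B.dtp, H (j + 1) y ∈ Ioo B.ctp B.ctm) := by
    intro j hj hder hmono hXa hit
    have hcont : ContinuousOn (H j) (Ioo B.dtm B.dtp) := fun y hy =>
      (hder y hy).continuousAt.continuousWithinAt
    have hXU := mem_Ioo_of_mem_Icc haI
    by_cases hjm : j + 1 < m
    · have HS' : ∀ y, H (j + 1) y = Ψ (H j y + n j) := fun y => by rw [HS, if_pos hjm]
      have hr : ∀ y ∈ Ioo B.dtm B.dtp, H j y + n j ∈ Ioo (B.F B.ctm) (B.F B.ctp + 1) := by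
        intro y hy
        have := B.add_int_mem_Ioo (n := n j) (e := 1) hcont hmono hit haI (by
          rw [hXa, ← hstep j hj, Int.cast_one, ← B.hlift]
          have hm' := hamid j hjm
          exact ⟨B.strictMonoOn (left_mem_Icc.2 hpq.le) (Ioo_subset_Icc_self hm') hm'.1,
            B.strictMonoOn (Ioo_subset_Icc_self hm') (right_mem_Icc.2 hpq.le) hm'.2⟩) hy
        rwa [Int.cast_one] at this
      refine ⟨fun y hy => ?_, fun y hy => ?_, ?_, fun _ y hy => ?_, fun h => absurd h (by lia)⟩
      · rw [HS', (hΨ _ (hr y hy)).2]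
      · have hne : deriv B.F (Ψ (H j y + n j)) ≠ 0 := (B.hincr _ (hΨ _ (hr y hy)).1).ne'
        have h1 := B.hasTwoDerivs.hasDerivAt_rightInverse isOpen_Ioo isOpen_Ioo
          (B.strictMonoOn.injOn.mono Ioo_subset_Icc_self) hΨ (hr y hy) hne
        have h2 := h1.comp y ((hder y hy).add_const (n j : ℝ))
        have e2 : H (j + 1) = Ψ ∘ fun y => H j y + n j := funext HS'
        rw [H'S, HS', e2]
        exact h2.congr_deriv (by ring)
      · rw [HS']
        refine B.strictMonoOn.injOn (Ioo_subset_Icc_self (hΨ _ (hr X hXU)).1)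
          (Ioo_subset_Icc_self (hamid j hjm)) ?_
        rw [(hΨ _ (hr X hXU)).2, hXa, hstep j hj]
      · rw [HS']; exact (hΨ _ (hr y hy)).1
    · have hjm' : j + 1 = m := by lia
      have HS' : ∀ y, H (j + 1) y = Φ (H j y + n j) := fun y => by rw [HS, if_neg hjm]
      have haj : a (j + 1) = x := by rw [hjm', ham]
      have hr : ∀ y ∈ Ioo B.dtm B.dtp, H j y + n j ∈ Ioo (B.F B.ctm) (B.F B.ctp) := by
        intro y hy
        have := B.add_int_mem_Ioo (n := n j) (e := 0) hcont hmono hit haI (by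
          rw [hXa, ← hstep j hj, Int.cast_zero, add_zero, haj]
          exact ⟨B.strictAntiOn (Ioo_subset_Icc_self hx) (right_mem_Icc.2 B.h1.le) hx.2,
            B.strictAntiOn (left_mem_Icc.2 B.h1.le) (Ioo_subset_Icc_self hx) hx.1⟩) hy
        rwa [Int.cast_zero, add_zero] at this
      refine ⟨fun y hy => ?_, fun y hy => ?_, ?_, fun h => absurd h hjm, fun _ y hy => ?_⟩
      · rw [HS', (hΦ _ (hr y hy)).2]
      · have hne : deriv B.F (Φ (H j y + n j)) ≠ 0 := (B.hdecr _ (hΦ _ (hr y hy)).1).ne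
        have h1 := B.hasTwoDerivs.hasDerivAt_rightInverse isOpen_Ioo isOpen_Ioo
          (B.strictAntiOn.injOn.mono Ioo_subset_Icc_self) hΦ (hr y hy) hne
        have h2 := h1.comp y ((hder y hy).add_const (n j : ℝ))
        have e2 : H (j + 1) = Φ ∘ fun y => H j y + n j := funext HS'
        rw [H'S, HS', e2]
        exact h2.congr_deriv (by ring)
      · rw [HS']
        refine B.strictAntiOn.injOn (Ioo_subset_Icc_self (hΦ _ (hr X hXU)).1)
          (haj ▸ Ioo_subset_Icc_self hx) ?_
        rw [(hΦ _ (hr X hXU)).2, hXa, hstep j hj]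
      · rw [HS']; exact (hΦ _ (hr y hy)).1
  have hall : ∀ j < m, (∀ y ∈ Ioo B.dtm B.dtp, HasDerivAt (H j) (H' j y) y) ∧
      StrictMonoOn (H j) (Ioo B.dtm B.dtp) ∧ H j X = a j ∧
      (∀ y ∈ Ioo B.dtm B.dtp, ∃ N : ℤ, B.F^[j] (H j y) = y + N) := by
    intro j
    induction j with
    | zero =>
      intro _
      have e0 : H 0 = fun y => y := funext H0
      refine ⟨fun y _ => ?_, ?_, H0 X, fun y _ => ⟨0, by simp [H0]⟩⟩
      · rw [H'0, e0]; exact hasDerivAt_id y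
      · rw [e0]; exact strictMono_id.strictMonoOn _
    | succ j ih =>
      intro hj
      obtain ⟨i1, i2, i3, i4⟩ := ih (by lia)
      obtain ⟨s1, s2, s3, s4, -⟩ := hsucc j (by lia) i1 i2 i3 i4
      refine ⟨s2, fun u hu v hv huv => ?_, s3, fun y hy => ?_⟩
      · refine (B.strictMonoOn.lt_iff_lt (Ioo_subset_Icc_self (s4 hj u hu))
          (Ioo_subset_Icc_self (s4 hj v hv))).1 ?_
        rw [s1 u hu, s1 v hv]
        linarith [i2 hu hv huv]
      · obtain ⟨N, hN⟩ := i4 y hy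
        refine ⟨N + n j, ?_⟩
        rw [Function.iterate_succ_apply, s1 y hy, B.iterate_add_int, hN]
        push_cast; ring
  have hfull : ∀ j (hj : j < m), _ := fun j hj =>
    hsucc j hj (hall j hj).1 (hall j hj).2.1 (hall j hj).2.2.1 (hall j hj).2.2.2
  obtain ⟨M, hM⟩ : ∃ M, m = M + 1 := ⟨m - 1, by lia⟩
  refine ⟨H, H', n, ⟨hm, H0, H'0, fun j hj => (hfull j hj).1,
    fun j hj => (hfull j (by lia)).2.2.2.1 hj, ?_, fun j _ y _ => H'S j y, fun j hj => ?_⟩, ?_⟩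
  · have := (hfull M (by lia)).2.2.2.2 hM.symm
    rwa [← hM] at this
  · rcases hj.eq_or_lt with hj | hj
    · rw [hj, hM]; exact (hfull M (by lia)).2.1
    · exact (hall j hj).1
  · have := (hfull M (by lia)).2.2.1
    rwa [← hM, ham, ha0] at this

end BimodData

namespace BimodData
variable (B : BimodData)

lemma iterate_coe (k : ℕ) (x : ℝ) :
    B.f^[k] (x : UnitAddCircle) = ((B.F^[k] x : ℝ) : UnitAddCircle) := by
  induction k generalizing x with
  | zero => rfl
  | succ k ih => rw [Function.iterate_succ_apply, B.hf, ih, Function.iterate_succ_apply]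

lemma coe_eq_coe_iff {x y : ℝ} : (x : UnitAddCircle) = y ↔ ∃ k : ℤ, x = y + k := by
  rw [← sub_eq_zero, ← AddCircle.coe_sub, AddCircle.coe_eq_zero_iff]
  constructor
  · rintro ⟨k, hk⟩
    refine ⟨k, ?_⟩
    simp at hk
    linarith
  · rintro ⟨k, hk⟩
    refine ⟨k, ?_⟩
    simp [hk]

lemma coe_mem_II {z : ℝ} :
    (z : UnitAddCircle) ∈ B.II ↔ ∃ k : ℤ, z - k ∈ Icc B.ctp B.ctm := by
  constructor
  · rintro ⟨x, hx, hxz⟩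
    obtain ⟨k, hk⟩ := coe_eq_coe_iff.1 hxz.symm
    exact ⟨k, by rwa [hk, add_sub_cancel_right]⟩
  · rintro ⟨k, hk⟩
    exact ⟨z - k, hk, coe_eq_coe_iff.2 ⟨-k, by push_cast; ring⟩⟩

/-- The projection to the circle is injective on intervals of length less than one. -/
lemma coe_injOn {a b x y : ℝ} (hab : b < a + 1) (hx : x ∈ Icc a b) (hy : y ∈ Icc a b)
    (h : (x : UnitAddCircle) = y) : x = y := by
  obtain ⟨k, rfl⟩ := coe_eq_coe_iff.1 h
  have h1 : (k : ℝ) < 1 := by linarith [hx.2, hy.1]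
  have h2 : (-1 : ℝ) < k := by linarith [hx.1, hy.2]
  have : k = 0 := by
    have h1' : k < 1 := by exact_mod_cast h1
    have h2' : -1 < k := by exact_mod_cast h2
    lia
  simp [this]

lemma continuous_f : Continuous B.f := by
  have : Continuous fun x : ℝ => B.f (x : UnitAddCircle) := by
    simp only [B.hf]
    exact (AddCircle.continuous_mk' 1).comp B.continuous_F
  have hq := QuotientAddGroup.isQuotientMap_mk (N := AddSubgroup.zmultiples (1 : ℝ))
  exact hq.continuous_iff.2 this

lemma deriv_F_add_int (x : ℝ) (k : ℤ) : deriv B.F (x + k) = deriv B.F x := by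
  rw [← deriv_comp_add_const]
  simp only [B.F_add_int, deriv_add_const]

lemma Df_coe (x : ℝ) : B.Df x = deriv B.F x := by
  have h : (x : UnitAddCircle) = (Int.fract x : ℝ) :=
    coe_eq_coe_iff.2 ⟨⌊x⌋, (Int.fract_add_floor x).symm⟩
  rw [h, Df, AddCircle.liftIco_coe_apply]
  · conv_rhs => rw [← Int.fract_add_floor x, B.deriv_F_add_int]
  · exact ⟨Int.fract_nonneg x, by simpa using Int.fract_lt_one x⟩

/-- The derivative of `F^[k]`, written via the chain rule. -/
def orbDeriv (k : ℕ) (x : ℝ) : ℝ := ∏ i ∈ Finset.range k, deriv B.F (B.F^[i] x)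

lemma DfIter_coe (k : ℕ) (x : ℝ) : B.DfIter k x = B.orbDeriv k x := by
  simp only [DfIter, orbDeriv, B.iterate_coe, B.Df_coe]

lemma orbDeriv_add_int (k : ℕ) (x : ℝ) (N : ℤ) : B.orbDeriv k (x + N) = B.orbDeriv k x := by
  simp only [orbDeriv, B.iterate_add_int, B.deriv_F_add_int]

lemma orbDeriv_add (a b : ℕ) (x : ℝ) :
    B.orbDeriv (a + b) x = B.orbDeriv a x * B.orbDeriv b (B.F^[a] x) := by
  rw [orbDeriv, Finset.prod_range_add]
  simp only [orbDeriv, ← Function.iterate_add_apply, add_comm]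

lemma hasDerivAt_iterate (k : ℕ) (x : ℝ) : HasDerivAt (B.F^[k]) (B.orbDeriv k x) x := by
  induction k with
  | zero => simpa [orbDeriv] using hasDerivAt_id x
  | succ k ih =>
    rw [Function.iterate_succ', orbDeriv, Finset.prod_range_succ, mul_comm]
    exact ((B.hC2.differentiable (by norm_num)) _).hasDerivAt.comp x ih

lemma N0_ctp : B.N0 (B.ctp : UnitAddCircle) = 0 := by
  refine Nat.sInf_eq_zero.2 (Or.inr (eq_empty_of_forall_notMem ?_))
  rintro n ⟨hn, h⟩
  rw [B.iterate_coe, B.coe_mem_II] at h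
  obtain ⟨k, hk⟩ := h
  exact B.iterate_ctp_notMem hn k ⟨hk.1, hk.2.trans B.hdtp.1.le⟩

lemma N0_ctm : B.N0 (B.ctm : UnitAddCircle) = 0 := by
  refine Nat.sInf_eq_zero.2 (Or.inr (eq_empty_of_forall_notMem ?_))
  rintro n ⟨hn, h⟩
  rw [B.iterate_coe, B.coe_mem_II] at h
  obtain ⟨k, hk⟩ := h
  exact B.iterate_ctm_notMem hn k ⟨B.hdtm.2.le.trans hk.1, hk.2⟩

lemma mem_Ioo_of_N0_pos {x : ℝ} (hx : x ∈ Icc B.ctp B.ctm) (h : 1 ≤ B.N0 x) :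
    x ∈ Ioo B.ctp B.ctm := by
  refine ⟨hx.1.lt_of_ne ?_, hx.2.lt_of_ne ?_⟩
  · rintro rfl
    simp [B.N0_ctp] at h
  · rintro rfl
    simp [B.N0_ctm] at h

/-- A point of `(c̃⁺, c̃⁻)` with a first return time lies on an inverse branch. -/
lemma exists_chain_of_N0 {x : ℝ} (hx : x ∈ Icc B.ctp B.ctm) (h : 1 ≤ B.N0 x) :
    ∃ H H' n, B.IsChain (B.N0 x) H H' n ∧ ∃ y ∈ Icc B.ctp B.ctm, H (B.N0 x) y = x := by
  have hne : (B.returnSet x).Nonempty := by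
    by_contra hem
    rw [not_nonempty_iff_eq_empty] at hem
    simp [N0, hem] at h
  have hmem := Nat.sInf_mem hne
  change B.N0 x ∈ B.returnSet x at hmem
  obtain ⟨k, hk⟩ := B.coe_mem_II.1 (B.iterate_coe _ _ ▸ hmem.2)
  obtain ⟨H, H', n, hc, he⟩ := B.exists_chain (B.mem_Ioo_of_N0_pos hx h) h hk (by
    intro j hj hjm k hk
    refine Nat.notMem_of_lt_sInf hjm ⟨hj, ?_⟩
    rw [B.iterate_coe, B.coe_mem_II]
    exact ⟨k, hk⟩)
  exact ⟨H, H', n, hc, _, hk, he⟩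

variable {B} {m : ℕ} {H H' : ℕ → ℝ → ℝ} {n : ℕ → ℤ}
namespace IsChain

lemma N0_eq (h : B.IsChain m H H' n) {y : ℝ} (hy : y ∈ Icc B.ctp B.ctm) :
    B.N0 (H m y : ℝ) = m := by
  have hyU := mem_Ioo_of_mem_Icc hy
  obtain ⟨N, hN⟩ := h.iterate_last hyU
  have hm : m ∈ B.returnSet (H m y : ℝ) := by
    refine ⟨h.pos, ?_⟩
    rw [B.iterate_coe, B.coe_mem_II, hN]
    exact ⟨N, by simpa using hy⟩
  refine le_antisymm (Nat.sInf_le hm) (le_csInf ⟨m, hm⟩ ?_)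
  rintro j ⟨hj, hjI⟩
  by_contra! hlt
  obtain ⟨i, rfl⟩ : ∃ i, m = i + 1 + j := ⟨m - j - 1, by lia⟩
  rw [B.iterate_coe, B.coe_mem_II] at hjI
  obtain ⟨k, hk⟩ := hjI
  obtain ⟨N, hN⟩ := h.iterate_eq j (i + 1) le_rfl hyU
  have hI := h.mem i (by lia) y hyU
  rw [hN] at hk
  have h1 : ((N - k : ℤ) : ℝ) < 0 := by push_cast; linarith [hk.2, hI.1]
  have h2 : (-1 : ℝ) < ((N - k : ℤ) : ℝ) := by push_cast; linarith [hk.1, hI.2]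
  have h1' : N - k < 0 := by exact_mod_cast h1
  have h2' : -1 < N - k := by exact_mod_cast h2
  lia

lemma mem_Icc_of_N0 (h : B.IsChain m H H' n) {y : ℝ} (hy : y ∈ Ioo B.dtm B.dtp)
    (hN : B.N0 (H m y : ℝ) = m) : y ∈ Icc B.ctp B.ctm := by
  have hne : (B.returnSet (H m y : ℝ)).Nonempty := by
    by_contra hem
    rw [not_nonempty_iff_eq_empty] at hem
    have := h.pos
    simp [N0, hem] at hN
    lia
  have hmem := Nat.sInf_mem hne
  change B.N0 _ ∈ _ at hmem
  rw [hN] at hmem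
  obtain ⟨N, hF⟩ := h.iterate_last hy
  have h2 := hmem.2
  rw [B.iterate_coe, B.coe_mem_II, hF] at h2
  obtain ⟨k, hk⟩ := h2
  have hp := B.hdtp
  have hq := B.hdtm
  have h1 : ((N - k : ℤ) : ℝ) < 1 := by push_cast; linarith [hk.2, hy.1, hq.1]
  have h2 : (-1 : ℝ) < ((N - k : ℤ) : ℝ) := by push_cast; linarith [hk.1, hy.2, hp.2]
  have h1' : N - k < 1 := by exact_mod_cast h1
  have h2' : -1 < N - k := by exact_mod_cast h2
  have : N = k := by lia
  simpa [this] using hk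

lemma isOpen_image (h : B.IsChain m H H' n) : IsOpen (H m '' Ioo B.dtm B.dtp) := by
  rw [isOpen_iff_mem_nhds]
  rintro _ ⟨y, hy, rfl⟩
  obtain ⟨a, hUa, hay⟩ := exists_between hy.1
  obtain ⟨b, hyb, hbU⟩ := exists_between hy.2
  have haU : a ∈ Ioo B.dtm B.dtp := ⟨hUa, hay.trans hy.2⟩
  have hbU : b ∈ Ioo B.dtm B.dtp := ⟨hy.1.trans hyb, hbU⟩
  have hsub : Icc a b ⊆ Ioo B.dtm B.dtp := Icc_subset_Ioo haU.1 hbU.2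
  have h1 := h.between le_rfl haU hy hbU (Or.inl ⟨hay, hyb.le⟩)
  have h2 := h.between le_rfl hbU hy haU (Or.inr ⟨hay.le, hyb⟩)
  have hc : ContinuousOn (H m) (uIcc a b) := by
    rw [uIcc_of_le (hay.trans hyb).le]
    exact fun z hz => (h.hasDerivAt m le_rfl z (hsub hz)).continuousAt.continuousWithinAt
  refine mem_of_superset ?_ ((intermediate_value_uIcc hc).trans
    (image_mono (by rwa [uIcc_of_le (hay.trans hyb).le])))
  rcases h1 with h1 | h1 <;> rcases h2 with h2 | h2
  · exact absurd h1.1 h2.2.not_gt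
  · exact mem_of_superset (Icc_mem_nhds h1.1 h2.2) Icc_subset_uIcc
  · exact mem_of_superset (Icc_mem_nhds h2.1 h1.2) Icc_subset_uIcc'
  · exact absurd h1.2 h2.1.not_gt

/-- A connected set of constant return time meeting the image of an inverse branch is contained
in it. -/
lemma subset_image (h : B.IsChain m H H' n) {J : Set UnitAddCircle} (hJ : IsPreconnected J)
    (hN : ∀ z ∈ J, B.N0 z = m) {y : ℝ} (hy : y ∈ Icc B.ctp B.ctm)
    (hyJ : ((H m y : ℝ) : UnitAddCircle) ∈ J) :
    ∀ x ∈ J, ∃ X ∈ Icc B.ctp B.ctm, x = (H m X : ℝ) := by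
  set A : Set UnitAddCircle := (fun z : ℝ => (H m z : UnitAddCircle)) '' Icc B.ctp B.ctm with hA
  have hAc : IsClosed A := by
    refine (isCompact_Icc.image_of_continuousOn ?_).isClosed
    refine (AddCircle.continuous_mk' 1).comp_continuousOn fun z hz => ?_
    exact (h.hasDerivAt m le_rfl z (mem_Ioo_of_mem_Icc hz)).continuousAt.continuousWithinAt
  set O : Set UnitAddCircle := (fun z : ℝ => (z : UnitAddCircle)) '' (H m '' Ioo B.dtm B.dtp)
  have hOo : IsOpen O :=
    QuotientAddGroup.isOpenMap_coe (N := AddSubgroup.zmultiples (1 : ℝ)) _ h.isOpen_image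
  have hOA : ∀ z ∈ J, z ∈ O → z ∈ A := by
    rintro _ hzJ ⟨_, ⟨z, hz, rfl⟩, rfl⟩
    exact ⟨z, h.mem_Icc_of_N0 hz (hN _ hzJ), rfl⟩
  have hAO : A ⊆ O := by
    rintro _ ⟨z, hz, rfl⟩
    exact ⟨_, ⟨z, mem_Ioo_of_mem_Icc hz, rfl⟩, rfl⟩
  intro x hx
  by_cases hxA : x ∈ A
  · obtain ⟨X, hX, rfl⟩ := hxA
    exact ⟨X, hX, rfl⟩
  · exfalso
    obtain ⟨z, hzJ, hzO, hzA⟩ := hJ O Aᶜ hOo hAc.isOpen_compl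
      (fun z _ => (em (z ∈ A)).imp (fun hz => hAO hz) id)
      ⟨_, hyJ, hAO ⟨y, hy, rfl⟩⟩ ⟨x, hx, hxA⟩
    exact hzA (hOA z hzJ hzO)

lemma orbDeriv_mul (h : B.IsChain m H H' n) {j : ℕ} (hj : j ≤ m) {y : ℝ}
    (hy : y ∈ Ioo B.dtm B.dtp) : B.orbDeriv j (H j y) * H' j y = 1 := by
  induction j with
  | zero => simp [orbDeriv, h.deriv_zero]
  | succ j ih =>
    have h1 : B.orbDeriv (j + 1) (H (j + 1) y)
        = deriv B.F (H (j + 1) y) * B.orbDeriv j (H j y) := by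
      rw [add_comm j 1, B.orbDeriv_add, add_comm 1 j]
      simp only [Function.iterate_one, h.map j hj y hy, B.orbDeriv_add_int]
      simp [orbDeriv]
    rw [h1, h.deriv_succ j hj y hy, ← ih (by lia)]
    have := h.deriv_F_ne hj hy
    field_simp

end IsChain
end BimodData

namespace BimodData
variable (B : BimodData)

/-- The inverse branches of the first return map, indexed by their images. -/
def Branch : Type :=
  {A : Set ℝ // ∃ m H H' n, B.IsChain m H H' n ∧ A = H m '' Icc B.ctp B.ctm}

variable {B}
namespace Branch

lemma exists_data (i : B.Branch) : ∃ (m : ℕ) (g g' : ℝ → ℝ), ∃ H H' n, B.IsChain m H H' n ∧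
    g = H m ∧ g' = H' m ∧ i.1 = g '' Icc B.ctp B.ctm := by
  obtain ⟨m, H, H', n, h, hA⟩ := i.2
  exact ⟨m, H m, H' m, H, H', n, h, rfl, rfl, hA⟩

/-- The return time of a branch. -/
def time (i : B.Branch) : ℕ := i.exists_data.choose

/-- The inverse branch as a map. -/
def map (i : B.Branch) : ℝ → ℝ := i.exists_data.choose_spec.choose

/-- The derivative of the inverse branch. -/
def mapDeriv (i : B.Branch) : ℝ → ℝ := i.exists_data.choose_spec.choose_spec.choose

lemma spec (i : B.Branch) : ∃ H H' n, B.IsChain i.time H H' n ∧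
    i.map = H i.time ∧ i.mapDeriv = H' i.time ∧ i.1 = i.map '' Icc B.ctp B.ctm :=
  i.exists_data.choose_spec.choose_spec.choose_spec

/-- The total return time of a word of branches. -/
def wordTime (w : List B.Branch) : ℕ := (w.map time).sum

lemma time_pos (i : B.Branch) : 1 ≤ i.time := by
  obtain ⟨H, H', n, h, -⟩ := i.spec
  exact h.pos

lemma map_mem (i : B.Branch) {y : ℝ} (hy : y ∈ Icc B.ctp B.ctm) :
    i.map y ∈ Ioo B.ctp B.ctm := by
  obtain ⟨H, H', n, h, e, -⟩ := i.spec
  rw [e]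
  exact h.last y (mem_Ioo_of_mem_Icc hy)

lemma N0_map (i : B.Branch) {y : ℝ} (hy : y ∈ Icc B.ctp B.ctm) :
    B.N0 (i.map y : ℝ) = i.time := by
  obtain ⟨H, H', n, h, e, -⟩ := i.spec
  rw [e]
  exact h.N0_eq hy

lemma iterate_map (i : B.Branch) {y : ℝ} (hy : y ∈ Icc B.ctp B.ctm) :
    ∃ N : ℤ, B.F^[i.time] (i.map y) = y + N := by
  obtain ⟨H, H', n, h, e, -⟩ := i.spec
  rw [e]
  exact h.iterate_last (mem_Ioo_of_mem_Icc hy)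

lemma T0_map (i : B.Branch) {y : ℝ} (hy : y ∈ Icc B.ctp B.ctm) :
    B.T0 (i.map y : ℝ) = y := by
  obtain ⟨N, hN⟩ := i.iterate_map hy
  rw [T0, i.N0_map hy, B.iterate_coe, hN]
  exact coe_eq_coe_iff.2 ⟨N, rfl⟩

lemma orbDeriv_map (i : B.Branch) {y : ℝ} (hy : y ∈ Icc B.ctp B.ctm) :
    B.orbDeriv i.time (i.map y) * i.mapDeriv y = 1 := by
  obtain ⟨H, H', n, h, e, e', -⟩ := i.spec
  rw [e, e']
  exact h.orbDeriv_mul le_rfl (mem_Ioo_of_mem_Icc hy)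

lemma continuousOn_map (i : B.Branch) : ContinuousOn i.map (Icc B.ctp B.ctm) := by
  obtain ⟨H, H', n, h, e, -⟩ := i.spec
  rw [e]
  exact fun y hy =>
    (h.hasDerivAt _ le_rfl y (mem_Ioo_of_mem_Icc hy)).continuousAt.continuousWithinAt

lemma subset_image (i : B.Branch) {J : Set UnitAddCircle} (hJ : IsPreconnected J)
    (hN : ∀ z ∈ J, B.N0 z = i.time) {y : ℝ} (hy : y ∈ Icc B.ctp B.ctm)
    (hyJ : ((i.map y : ℝ) : UnitAddCircle) ∈ J) :
    ∀ x ∈ J, ∃ X ∈ Icc B.ctp B.ctm, x = (i.map X : ℝ) := by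
  obtain ⟨H, H', n, h, e, -⟩ := i.spec
  rw [e] at hyJ ⊢
  exact h.subset_image hJ hN hy hyJ

lemma eq_of_map_eq {i j : B.Branch} {x y : ℝ} (hx : x ∈ Icc B.ctp B.ctm)
    (hy : y ∈ Icc B.ctp B.ctm) (h : i.map x = j.map y) : i = j := by
  have ht : i.time = j.time := by rw [← i.N0_map hx, ← j.N0_map hy, h]
  have key : ∀ {i j : B.Branch} {x y : ℝ}, x ∈ Icc B.ctp B.ctm → y ∈ Icc B.ctp B.ctm →
      i.map x = j.map y → i.time = j.time →
      i.map '' Icc B.ctp B.ctm ⊆ j.map '' Icc B.ctp B.ctm := by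
    rintro i j x y hx hy h ht _ ⟨z, hz, rfl⟩
    have hpre : IsPreconnected
        ((fun z : ℝ => ((i.map z : ℝ) : UnitAddCircle)) '' Icc B.ctp B.ctm) :=
      isPreconnected_Icc.image _ ((AddCircle.continuous_mk' 1).comp_continuousOn
        i.continuousOn_map)
    obtain ⟨X, hX, he⟩ := j.subset_image hpre
      (by rintro _ ⟨z, hz, rfl⟩; rw [← ht]; exact i.N0_map hz) hy ⟨x, hx, by simp only [h]⟩ _
      ⟨z, hz, rfl⟩
    have hlt : B.ctm < B.ctp + 1 := by linarith [B.h0, B.h2]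
    exact ⟨X, hX, coe_injOn hlt (Ioo_subset_Icc_self (j.map_mem hX))
      (Ioo_subset_Icc_self (i.map_mem hz)) he.symm⟩
  obtain ⟨-, -, -, -, -, -, hi⟩ := i.spec
  obtain ⟨-, -, -, -, -, -, hj⟩ := j.spec
  refine Subtype.ext ?_
  rw [hi, hj]
  exact (key hx hy h ht).antisymm (key hy hx h.symm ht.symm)

lemma wordMap_mem (w : List B.Branch) {y : ℝ} (hy : y ∈ Icc B.ctp B.ctm) :
    wordMap map w y ∈ Icc B.ctp B.ctm := by
  cases w with
  | nil => exact hy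
  | cons i w => exact Ioo_subset_Icc_self (i.map_mem (wordMap_mem w hy))

lemma iterate_wordMap (w : List B.Branch) {y : ℝ} (hy : y ∈ Icc B.ctp B.ctm) :
    (∃ N : ℤ, B.F^[wordTime w] (wordMap map w y) = y + N) ∧
      B.orbDeriv (wordTime w) (wordMap map w y) * wordDeriv map mapDeriv w y = 1 := by
  induction w with
  | nil => exact ⟨⟨0, by simp [wordTime, wordMap]⟩, by simp [wordTime, wordDeriv, orbDeriv]⟩
  | cons i w ih =>
    obtain ⟨⟨N, hN⟩, hd⟩ := ih
    have hz := wordMap_mem w hy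
    obtain ⟨k, hk⟩ := i.iterate_map hz
    have ht : wordTime (i :: w) = i.time + wordTime w := by simp [wordTime]
    constructor
    · refine ⟨N + k, ?_⟩
      rw [ht, add_comm, Function.iterate_add_apply, wordMap, hk, B.iterate_add_int, hN]
      push_cast; ring
    · rw [ht, B.orbDeriv_add, wordMap, hk, B.orbDeriv_add_int, wordDeriv, mul_mul_mul_comm,
        i.orbDeriv_map hz]
      rw [mul_comm] at hd
      rw [one_mul, mul_comm, hd]

lemma one_le_wordTime {w : List B.Branch} (hw : w ≠ []) : 1 ≤ wordTime w := by
  obtain ⟨i, w, rfl⟩ := List.exists_cons_of_ne_nil hw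
  have := i.time_pos
  simp only [wordTime, List.map_cons, List.sum_cons]
  lia

variable (B) in
/-- The inverse branches of the first return map form a branch system. -/
theorem exists_branchSystem :
    ∃ K, BranchSystem B.ctp B.ctm K (map (B := B)) (mapDeriv (B := B)) := by
  obtain ⟨K, hK, hdist⟩ := exists_chain_distortion B
  refine ⟨K, B.h1, hK, fun i y hy => i.map_mem hy, ?_, ?_, ?_, fun i j x hx y hy h =>
    eq_of_map_eq hx hy h, ?_⟩
  · intro i y hy
    obtain ⟨H, H', n, h, e, e', -⟩ := i.spec
    rw [e, e']
    exact h.hasDerivAt _ le_rfl y (mem_Ioo_of_mem_Icc hy)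
  · intro i y hy h0
    simpa [h0] using i.orbDeriv_map hy
  · intro i x hx y hy
    obtain ⟨H, H', n, h, e, e', -⟩ := i.spec
    rw [e']
    exact hdist _ _ _ _ h x hx y hy
  · intro w hw y hy hfix
    obtain ⟨⟨N, hN⟩, hd⟩ := iterate_wordMap w hy
    rw [hfix] at hN hd
    have hA := B.hA3 y _ (one_le_wordTime hw) ⟨N, hN⟩
    rw [(B.hasDerivAt_iterate _ _).deriv] at hA
    have hprod := congrArg abs hd
    rw [abs_mul, abs_one] at hprod
    nlinarith [abs_nonneg (wordDeriv (map (B := B)) mapDeriv w y)]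

end Branch

lemma exists_branch_of_N0 {J : Set UnitAddCircle} (hJ : IsPreconnected J) (hne : J.Nonempty)
    (hJI : J ⊆ B.II) {m : ℕ} (hm : 1 ≤ m) (hN : ∀ z ∈ J, B.N0 z = m) :
    ∃ i : B.Branch, i.time = m ∧ ∀ x ∈ J, ∃ X ∈ Icc B.ctp B.ctm, x = (i.map X : ℝ) := by
  obtain ⟨_, hxJ⟩ := hne
  obtain ⟨x, hx, rfl⟩ := hJI hxJ
  have hNx := hN _ hxJ
  simp only at hNx hxJ
  obtain ⟨H, H', n, h, y, hy, hyx⟩ := B.exists_chain_of_N0 hx (by rw [hNx]; exact hm)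
  rw [hNx] at h hyx
  let i : B.Branch := ⟨_, m, H, H', n, h, rfl⟩
  obtain ⟨-, -, -, -, -, -, hi⟩ := i.spec
  have hxi : x ∈ i.map '' Icc B.ctp B.ctm := hi ▸ ⟨y, hy, hyx⟩
  obtain ⟨z, hz, rfl⟩ := hxi
  have ht : i.time = m := by rw [← hNx, i.N0_map hz]
  exact ⟨i, ht, i.subset_image hJ (ht ▸ hN) hz hxJ⟩

/-- The iterates of the first return map are inverted by words of branches. -/
lemma exists_word (n : ℕ) {J : Set UnitAddCircle} (hJ : IsPreconnected J) (hJI : J ⊆ B.II)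
    (hN : ∀ k < n, ∃ m : ℕ, 1 ≤ m ∧ ∀ z ∈ B.T0^[k] '' J, B.N0 z = m) :
    ∃ w : List B.Branch, ∀ x ∈ J, ∃ X ∈ Icc B.ctp B.ctm,
      x = (wordMap Branch.map w X : ℝ) ∧ B.T0^[n] x = X ∧
        B.totalTime n x = Branch.wordTime w := by
  induction n generalizing J with
  | zero =>
    refine ⟨[], fun x hx => ?_⟩
    obtain ⟨X, hX, rfl⟩ := hJI hx
    exact ⟨X, hX, rfl, rfl, by simp [totalTime, Branch.wordTime]⟩
  | succ n ih =>
    rcases J.eq_empty_or_nonempty with rfl | hne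
    · exact ⟨[], by simp⟩
    obtain ⟨m, hm, hNm⟩ := hN 0 (by lia)
    rw [Function.iterate_zero, image_id] at hNm
    obtain ⟨i, hi, hiJ⟩ := exists_branch_of_N0 hJ hne hJI hm hNm
    have himg : B.T0 '' J = B.f^[m] '' J :=
      image_congr fun z hz => by rw [T0, hNm z hz]
    have hJ' : IsPreconnected (B.T0 '' J) := by
      rw [himg]
      exact hJ.image _ (B.continuous_f.iterate m).continuousOn
    have hJI' : B.T0 '' J ⊆ B.II := by
      rintro _ ⟨x, hx, rfl⟩
      obtain ⟨X, hX, rfl⟩ := hiJ x hx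
      exact ⟨X, hX, (i.T0_map hX).symm⟩
    obtain ⟨w, hw⟩ := ih hJ' hJI' (by
      intro k hk
      rw [← image_comp, ← Function.iterate_succ]
      exact hN (k + 1) (by lia))
    refine ⟨i :: w, fun x hx => ?_⟩
    obtain ⟨Z, hZ, hxZ⟩ := hiJ x hx
    obtain ⟨X, hX, h1, h2, h3⟩ := hw _ (mem_image_of_mem _ hx)
    have hTx : B.T0 x = Z := by rw [hxZ, i.T0_map hZ]
    have hZX : Z = wordMap Branch.map w X :=
      coe_injOn (by linarith [B.h0, B.h2]) hZ (Branch.wordMap_mem w hX) (hTx ▸ h1)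
    refine ⟨X, hX, ?_, ?_, ?_⟩
    · rw [hxZ, hZX, wordMap]
    · rw [Function.iterate_succ_apply, h2]
    · rw [totalTime, Finset.sum_range_succ', Function.iterate_zero, id, hNm x hx]
      simp only [Function.iterate_succ_apply]
      rw [totalTime] at h3
      rw [h3]
      simp [Branch.wordTime, hi, add_comm]

/-- On the interval `[c̃⁺, c̃⁻]` the distance of the line is controlled by the circle distance. -/
lemma mul_abs_sub_le_dist {X Y : ℝ} (hX : X ∈ Icc B.ctp B.ctm) (hY : Y ∈ Icc B.ctp B.ctm) :
    (1 - (B.ctm - B.ctp)) * |X - Y| ≤ dist (X : UnitAddCircle) Y := by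
  have h0 := B.h0
  have h1 := B.h1
  have h2 := B.h2
  have hd : |X - Y| ≤ B.ctm - B.ctp := abs_sub_le_iff.2 ⟨by linarith [hX.2, hY.1], by
    linarith [hY.2, hX.1]⟩
  have hp := abs_nonneg (X - Y)
  rw [dist_eq_norm, ← AddCircle.coe_sub, UnitAddCircle.norm_eq]
  by_cases hr : round (X - Y) = 0
  · rw [hr, Int.cast_zero, sub_zero]
    nlinarith
  · have h3 : (1 : ℝ) ≤ |(round (X - Y) : ℝ)| := by exact_mod_cast Int.one_le_abs hr
    have h4 := abs_sub_abs_le_abs_sub (round (X - Y) : ℝ) (X - Y)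
    rw [abs_sub_comm (round (X - Y) : ℝ)] at h4
    nlinarith

end BimodData

/-- **Proposition (distortion of iterates of the first return map).** For every
`f ∈ Bimod` there is `D₃ > 0` such that, for every `n ≥ 1` and every interval
`J ⊆ Int(𝕀)` such that the return time `N⁰` is finite and constant on each
`(T⁰)^k(J)` for `0 ≤ k < n`, the distortion bound
`|D(T⁰)^n(x) / D(T⁰)^n(y)| ≤ 1 + D₃ · d((T⁰)^n(x), (T⁰)^n(y))` holds on `J`. -/
theorem distortion_T0_iterates (B : BimodData) :
    ∃ D₃ > (0 : ℝ), ∀ n : ℕ, 1 ≤ n →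
      ∀ J : Set UnitAddCircle, IsPreconnected J → J ⊆ interior B.II →
      (∀ k < n, ∃ m : ℕ, 1 ≤ m ∧ ∀ z ∈ B.T0^[k] '' J, B.N0 z = m) →
      ∀ x ∈ J, ∀ y ∈ J,
        |B.DfIter (B.totalTime n x) x / B.DfIter (B.totalTime n y) y|
          ≤ 1 + D₃ * dist (B.T0^[n] x) (B.T0^[n] y) := by
  obtain ⟨K, S⟩ := BimodData.Branch.exists_branchSystem B
  obtain ⟨C, hC, hdist⟩ := S.exists_distortion
  have hL : 0 < 1 - (B.ctm - B.ctp) := by linarith [B.h0, B.h2]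
  refine ⟨C * Real.exp C / (1 - (B.ctm - B.ctp)), by positivity, ?_⟩
  intro n _ J hJ hJI hN x hx y hy
  obtain ⟨w, hw⟩ := BimodData.exists_word n hJ (hJI.trans interior_subset) hN
  obtain ⟨X, hX, hxX, hTx, htx⟩ := hw x hx
  obtain ⟨Y, hY, hyY, hTy, hty⟩ := hw y hy
  rw [hTx, hTy, htx, hty, hxX, hyY, B.DfIter_coe, B.DfIter_coe]
  have hdx := (BimodData.Branch.iterate_wordMap w hX).2
  have hdy := (BimodData.Branch.iterate_wordMap w hY).2
  set a := wordDeriv BimodData.Branch.map BimodData.Branch.mapDeriv w X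
  set b := wordDeriv BimodData.Branch.map BimodData.Branch.mapDeriv w Y
  have ha : a ≠ 0 := right_ne_zero_of_mul_eq_one hdx
  have hb : b ≠ 0 := right_ne_zero_of_mul_eq_one hdy
  rw [eq_inv_of_mul_eq_one_left hdx, eq_inv_of_mul_eq_one_left hdy, inv_div_inv, abs_div,
    div_le_iff₀ (abs_pos.2 ha)]
  have hlog : |b| ≤ Real.exp (C * |Y - X|) * |a| :=
    BranchSystem.abs_le_of_log hb ha (hdist w Y hY X hX)
  refine hlog.trans (mul_le_mul_of_nonneg_right ?_ (abs_nonneg a))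
  have hXY : |X - Y| ≤ 1 := abs_sub_le_iff.2
    ⟨by linarith [hX.2, hY.1, B.h0, B.h2], by linarith [hY.2, hX.1, B.h0, B.h2]⟩
  have hc : |X - Y| ≤ dist (X : UnitAddCircle) Y / (1 - (B.ctm - B.ctp)) := by
    rw [le_div_iff₀ hL, mul_comm]
    exact BimodData.mul_abs_sub_le_dist hX hY
  rw [abs_sub_comm Y X]
  set u := C * |X - Y| with hu
  have hu0 : 0 ≤ u := by positivity
  have huC : u ≤ C := by nlinarith
  have h1 : Real.exp u ≤ 1 + u * Real.exp u := by
    have h2 := Real.add_one_le_exp (-u)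
    have h3 : Real.exp u * Real.exp (-u) = 1 := by rw [← Real.exp_add]; simp
    nlinarith [Real.exp_pos u]
  calc Real.exp u ≤ 1 + u * Real.exp u := h1
    _ ≤ 1 + u * Real.exp C := by gcongr
    _ = 1 + C * Real.exp C * |X - Y| := by rw [hu]; ring
    _ ≤ 1 + C * Real.exp C * (dist (X : UnitAddCircle) Y / (1 - (B.ctm - B.ctp))) := by gcongr
    _ = _ := by ring
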